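/- The Hausdorff dimension of the graph {(x, W(x)) : x ∈ [0,1]} ⊂ ℝ × ℝ² of the two-dimensional Weierstrass function W equals 2. -/

import Mathlib

open Real MeasureTheory Set Filter

noncomputable section

/-- The Euclidean plane. -/
abbrev E2 : Type := EuclideanSpace ℝ (Fin 2)

/-- The unit vector `(cos t, sin t)` in the Euclidean plane. -/
def cs (t : ℝ) : E2 := (WithLp.equiv 2 (Fin 2 → ℝ)).symm ![Real.cos t, Real.sin t]

/-- The vector `(-sin t, cos t)` in the Euclidean plane. -/
def cs' (t : ℝ) : E2 := (WithLp.equiv 2 (Fin 2 → ℝ)).symm ![-Real.sin t, Real.cos t]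

/-- The two-dimensional Weierstrass function
`W(x) = ∑_{n≥0} 2^{-n/2} (cos (2π 2^n x), sin (2π 2^n x))`. -/
def Wfn (x : ℝ) : E2 := ∑' n : ℕ, (2 : ℝ) ^ (-(n : ℝ) / 2) • cs (2 * π * 2 ^ n * x)

/-- `dig j ξ` is the `j`-th binary digit of `ξ`: `⌊2^j ξ⌋ mod 2` (as a real number). -/
def dig (j : ℕ) (ξ : ℝ) : ℝ := ((⌊(2 : ℝ) ^ j * ξ⌋ % 2 : ℤ) : ℝ)

/-- `rho n ξ = ∑_{i=1}^n d_{n+1-i}(ξ) 2^{-i}`. -/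
def rho (n : ℕ) (ξ : ℝ) : ℝ := ∑ i ∈ Finset.Icc 1 n, dig (n + 1 - i) ξ / 2 ^ i

/-- `x` is a dyadic rational. -/
def dyadic (x : ℝ) : Prop := ∃ (k : ℕ) (m : ℤ), x = (m : ℝ) / 2 ^ k

/-- The stable-direction function
`S(ξ,x) = -2π ∑_{n≥1} 2^{-n/2} (-sin (2π(ρ_n(ξ)+x/2^n)), cos (2π(ρ_n(ξ)+x/2^n)))`. -/
def Sfn (ξ x : ℝ) : E2 :=
  (-(2 * π)) • ∑' n : ℕ,
    (2 : ℝ) ^ (-((n : ℝ) + 1) / 2) • cs' (2 * π * (rho (n + 1) ξ + x / 2 ^ (n + 1)))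

/-- The function `H` given by the doubly infinite series
`H(ξ,x) = ∑_{n≥0} 2^{-n/2} ((cos,sin)(2π 2^n x) - (1,0))
        + ∑_{k≥1} 2^{k/2} ((cos,sin)(2π(ρ_k(ξ)+x/2^k)) - (cos,sin)(2π ρ_k(ξ)))`. -/
def Hfn (ξ x : ℝ) : E2 :=
  (∑' n : ℕ, (2 : ℝ) ^ (-(n : ℝ) / 2) •
      (cs (2 * π * 2 ^ n * x) - (WithLp.equiv 2 (Fin 2 → ℝ)).symm ![1, 0]))
  + ∑' k : ℕ, (2 : ℝ) ^ (((k : ℝ) + 1) / 2) •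
      (cs (2 * π * (rho (k + 1) ξ + x / 2 ^ (k + 1))) - cs (2 * π * rho (k + 1) ξ))

/-- The baker transformation `B(ξ,x) = (2ξ mod 1, (⌊2ξ⌋ + x)/2)`. -/
def baker (p : ℝ × ℝ) : ℝ × ℝ :=
  (Int.fract (2 * p.1), ((⌊2 * p.1⌋ : ℝ) + p.2) / 2)

/-- The unit square `[0,1)²`. -/
def usq : Set (ℝ × ℝ) := Ico (0:ℝ) 1 ×ˢ Ico (0:ℝ) 1

/-- The explicit formula for the `N`-th backward iterate of the baker transformation:
`B^{-N}(ξ,x) = (ξ/2^N + ∑_{j=1}^N d_j(x) 2^{-(N+1-j)}, 2^N x mod 1)`. -/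
def bakerInvN (N : ℕ) (p : ℝ × ℝ) : ℝ × ℝ :=
  (p.1 / 2 ^ N + ∑ j ∈ Finset.Icc 1 N, dig j p.2 / 2 ^ (N + 1 - j),
    Int.fract ((2 : ℝ) ^ N * p.2))

/-- The contraction ratio `2^{-1/2}`. -/
def rt : ℝ := (√2)⁻¹

lemma rt_pos : 0 < rt := by unfold rt; positivity

lemma rt_sq : rt ^ 2 = 1 / 2 := by
  unfold rt
  rw [inv_pow, Real.sq_sqrt (by norm_num)]; norm_num

lemma rt_lt : rt < 0.70711 := by
  nlinarith [rt_sq, rt_pos]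

lemma lt_rt : 0.7071 < rt := by
  nlinarith [rt_sq, rt_pos]

lemma rt_le_one : rt ≤ 1 := by linarith [rt_lt]

lemma rt_pow_two_mul (n : ℕ) : rt ^ (2 * n) = (1 / 2) ^ n := by
  rw [pow_mul, rt_sq]

/-- The character `t ↦ exp (2πit)`. -/
def ex (t : ℝ) : ℂ := Complex.exp (2 * π * t * Complex.I)

lemma norm_ex (t : ℝ) : ‖ex t‖ = 1 := by
  unfold ex
  have := Complex.norm_exp_ofReal_mul_I (2 * π * t)
  push_cast at this
  exact this

lemma ex_add (s t : ℝ) : ex (s + t) = ex s * ex t := by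
  unfold ex
  rw [← Complex.exp_add]
  congr 1
  push_cast; ring

lemma ex_intCast (n : ℤ) : ex n = 1 := by
  unfold ex
  rw [Complex.exp_eq_one_iff]
  exact ⟨n, by push_cast; ring⟩

lemma ex_add_intCast (t : ℝ) (n : ℤ) : ex (t + n) = ex t := by
  rw [ex_add, ex_intCast, mul_one]

lemma ex_half : ex (1 / 2) = -1 := by
  unfold ex
  rw [← Complex.exp_pi_mul_I]
  congr 1
  push_cast; ring

lemma hasDerivAt_ex_half (z : ℝ) :
    HasDerivAt (fun z : ℝ => ex (z / 2)) (π * Complex.I * ex (z / 2)) z := by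
  have h1 : HasDerivAt (fun z : ℝ => (π * Complex.I) * (z : ℂ)) (π * Complex.I * 1) z :=
    (HasDerivAt.ofReal_comp (hasDerivAt_id z)).const_mul _
  have h2 := h1.cexp
  have e : ∀ z : ℝ, ex (z / 2) = Complex.exp ((π * Complex.I) * (z : ℂ)) := by
    intro z
    unfold ex
    congr 1
    push_cast; ring
  simp only [e]
  convert h2 using 1
  ring

/-- The `j`-th derivative of `z ↦ ∑_{k=1}^l 2^{-k/2} exp (2πi z / 2^k)`. -/
def Gd (j : ℕ) : ℕ → ℝ → ℂ
  | 0, _ => 0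
  | l + 1, z => rt * (π * Complex.I) ^ j * ex (z / 2) + (rt / 2 ^ j : ℝ) * Gd j l (z / 2)

lemma Gd_succ (j l : ℕ) (z : ℝ) :
    Gd j (l + 1) z = rt * (π * Complex.I) ^ j * ex (z / 2) + (rt / 2 ^ j : ℝ) * Gd j l (z / 2) :=
  rfl

lemma hasDerivAt_Gd (j l : ℕ) (z : ℝ) : HasDerivAt (Gd j l) (Gd (j + 1) l z) z := by
  induction l generalizing z with
  | zero => exact hasDerivAt_const z 0
  | succ l ih =>
    have h1 := (hasDerivAt_ex_half z).const_mul (rt * (π * Complex.I) ^ j : ℂ)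
    have h2 : HasDerivAt (fun z : ℝ => Gd j l (z / 2)) ((1 / 2 : ℝ) • Gd (j + 1) l (z / 2)) z :=
      HasDerivAt.scomp z (ih (z / 2)) ((hasDerivAt_id z).div_const 2)
    have h3 := h1.add (h2.const_mul ((rt / 2 ^ j : ℝ) : ℂ))
    have e : Gd j (l + 1) = fun z => rt * (π * Complex.I) ^ j * ex (z / 2) +
        (rt / 2 ^ j : ℝ) * Gd j l (z / 2) := by
      funext z; exact Gd_succ j l z
    rw [e]
    refine h3.congr_deriv ?_
    rw [Gd_succ, Complex.real_smul]
    push_cast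
    ring

lemma Gd_add (j m l : ℕ) (z : ℝ) :
    Gd j (m + l) z = Gd j m z + ((rt / 2 ^ j) ^ m : ℝ) * Gd j l (z / 2 ^ m) := by
  induction m generalizing z with
  | zero => simp [Gd]
  | succ m ih =>
    rw [show m + 1 + l = (m + l) + 1 by ring, Gd_succ, Gd_succ, ih]
    have : z / 2 / 2 ^ m = z / 2 ^ (m + 1) := by field_simp; ring
    rw [this]
    push_cast
    ring

lemma Gd_add_mul (j l : ℕ) (z : ℝ) (c : ℤ) : Gd j l (z + 2 ^ l * c) = Gd j l z := by
  induction l generalizing z with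
  | zero => simp [Gd]
  | succ l ih =>
    have h1 : (z + 2 ^ (l + 1) * c) / 2 = z / 2 + 2 ^ l * c := by ring
    have h2 : ex (z / 2 + 2 ^ l * c) = ex (z / 2) := by
      have := ex_add_intCast (z / 2) (2 ^ l * c)
      push_cast at this
      exact this
    rw [Gd_succ, Gd_succ, h1, ih, h2]

lemma norm_Gd_succ_le (j l : ℕ) (z : ℝ) :
    ‖Gd j (l + 1) z‖ ≤ rt * π ^ j + rt / 2 ^ j * ‖Gd j l (z / 2)‖ := by
  rw [Gd_succ]
  refine (norm_add_le _ _).trans (add_le_add ?_ ?_)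
  · rw [norm_mul, norm_mul, norm_pow, norm_mul, norm_ex, Complex.norm_I, Complex.norm_real,
      Complex.norm_real, Real.norm_of_nonneg rt_pos.le, Real.norm_of_nonneg pi_pos.le]
    simp
  · rw [norm_mul, Complex.norm_real, Real.norm_of_nonneg (by have := rt_pos; positivity)]

lemma norm_Gd_zero_le (l : ℕ) (z : ℝ) : ‖Gd 0 l z‖ ≤ 2.5 := by
  induction l generalizing z with
  | zero => simp [Gd]; norm_num
  | succ l ih =>
    have h1 := norm_Gd_succ_le 0 l z
    have h2 := ih (z / 2)
    have h3 := rt_lt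
    have h4 := rt_pos
    simp only [pow_zero, mul_one, div_one] at h1
    nlinarith [norm_nonneg (Gd 0 l (z / 2))]

lemma norm_Gd_one_le (l : ℕ) (z : ℝ) : ‖Gd 1 l z‖ ≤ 3.45 := by
  induction l generalizing z with
  | zero => simp [Gd]; norm_num
  | succ l ih =>
    have h1 := norm_Gd_succ_le 1 l z
    have h2 := ih (z / 2)
    have h3 := rt_lt
    have h4 := rt_pos
    have h5 := pi_lt_d4
    have h6 := pi_pos
    simp only [pow_one] at h1
    have h7 : rt * π ≤ 0.70711 * 3.1416 := by gcongr
    have h8 : rt / 2 * ‖Gd 1 l (z / 2)‖ ≤ 0.70711 / 2 * 3.45 := by gcongr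
    linarith

lemma norm_Gd_two_le (l : ℕ) (z : ℝ) : ‖Gd 2 l z‖ ≤ 8.5 := by
  induction l generalizing z with
  | zero => simp [Gd]; norm_num
  | succ l ih =>
    have h1 := norm_Gd_succ_le 2 l z
    have h2 := ih (z / 2)
    have h3 := rt_lt
    have h4 := rt_pos
    have h5 := pi_lt_d4
    have h6 := pi_pos
    have h7 : rt * π ^ 2 ≤ 0.70711 * 3.1416 ^ 2 := by gcongr
    have h8 : rt / 2 ^ 2 * ‖Gd 2 l (z / 2)‖ ≤ 0.70711 / 2 ^ 2 * 8.5 := by gcongr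
    linarith

/-- Transversality: at an odd integer distance, the first two derivatives of the
difference cannot both be nearly orthogonal to a given direction. -/
lemma transversality {l : ℕ} (hl : 1 ≤ l) {d : ℤ} (hd : Odd d) {θ : ℂ} (hθ : ‖θ‖ = 1) (z : ℝ)
    (h : |(θ * (Gd 1 l (z + d) - Gd 1 l z)).re| ≤ 0.4) :
    1 / 2 ≤ |(θ * (Gd 2 l (z + d) - Gd 2 l z)).re| ∧
      1 / 2 ≤ |(θ * (Gd 1 l (z + d) - Gd 1 l z)).im| := by
  obtain ⟨l, rfl⟩ : ∃ k, l = k + 1 := ⟨l - 1, by omega⟩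
  obtain ⟨n, rfl⟩ := hd
  have hex : ex ((z + (2 * n + 1 : ℤ)) / 2) = - ex (z / 2) := by
    have : (z + ((2 * n + 1 : ℤ) : ℝ)) / 2 = z / 2 + 1 / 2 + n := by push_cast; ring
    rw [this, ex_add_intCast, ex_add, ex_half]; ring
  set z' : ℝ := (z + (2 * n + 1 : ℤ)) / 2 with hz'
  set A : ℂ := θ * (-2 * rt * (π * Complex.I) * ex (z / 2)) with hA
  set r1 : ℂ := θ * ((rt / 2 ^ 1 : ℝ) * (Gd 1 l z' - Gd 1 l (z / 2))) with hr1
  set r2 : ℂ := θ * ((rt / 2 ^ 2 : ℝ) * (Gd 2 l z' - Gd 2 l (z / 2))) with hr2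
  have e1 : θ * (Gd 1 (l + 1) (z + (2 * n + 1 : ℤ)) - Gd 1 (l + 1) z) = A + r1 := by
    rw [Gd_succ, Gd_succ, ← hz', hex, hA, hr1]; ring
  have e2 : θ * (Gd 2 (l + 1) (z + (2 * n + 1 : ℤ)) - Gd 2 (l + 1) z)
      = (π * Complex.I) * A + r2 := by
    rw [Gd_succ, Gd_succ, ← hz', hex, hA, hr2]; ring
  rw [e1] at h ⊢
  rw [e2]
  have hp := rt_pos
  have hrt := rt_lt
  have hpi := pi_gt_d4
  have nA : ‖A‖ = 2 * rt * π := by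
    rw [hA, norm_mul, hθ, norm_mul, norm_mul, norm_mul, norm_mul, norm_ex, Complex.norm_I,
      Complex.norm_real, Complex.norm_real, Real.norm_of_nonneg hp.le,
      Real.norm_of_nonneg pi_pos.le]
    simp
  have n1 : ‖r1‖ ≤ 2.44 := by
    rw [hr1, norm_mul, hθ, norm_mul, Complex.norm_real, Real.norm_of_nonneg (by positivity)]
    have := (norm_sub_le (Gd 1 l z') (Gd 1 l (z / 2)))
    have b1 := norm_Gd_one_le l z'
    have b2 := norm_Gd_one_le l (z / 2)
    have : rt / 2 ^ 1 * ‖Gd 1 l z' - Gd 1 l (z / 2)‖ ≤ 0.70711 / 2 ^ 1 * 6.9 := by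
      gcongr; linarith
    linarith
  have n2 : ‖r2‖ ≤ 3.01 := by
    rw [hr2, norm_mul, hθ, norm_mul, Complex.norm_real, Real.norm_of_nonneg (by positivity)]
    have := (norm_sub_le (Gd 2 l z') (Gd 2 l (z / 2)))
    have b1 := norm_Gd_two_le l z'
    have b2 := norm_Gd_two_le l (z / 2)
    have : rt / 2 ^ 2 * ‖Gd 2 l z' - Gd 2 l (z / 2)‖ ≤ 0.70711 / 2 ^ 2 * 17 := by
      gcongr; linarith
    linarith
  have a1 : 4.44 ≤ ‖A‖ := by
    rw [nA]
    nlinarith [lt_rt]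
  have sA : A.re ^ 2 + A.im ^ 2 = ‖A‖ ^ 2 := by
    rw [Complex.sq_norm, Complex.normSq_apply]; ring
  have r1re := (Complex.abs_re_le_norm r1).trans n1
  have r1im := (Complex.abs_im_le_norm r1).trans n1
  have r2re := (Complex.abs_re_le_norm r2).trans n2
  have hre : |A.re| ≤ 2.84 := by
    rw [Complex.add_re] at h
    have := abs_sub_abs_le_abs_sub A.re (-r1.re)
    rw [abs_neg, sub_neg_eq_add] at this
    linarith
  have him : 3.4 ≤ |A.im| := by
    have h5 : A.re ^ 2 ≤ 2.84 ^ 2 := by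
      rw [← sq_abs]; gcongr
    have h6 : (3.4 : ℝ) ^ 2 ≤ A.im ^ 2 := by nlinarith
    rw [← sq_abs A.im] at h6
    exact le_of_sq_le_sq h6 (abs_nonneg _)
  constructor
  · have e3 : ((π * Complex.I) * A + r2).re = r2.re - π * A.im := by
      simp [Complex.add_re, Complex.mul_re]; ring
    rw [e3]
    have := abs_sub_abs_le_abs_sub (π * A.im) r2.re
    rw [abs_mul, abs_of_pos pi_pos, abs_sub_comm] at this
    nlinarith
  · rw [Complex.add_im]
    have := abs_sub_abs_le_abs_sub A.im (-r1.im)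
    rw [abs_neg, sub_neg_eq_add] at this
    linarith

lemma sum_range_mul_eq {M K : ℕ} (F : ℕ → ℝ) :
    ∑ x ∈ Finset.range (M * K), F x =
      ∑ a ∈ Finset.range M, ∑ c ∈ Finset.range K, F (a + M * c) := by
  induction K with
  | zero => simp
  | succ K ih =>
    rw [Nat.mul_succ, Finset.sum_range_add, ih]
    simp_rw [Finset.sum_range_succ, Finset.sum_add_distrib]
    congr 1
    exact Finset.sum_congr rfl fun a _ => by rw [add_comm]

lemma sum_range_two_pow_add (i s : ℕ) (F : ℕ → ℝ) :
    ∑ x ∈ Finset.range (2 ^ (i + s)), F x =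
      ∑ a ∈ Finset.range (2 ^ i), ∑ c ∈ Finset.range (2 ^ s), F (a + 2 ^ i * c) := by
  rw [pow_add, sum_range_mul_eq]

lemma sum_sum_range_two_pow_add (i s : ℕ) (F : ℕ → ℕ → ℝ) :
    ∑ x ∈ Finset.range (2 ^ (i + s)), ∑ y ∈ Finset.range (2 ^ (i + s)), F x y =
      ∑ a ∈ Finset.range (2 ^ i), ∑ b ∈ Finset.range (2 ^ i),
        ∑ c ∈ Finset.range (2 ^ s), ∑ d ∈ Finset.range (2 ^ s),
          F (a + 2 ^ i * c) (b + 2 ^ i * d) := by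
  rw [sum_range_two_pow_add]
  refine Finset.sum_congr rfl fun a _ => ?_
  simp_rw [sum_range_two_pow_add i s]
  rw [Finset.sum_comm]

lemma near_of_floor_eq {δ : ℝ} (hδ : 0 < δ) {a b : ℝ} (h : ⌊a / δ⌋ = ⌊b / δ⌋) : |a - b| ≤ δ := by
  have := Int.abs_sub_lt_one_of_floor_eq_floor h
  rw [← sub_div, abs_div, abs_of_pos hδ, div_lt_one hδ] at this
  exact this.le

lemma sum_sq_cell_le {α : Type*} (r : Finset α) (v : α → ℝ) (hv : ∀ i, 0 ≤ v i) (X : α → ℝ)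
    {δ : ℝ} (hδ : 0 < δ) (S : Finset ℤ) (e : ℤ) :
    ∑ k ∈ S, (∑ i ∈ r, if ⌊X i / δ⌋ = k + e then v i else 0) ^ 2 ≤
      ∑ i ∈ r, ∑ i' ∈ r, if |X i - X i'| ≤ δ then v i * v i' else 0 := by
  simp_rw [sq, Finset.sum_mul_sum]
  rw [Finset.sum_comm]
  refine Finset.sum_le_sum fun i _ => ?_
  rw [Finset.sum_comm]
  refine Finset.sum_le_sum fun i' _ => ?_
  by_cases h : ⌊X i / δ⌋ = ⌊X i' / δ⌋
  · rw [if_pos (near_of_floor_eq hδ h)]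
    have : ∀ k ∈ S, ((if ⌊X i / δ⌋ = k + e then v i else 0) *
        (if ⌊X i' / δ⌋ = k + e then v i' else 0)) =
        if k = ⌊X i / δ⌋ - e then v i * v i' else 0 := by
      intro k _
      rw [← h]
      by_cases hk : ⌊X i / δ⌋ = k + e
      · rw [if_pos hk, if_pos hk, if_pos (by omega)]
      · rw [if_neg hk, zero_mul, if_neg (by omega)]
    rw [Finset.sum_congr rfl this, Finset.sum_ite_eq']
    split_ifs
    · exact le_rfl
    · exact mul_nonneg (hv _) (hv _)
  · have : ∀ k ∈ S, ((if ⌊X i / δ⌋ = k + e then v i else 0) *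
        (if ⌊X i' / δ⌋ = k + e then v i' else 0)) = 0 := by
      intro k _
      by_cases hk : ⌊X i / δ⌋ = k + e
      · rw [if_neg (show ¬ ⌊X i' / δ⌋ = k + e by omega), mul_zero]
      · rw [if_neg hk, zero_mul]
    rw [Finset.sum_eq_zero this]
    split_ifs
    · exact mul_nonneg (hv _) (hv _)
    · exact le_rfl

/-- Correlations of two weighted point sets at scale `δ` are controlled by their
autocorrelations. -/
lemma sum_sum_near_le {ι κ : Type*} (s : Finset ι) (t : Finset κ) (w : ι → ℝ) (w' : κ → ℝ)
    (hw : ∀ i, 0 ≤ w i) (hw' : ∀ i, 0 ≤ w' i) (x : ι → ℝ) (y : κ → ℝ) {δ : ℝ} (hδ : 0 < δ) :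
    ∑ i ∈ s, ∑ j ∈ t, (if |y j - x i| ≤ δ then w i * w' j else 0) ≤
      3 * (√(∑ i ∈ s, ∑ i' ∈ s, if |x i - x i'| ≤ δ then w i * w i' else 0) *
        √(∑ j ∈ t, ∑ j' ∈ t, if |y j - y j'| ≤ δ then w' j * w' j' else 0)) := by
  classical
  set p : ι → ℤ := fun i => ⌊x i / δ⌋ with hp
  set q : κ → ℤ := fun j => ⌊y j / δ⌋ with hq
  have far : ∀ a b : ℝ, |b - a| ≤ δ → ⌊b / δ⌋ - ⌊a / δ⌋ ∈ ({-1, 0, 1} : Finset ℤ) := by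
    intro a b h
    have h1 : |b / δ - a / δ| ≤ 1 := by
      rw [← sub_div, abs_div, abs_of_pos hδ, div_le_one hδ]; exact h
    rw [abs_le] at h1
    have := Int.floor_le (a / δ)
    have := Int.lt_floor_add_one (a / δ)
    have := Int.floor_le (b / δ)
    have := Int.lt_floor_add_one (b / δ)
    have h2 : ⌊b / δ⌋ - ⌊a / δ⌋ < 2 := by
      have : ((⌊b / δ⌋ - ⌊a / δ⌋ : ℤ) : ℝ) < 2 := by push_cast; linarith
      exact_mod_cast this
    have h3 : -2 < ⌊b / δ⌋ - ⌊a / δ⌋ := by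
      have : (-2 : ℝ) < ((⌊b / δ⌋ - ⌊a / δ⌋ : ℤ) : ℝ) := by push_cast; linarith
      exact_mod_cast this
    simp only [Finset.mem_insert, Finset.mem_singleton]
    omega
  set S : Finset ℤ := s.image p
  set P : ℝ := ∑ i ∈ s, ∑ i' ∈ s, if |x i - x i'| ≤ δ then w i * w i' else 0
  set Q : ℝ := ∑ j ∈ t, ∑ j' ∈ t, if |y j - y j'| ≤ δ then w' j * w' j' else 0
  have key : ∀ e : ℤ, ∑ i ∈ s, ∑ j ∈ t, (if q j - p i = e then w i * w' j else 0) ≤ √P * √Q := by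
    intro e
    have h1 : ∑ i ∈ s, ∑ j ∈ t, (if q j - p i = e then w i * w' j else 0) =
        ∑ k ∈ S, (∑ i ∈ s, if ⌊x i / δ⌋ = k + 0 then w i else 0) *
          (∑ j ∈ t, if ⌊y j / δ⌋ = k + e then w' j else 0) := by
      simp_rw [Finset.sum_mul_sum]
      conv_rhs => rw [Finset.sum_comm]
      refine Finset.sum_congr rfl fun i hi => ?_
      conv_rhs => rw [Finset.sum_comm]
      refine Finset.sum_congr rfl fun j _ => ?_
      rw [Finset.sum_eq_single (p i)]
      · rw [if_pos (show ⌊x i / δ⌋ = p i + 0 by simp [hp])]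
        by_cases h : q j - p i = e
        · rw [if_pos h, if_pos (by simp only [hq] at h; linarith)]
        · rw [if_neg h, if_neg (by intro h'; apply h; simp only [hq]; linarith), mul_zero]
      · intro k _ hk
        rw [if_neg (by rw [add_zero]; exact fun h => hk h.symm), zero_mul]
      · intro h; exact absurd (Finset.mem_image_of_mem p hi) h
    rw [h1]
    refine (Real.sum_mul_le_sqrt_mul_sqrt _ _ _).trans ?_
    gcongr
    · exact sum_sq_cell_le s w hw x hδ S 0
    · exact sum_sq_cell_le t w' hw' y hδ S e
  calc ∑ i ∈ s, ∑ j ∈ t, (if |y j - x i| ≤ δ then w i * w' j else 0)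
      ≤ ∑ i ∈ s, ∑ j ∈ t, ∑ e ∈ ({-1, 0, 1} : Finset ℤ),
          (if q j - p i = e then w i * w' j else 0) := by
        refine Finset.sum_le_sum fun i _ => Finset.sum_le_sum fun j _ => ?_
        rw [Finset.sum_ite_eq]
        split_ifs with h1 h2 h2
        · exact le_rfl
        · exact absurd (far _ _ h1) h2
        · exact mul_nonneg (hw _) (hw' _)
        · exact le_rfl
    _ = ∑ e ∈ ({-1, 0, 1} : Finset ℤ), ∑ i ∈ s, ∑ j ∈ t,
          (if q j - p i = e then w i * w' j else 0) := by
        simp_rw [Finset.sum_comm (s := t)]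
        rw [Finset.sum_comm]
    _ ≤ ∑ e ∈ ({-1, 0, 1} : Finset ℤ), √P * √Q := Finset.sum_le_sum fun e _ => key e
    _ = 3 * (√P * √Q) := by
        rw [Finset.sum_const, show Finset.card ({-1, 0, 1} : Finset ℤ) = 3 from rfl]
        simp

/-- Lebesgue measure on the unit interval. -/
abbrev lebI : Measure ℝ := volume.restrict (Ico 0 1)

instance : IsProbabilityMeasure lebI := ⟨by simp [lebI]⟩

/-- The length of the part of a set that lies in the unit interval. -/
def vl (S : Set ℝ) : ℝ := lebI.real S

lemma vl_nonneg (S : Set ℝ) : 0 ≤ vl S := measureReal_nonneg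

lemma vl_le_one (S : Set ℝ) : vl S ≤ 1 := measureReal_le_one

lemma vl_mono {S T : Set ℝ} (h : S ⊆ T) : vl S ≤ vl T := measureReal_mono h

lemma vl_inter_Ico (S : Set ℝ) : vl (S ∩ Ico 0 1) = vl S := by
  simp only [vl, measureReal_def, lebI]
  rw [Measure.restrict_apply' measurableSet_Ico, Measure.restrict_apply' measurableSet_Ico,
    inter_assoc, inter_self]

lemma vl_mono' {S T : Set ℝ} (h : ∀ u ∈ Ico (0 : ℝ) 1, u ∈ S → u ∈ T) : vl S ≤ vl T := by
  rw [← vl_inter_Ico S]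
  exact vl_mono fun u hu => h u hu.2 hu.1

lemma vl_union_le (S T : Set ℝ) : vl (S ∪ T) ≤ vl S + vl T := measureReal_union_le S T

lemma vl_biUnion_le {ι : Type*} (s : Finset ι) (S : ι → Set ℝ) :
    vl (⋃ i ∈ s, S i) ≤ ∑ i ∈ s, vl (S i) := measureReal_biUnion_finset_le s S

lemma vl_le_of_dist_le {S : Set ℝ} {δ : ℝ} (hδ : 0 ≤ δ) (h : ∀ u ∈ S, ∀ v ∈ S, |u - v| ≤ δ) :
    vl S ≤ δ := by
  have h1 : lebI S ≤ ENNReal.ofReal δ :=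
    calc lebI S ≤ volume S := Measure.restrict_apply_le _ _
      _ ≤ Metric.ediam S := Real.volume_le_diam S
      _ ≤ ENNReal.ofReal δ := by
        refine Metric.ediam_le fun u hu v hv => ?_
        rw [edist_dist, Real.dist_eq]
        exact ENNReal.ofReal_le_ofReal (h u hu v hv)
  exact ENNReal.toReal_le_of_le_ofReal hδ h1

/-- The `k`-th of `N` equal windows of the unit interval. -/
def win (N k : ℕ) : Set ℝ := Ico ((k : ℝ) / N) ((k + 1) / N)

lemma exists_mem_win {N : ℕ} (hN : 0 < N) {u : ℝ} (hu : u ∈ Ico (0 : ℝ) 1) :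
    ∃ k ∈ Finset.range N, u ∈ win N k := by
  have hN' : (0 : ℝ) < N := by exact_mod_cast hN
  refine ⟨⌊u * N⌋₊, ?_, ?_, ?_⟩
  · rw [Finset.mem_range, Nat.floor_lt (mul_nonneg hu.1 hN'.le)]
    nlinarith [hu.2]
  · rw [div_le_iff₀ hN']
    exact Nat.floor_le (mul_nonneg hu.1 hN'.le)
  · rw [lt_div_iff₀ hN']
    exact Nat.lt_floor_add_one _

lemma abs_sub_le_of_mem_win {N k : ℕ} {u v : ℝ} (hu : u ∈ win N k) (hv : v ∈ win N k) :
    |u - v| ≤ 1 / N := by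
  obtain ⟨h1, h2⟩ := hu
  obtain ⟨h3, h4⟩ := hv
  rw [add_div] at h2 h4
  rw [abs_le]; constructor <;> linarith

lemma left_mem_win {N : ℕ} (hN : 0 < N) (k : ℕ) : (k : ℝ) / N ∈ win N k := by
  have hN' : (0 : ℝ) < N := by exact_mod_cast hN
  refine ⟨le_rfl, ?_⟩
  gcongr; linarith

lemma win_subset_Ico {N k : ℕ} (hk : k ∈ Finset.range N) : win N k ⊆ Ico 0 1 := by
  rw [Finset.mem_range] at hk
  have hN' : (0 : ℝ) < N := by exact_mod_cast (by omega : 0 < N)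
  refine fun u hu => ⟨le_trans (by positivity) hu.1, hu.2.trans_le ?_⟩
  rw [div_le_one hN']
  exact_mod_cast hk

lemma vl_win {N k : ℕ} (hk : k ∈ Finset.range N) : vl (win N k) = 1 / N := by
  rw [vl, measureReal_def, lebI, Measure.restrict_apply' measurableSet_Ico,
    inter_eq_left.2 (win_subset_Ico hk), win, Real.volume_Ico, add_div, add_sub_cancel_left]
  exact ENNReal.toReal_ofReal (by positivity)

lemma vl_le_sum_win {N : ℕ} (hN : 0 < N) {E : Set ℝ} {P : ℕ → Prop} [DecidablePred P] {δ : ℝ} (hδ : 0 ≤ δ)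
    (h : ∀ k ∈ Finset.range N, ∀ u ∈ E, u ∈ win N k →
      P k ∧ ∀ v ∈ E, v ∈ win N k → |u - v| ≤ δ) :
    vl E ≤ ∑ k ∈ Finset.range N, if P k then δ else 0 := by
  have h1 : vl E ≤ vl (⋃ k ∈ Finset.range N, E ∩ win N k) := by
    refine vl_mono' fun u hu hE => ?_
    obtain ⟨k, hk, hku⟩ := exists_mem_win hN hu
    exact mem_biUnion hk ⟨hE, hku⟩
  refine h1.trans ((vl_biUnion_le _ _).trans (Finset.sum_le_sum fun k hk => ?_))
  split_ifs with hP
  · exact vl_le_of_dist_le hδ fun u hu v hv => (h k hk u hu.1 hu.2).2 v hv.1 hv.2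
  · have : E ∩ win N k = ∅ := by
      rw [eq_empty_iff_forall_notMem]
      exact fun u hu => hP (h k hk u hu.1 hu.2).1
    rw [this]
    simp [vl]

lemma pairwise_disjoint_win (N : ℕ) : Pairwise (Function.onFun Disjoint (win N)) := by
  intro k l hkl
  rcases Nat.eq_zero_or_pos N with rfl | hN
  · simp [win, Function.onFun]
  have hN' : (0 : ℝ) < N := by exact_mod_cast hN
  rw [Function.onFun, Set.disjoint_left]
  rintro u ⟨h1, h2⟩ ⟨h3, h4⟩
  have h5 : (k : ℝ) / N < (l + 1) / N := h1.trans_lt h4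
  have h6 : (l : ℝ) / N < (k + 1) / N := h3.trans_lt h2
  rw [div_lt_div_iff_of_pos_right hN'] at h5 h6
  have h7 : k < l + 1 := by exact_mod_cast h5
  have h8 : l < k + 1 := by exact_mod_cast h6
  omega

open scoped Classical in
lemma sum_win_subset_le {N : ℕ} (hN : 0 < N) (E : Set ℝ) :
    ∑ k ∈ Finset.range N, (if win N k ⊆ E then (1 : ℝ) else 0) ≤ N * vl E := by
  have hN' : (0 : ℝ) < N := by exact_mod_cast hN
  have h1 : ∑ k ∈ Finset.range N, (lebI.restrict E).real (win N k) ≤ (lebI.restrict E).real univ := by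
    rw [← measureReal_biUnion_finset (fun k _ l _ h => pairwise_disjoint_win N h)
      (fun k _ => measurableSet_Ico)]
    exact measureReal_mono (subset_univ _)
  have h2 : (lebI.restrict E).real univ = vl E := by
    rw [measureReal_def, Measure.restrict_apply_univ]; rfl
  rw [h2] at h1
  have h3 : ∑ k ∈ Finset.range N, (if win N k ⊆ E then (1 : ℝ) else 0) ≤
      ∑ k ∈ Finset.range N, N * (lebI.restrict E).real (win N k) := by
    refine Finset.sum_le_sum fun k hk => ?_
    split_ifs with h
    · rw [measureReal_def, Measure.restrict_apply (show MeasurableSet (win N k) from measurableSet_Ico),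
        inter_eq_left.2 h]
      change 1 ≤ N * vl (win N k)
      rw [vl_win hk]
      field_simp; rfl
    · positivity
  rw [← Finset.mul_sum] at h3
  exact h3.trans (by gcongr)

lemma abs_sub_le_of_hasDerivAt {f f' : ℝ → ℝ} (hf : ∀ x, HasDerivAt f (f' x) x) {B u v : ℝ}
    (h : ∀ x, |x - u| ≤ |v - u| → |f' x| ≤ B) : |f v - f u| ≤ B * |v - u| := by
  have := Convex.norm_image_sub_le_of_norm_hasDerivWithin_le (f := f) (f' := f') (C := B)
    (s := Metric.closedBall u |v - u|) (x := u) (y := v)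
    (fun x _ => (hf x).hasDerivWithinAt) (fun x hx => h x (by simpa [Real.dist_eq] using hx))
    (convex_closedBall _ _) (by simp) (by simp [Real.dist_eq])
  simpa using this

lemma le_abs_sub_of_hasDerivAt {f f' : ℝ → ℝ} (hf : ∀ x, HasDerivAt f (f' x) x) {B u v : ℝ}
    (h : ∀ x, |x - u| ≤ |v - u| → B ≤ |f' x|) : B * |v - u| ≤ |f v - f u| := by
  rcases lt_trichotomy u v with huv | huv | huv
  · obtain ⟨c, hc, hc'⟩ := exists_hasDerivAt_eq_slope f f' huv
      (fun x _ => (hf x).continuousAt.continuousWithinAt) (fun x _ => hf x)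
    have := h c (by rw [abs_of_pos (by linarith [hc.1]), abs_of_pos (by linarith)]; linarith [hc.2])
    rw [hc', abs_div, le_div_iff₀ (abs_pos.2 (by linarith))] at this
    exact this
  · simp [huv]
  · obtain ⟨c, hc, hc'⟩ := exists_hasDerivAt_eq_slope f f' huv
      (fun x _ => (hf x).continuousAt.continuousWithinAt) (fun x _ => hf x)
    have := h c (by rw [abs_of_neg (by linarith [hc.2]), abs_of_neg (by linarith)]; linarith [hc.1])
    rw [hc', abs_div, le_div_iff₀ (abs_pos.2 (by linarith)), abs_sub_comm u v,
      abs_sub_comm (f u)] at this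
    exact this

lemma norm_Gd_zero_sub_le (l : ℕ) (x y : ℝ) : ‖Gd 0 l x - Gd 0 l y‖ ≤ 3.45 * |x - y| := by
  have := Convex.norm_image_sub_le_of_norm_hasDerivWithin_le (f := Gd 0 l) (f' := Gd 1 l)
    (C := 3.45) (s := univ) (x := y) (y := x)
    (fun x _ => (hasDerivAt_Gd 0 l x).hasDerivWithinAt) (fun x _ => norm_Gd_one_le l x)
    convex_univ (mem_univ _) (mem_univ _)
  simpa using this

/-- The difference of two translates of `Gd j l`. -/
def Df (j l a b : ℕ) (u : ℝ) : ℂ := Gd j l (u + b) - Gd j l (u + a)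

lemma hasDerivAt_Df (j l a b : ℕ) (u : ℝ) : HasDerivAt (Df j l a b) (Df (j + 1) l a b u) u :=
  ((hasDerivAt_Gd j l (u + b)).comp_add_const u b).sub
    ((hasDerivAt_Gd j l (u + a)).comp_add_const u a)

lemma norm_Df_one_le (l a b : ℕ) (u : ℝ) : ‖Df 1 l a b u‖ ≤ 6.9 := by
  have h1 := norm_Gd_one_le l (u + b)
  have h2 := norm_Gd_one_le l (u + a)
  exact (norm_sub_le _ _).trans (by linarith)

lemma norm_Df_two_le (l a b : ℕ) (u : ℝ) : ‖Df 2 l a b u‖ ≤ 17 := by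
  have h1 := norm_Gd_two_le l (u + b)
  have h2 := norm_Gd_two_le l (u + a)
  exact (norm_sub_le _ _).trans (by linarith)

lemma Gd_add_split (j i s a c : ℕ) (u : ℝ) :
    Gd j (i + s) (u + (a + 2 ^ i * c : ℕ)) =
      Gd j i (u + a) + ((rt / 2 ^ j) ^ i : ℝ) * Gd j s ((u + a) / 2 ^ i + c) := by
  have h1 := Gd_add_mul j i (u + a) c
  have h2 : u + ((a + 2 ^ i * c : ℕ) : ℝ) = u + a + 2 ^ i * ((c : ℤ) : ℝ) := by push_cast; ring
  rw [h2, Gd_add, h1]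
  congr 3
  field_simp
  push_cast
  ring

lemma Df_add_split (j i s a b c d : ℕ) (u : ℝ) :
    Df j (i + s) (a + 2 ^ i * c) (b + 2 ^ i * d) u =
      Df j i a b u + ((rt / 2 ^ j) ^ i : ℝ) *
        (Gd j s ((u + b) / 2 ^ i + d) - Gd j s ((u + a) / 2 ^ i + c)) := by
  rw [Df, Df, Gd_add_split, Gd_add_split]
  ring

lemma norm_Df_zero_split_le (i s a b c d : ℕ) (u : ℝ) :
    ‖Df 0 (i + s) (a + 2 ^ i * c) (b + 2 ^ i * d) u - Df 0 i a b u‖ ≤ 5 * rt ^ i := by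
  have hp := rt_pos
  rw [Df_add_split, add_sub_cancel_left, norm_mul, Complex.norm_real, mul_comm]
  gcongr
  · have h1 := norm_Gd_zero_le s ((u + b) / 2 ^ i + d)
    have h2 := norm_Gd_zero_le s ((u + a) / 2 ^ i + c)
    exact (norm_sub_le _ _).trans (by linarith)
  · rw [pow_zero, div_one, Real.norm_of_nonneg (by positivity)]

lemma norm_Df_one_split_le (i s a b c d : ℕ) (u : ℝ) :
    ‖Df 1 (i + s) (a + 2 ^ i * c) (b + 2 ^ i * d) u - Df 1 i a b u‖ ≤ 6.9 * rt ^ i := by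
  have hp := rt_pos
  rw [Df_add_split, add_sub_cancel_left, norm_mul, Complex.norm_real, mul_comm]
  gcongr
  · have h1 := norm_Gd_one_le s ((u + b) / 2 ^ i + d)
    have h2 := norm_Gd_one_le s ((u + a) / 2 ^ i + c)
    exact (norm_sub_le _ _).trans (by linarith)
  · rw [Real.norm_of_nonneg (by positivity)]
    gcongr
    linarith

/-- The component of `Df j l a b` in the direction `θ`. -/
def ph (θ : ℂ) (j l a b : ℕ) (u : ℝ) : ℝ := (θ * Df j l a b u).re

lemma hasDerivAt_ph (θ : ℂ) (j l a b : ℕ) (u : ℝ) :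
    HasDerivAt (ph θ j l a b) (ph θ (j + 1) l a b u) u := by
  have h := (hasDerivAt_Df j l a b u).const_mul θ
  exact (Complex.reCLM.hasFDerivAt.comp_hasDerivAt u h)

lemma abs_ph_le {θ : ℂ} (hθ : ‖θ‖ = 1) (j l a b : ℕ) (u : ℝ) :
    |ph θ j l a b u| ≤ ‖Df j l a b u‖ := by
  refine (Complex.abs_re_le_norm _).trans ?_
  rw [norm_mul, hθ, one_mul]

lemma abs_ph_sub_ph_le {θ : ℂ} (hθ : ‖θ‖ = 1) (j l l' a b a' b' : ℕ) (u : ℝ) :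
    |ph θ j l a b u - ph θ j l' a' b' u| ≤ ‖Df j l a b u - Df j l' a' b' u‖ := by
  rw [ph, ph, ← Complex.sub_re, ← mul_sub]
  refine (Complex.abs_re_le_norm _).trans ?_
  rw [norm_mul, hθ, one_mul]

lemma norm_neg_I_mul {θ : ℂ} (hθ : ‖θ‖ = 1) : ‖-Complex.I * θ‖ = 1 := by
  rw [norm_mul, hθ, norm_neg, Complex.norm_I, one_mul]

lemma ph_neg_I_mul (θ : ℂ) (j l a b : ℕ) (u : ℝ) :
    ph (-Complex.I * θ) j l a b u = (θ * Df j l a b u).im := by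
  rw [ph, mul_assoc]; simp

lemma ph_transversality {l a b : ℕ} (hl : 1 ≤ l) (hab : Odd (a + b)) {θ : ℂ} (hθ : ‖θ‖ = 1) (u : ℝ)
    (h : |ph θ 1 l a b u| ≤ 0.4) :
    1 / 2 ≤ |ph θ 2 l a b u| ∧ 1 / 2 ≤ |ph (-Complex.I * θ) 1 l a b u| := by
  have hd : Odd ((b : ℤ) - a) := by
    have : Odd ((a + b : ℕ) : ℤ) := by exact_mod_cast hab
    push_cast at this
    have e : (b : ℤ) - a = (a + b) - 2 * a := by ring
    rw [e]
    exact this.sub_even (even_two_mul _)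
  have e : u + a + (((b : ℤ) - a : ℤ) : ℝ) = u + b := by push_cast; ring
  have := transversality hl hd hθ (u + a)
  rw [e] at this
  rw [ph_neg_I_mul]
  exact this h

/-- The parameters at which two branches of level `i` nearly meet, to first order, in the
direction `θ` (and, when `T` holds, also to order zero in the orthogonal direction). -/
def Eset (θ : ℂ) (η : ℝ) (T : Prop) (i a b : ℕ) : Set ℝ :=
  {u | (i = 0 ∨ Odd (a + b)) ∧ |ph θ 0 i a b u| ≤ 100 * rt ^ i ∧
    |ph θ 1 i a b u| ≤ η + 100 * rt ^ i ∧ (T → |ph (-Complex.I * θ) 0 i a b u| ≤ 100 * rt ^ i)}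

lemma odd_add_two_pow_mul {i a b c d : ℕ} (hi : i ≠ 0) :
    Odd (a + 2 ^ i * c + (b + 2 ^ i * d)) ↔ Odd (a + b) := by
  obtain ⟨k, rfl⟩ := Nat.exists_eq_succ_of_ne_zero hi
  have : a + 2 ^ (k + 1) * c + (b + 2 ^ (k + 1) * d) = (a + b) + 2 * (2 ^ k * (c + d)) := by ring
  rw [this, Nat.odd_add]
  simp

lemma Eset_succ_subset {θ : ℂ} (hθ : ‖θ‖ = 1) (η : ℝ) (T : Prop) (i a b c d : ℕ) :
    Eset θ η T (i + 1) (a + 2 ^ i * c) (b + 2 ^ i * d) ⊆ Eset θ η T i a b := by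
  rintro u ⟨h0, h1, h2, h3⟩
  have hp : 0 < rt ^ i := pow_pos rt_pos i
  have hr := rt_lt
  have e1 := norm_Df_zero_split_le i 1 a b c d u
  have e2 := norm_Df_one_split_le i 1 a b c d u
  have f1 := abs_ph_sub_ph_le hθ 0 (i + 1) i (a + 2 ^ i * c) (b + 2 ^ i * d) a b u
  have f2 := abs_ph_sub_ph_le hθ 1 (i + 1) i (a + 2 ^ i * c) (b + 2 ^ i * d) a b u
  have f3 := abs_ph_sub_ph_le (norm_neg_I_mul hθ) 0 (i + 1) i (a + 2 ^ i * c) (b + 2 ^ i * d) a b u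
  rw [pow_succ] at h1 h2 h3
  have g : rt ^ i * rt ≤ rt ^ i * 0.71 := by gcongr; linarith
  rw [abs_le] at h1 h2 h3 f1 f2 f3
  refine ⟨?_, ?_, ?_, ?_⟩
  · by_cases hi : i = 0
    · exact Or.inl hi
    · refine Or.inr ((odd_add_two_pow_mul hi).1 (h0.resolve_left (by omega)))
  · rw [abs_le]; constructor <;> linarith
  · rw [abs_le]; constructor <;> linarith
  · intro hT
    have := h3 hT
    rw [abs_le]; constructor <;> linarith

/-- The total length of the sets `Eset`. -/
def Xs (θ : ℂ) (η : ℝ) (T : Prop) (i : ℕ) : ℝ :=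
  ∑ a ∈ Finset.range (2 ^ i), ∑ b ∈ Finset.range (2 ^ i), vl (Eset θ η T i a b)

lemma Xs_nonneg (θ : ℂ) (η : ℝ) (T : Prop) (i : ℕ) : 0 ≤ Xs θ η T i :=
  Finset.sum_nonneg fun _ _ => Finset.sum_nonneg fun _ _ => vl_nonneg _

lemma Xs_succ_le {θ : ℂ} (hθ : ‖θ‖ = 1) (η : ℝ) (T : Prop) (i : ℕ) :
    Xs θ η T (i + 1) ≤ 4 * Xs θ η T i := by
  rw [Xs, sum_sum_range_two_pow_add, Xs, Finset.mul_sum]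
  refine Finset.sum_le_sum fun a _ => ?_
  rw [Finset.mul_sum]
  refine Finset.sum_le_sum fun b _ => ?_
  calc _ ≤ ∑ c ∈ Finset.range (2 ^ 1), ∑ d ∈ Finset.range (2 ^ 1), vl (Eset θ η T i a b) :=
        Finset.sum_le_sum fun c _ => Finset.sum_le_sum fun d _ =>
          vl_mono (Eset_succ_subset hθ η T i a b c d)
    _ = _ := by simp; ring

lemma Xs_add_le {θ : ℂ} (hθ : ‖θ‖ = 1) (η : ℝ) (T : Prop) (i k : ℕ) :
    Xs θ η T (i + k) ≤ 4 ^ k * Xs θ η T i := by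
  induction k with
  | zero => simp
  | succ k ih =>
    have := Xs_succ_le hθ η T (i + k)
    rw [← add_assoc]
    calc _ ≤ _ := this
      _ ≤ 4 * (4 ^ k * Xs θ η T i) := by gcongr
      _ = _ := by ring

lemma Xs_le_four_pow (θ : ℂ) (η : ℝ) (T : Prop) (i : ℕ) : Xs θ η T i ≤ 4 ^ i := by
  calc Xs θ η T i ≤ ∑ a ∈ Finset.range (2 ^ i), ∑ b ∈ Finset.range (2 ^ i), 1 :=
        Finset.sum_le_sum fun c _ => Finset.sum_le_sum fun d _ => vl_le_one _
    _ = _ := by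
      simp only [Finset.sum_const, Finset.card_range, nsmul_eq_mul, mul_one]
      push_cast
      rw [← mul_pow]; norm_num

lemma Eset_window {θ : ℂ} (hθ : ‖θ‖ = 1) {η : ℝ} {T : Prop} {h M a b c d : ℕ} (hh : 10 ≤ h)
    (hM : h ≤ M) (hη : η ≤ (1 / 2) ^ h) (hT : T ∨ η = 0) {u v : ℝ}
    (hu : u ∈ Eset θ η T (2 * M + 2 * h) (a + 2 ^ (2 * M) * c) (b + 2 ^ (2 * M) * d))
    (huv : |v - u| ≤ (1 / 2) ^ M) :
    v ∈ Eset θ η T (2 * M) a b ∧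
    |ph θ 0 (2 * M + 2 * h) (a + 2 ^ (2 * M) * c) (b + 2 ^ (2 * M) * d) v| ≤
      218 * ((1 / 2) ^ M * (1 / 2) ^ h) ∧
    (v ∈ Eset θ η T (2 * M + 2 * h) (a + 2 ^ (2 * M) * c) (b + 2 ^ (2 * M) * d) →
      |u - v| ≤ 400 * ((1 / 2) ^ M * (1 / 2) ^ h)) := by
  obtain ⟨h0, h1, h2, h3⟩ := hu
  have odd := h0.resolve_left (by omega)
  have hn : 1 ≤ 2 * M + 2 * h := by omega
  have hri : rt ^ (2 * M) = (1 / 2) ^ M := rt_pow_two_mul M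
  have e1 := norm_Df_zero_split_le (2 * M) (2 * h) a b c d v
  have e2 := norm_Df_one_split_le (2 * M) (2 * h) a b c d v
  rw [hri] at e1 e2
  rw [← mul_add, rt_pow_two_mul, pow_add] at h1 h2 h3
  rw [mul_add] at h1 h2 h3
  generalize hA : a + 2 ^ (2 * M) * c = A at *
  generalize hB : b + 2 ^ (2 * M) * d = B at *
  set n := 2 * M + 2 * h with hndef
  have he0 : 0 < (1 / 2 : ℝ) ^ M := by positivity
  have hf0 : 0 < (1 / 2 : ℝ) ^ h := by positivity
  have hef : (1 / 2 : ℝ) ^ M ≤ (1 / 2) ^ h :=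
    pow_le_pow_of_le_one (by norm_num) (by norm_num) hM
  have hf1 : (1 / 2 : ℝ) ^ h ≤ 1 / 1024 :=
    (pow_le_pow_of_le_one (by norm_num) (by norm_num) hh).trans (by norm_num)
  have hrn : rt ^ n = (1 / 2 : ℝ) ^ M * (1 / 2 : ℝ) ^ h := by
    rw [hndef, ← mul_add, rt_pow_two_mul, pow_add]
  set e := (1 / 2 : ℝ) ^ M with he
  set f := (1 / 2 : ℝ) ^ h with hf
  have hef' : e * f ≤ f / 1024 := by nlinarith
  have hef'' : e * f ≤ e / 1024 := by nlinarith
  have d1 : ∀ x, |x - u| ≤ e → |ph θ 1 n A B x| ≤ 19 * f := by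
    intro x hx
    have := abs_sub_le_of_hasDerivAt (hasDerivAt_ph θ 1 n A B) (B := 17) (u := u) (v := x)
      (fun y _ => (abs_ph_le hθ _ _ _ _ _).trans (norm_Df_two_le _ _ _ _))
    have h4 : 17 * |x - u| ≤ 17 * e := by gcongr
    rw [abs_le] at this h2 ⊢
    constructor <;> linarith
  have tr : ∀ x, |x - u| ≤ |v - u| →
      1 / 2 ≤ |ph θ 2 n A B x| ∧ 1 / 2 ≤ |ph (-Complex.I * θ) 1 n A B x| := by
    intro x hx
    refine ph_transversality hn odd hθ x ((d1 x (hx.trans huv)).trans ?_)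
    linarith
  have b0 : |ph θ 0 n A B v - ph θ 0 n A B u| ≤ 19 * f * e :=
    (abs_sub_le_of_hasDerivAt (hasDerivAt_ph θ 0 n A B)
      (fun y hy => d1 y (hy.trans huv))).trans (by gcongr)
  have b0' : |ph (-Complex.I * θ) 0 n A B v - ph (-Complex.I * θ) 0 n A B u| ≤ 6.9 * e :=
    (abs_sub_le_of_hasDerivAt (hasDerivAt_ph (-Complex.I * θ) 0 n A B)
      (fun y hy => (abs_ph_le (norm_neg_I_mul hθ) _ _ _ _ _).trans
        (norm_Df_one_le _ _ _ _))).trans (by gcongr)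
  have b1 : |ph θ 1 n A B v - ph θ 1 n A B u| ≤ 17 * e :=
    (abs_sub_le_of_hasDerivAt (hasDerivAt_ph θ 1 n A B)
      (fun y hy => (abs_ph_le hθ _ _ _ _ _).trans
        (norm_Df_two_le _ _ _ _))).trans (by gcongr)
  have c0 := (abs_ph_sub_ph_le hθ 0 n (2 * M) A B a b v).trans e1
  have c0' := (abs_ph_sub_ph_le (norm_neg_I_mul hθ) 0 n (2 * M) A B a b v).trans e1
  have c1 := (abs_ph_sub_ph_le hθ 1 n (2 * M) A B a b v).trans e2
  refine ⟨⟨Or.inr ?_, ?_, ?_, ?_⟩, ?_, ?_⟩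
  · rw [← hA, ← hB] at odd
    exact (odd_add_two_pow_mul (by omega)).1 odd
  · rw [hri]
    rw [abs_le] at c0 b0 h1 ⊢
    constructor <;> linarith
  · rw [hri]
    rw [abs_le] at c1 b1 h2 ⊢
    constructor <;> linarith
  · intro hT'
    have h4 := h3 hT'
    rw [hri]
    rw [abs_le] at c0' b0' h4 ⊢
    constructor <;> linarith
  · rw [abs_le] at b0 h1 ⊢
    constructor <;> linarith
  · rintro ⟨-, -, k2, k3⟩
    rw [hrn] at k2 k3
    rw [abs_sub_comm]
    rcases hT with hT | hT
    · have h4 := h3 hT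
      have k4 := k3 hT
      have := le_abs_sub_of_hasDerivAt (hasDerivAt_ph (-Complex.I * θ) 0 n A B)
        (fun x hx => (tr x hx).2)
      have h5 := abs_sub (ph (-Complex.I * θ) 0 n A B v) (ph (-Complex.I * θ) 0 n A B u)
      linarith
    · have := le_abs_sub_of_hasDerivAt (hasDerivAt_ph θ 1 n A B) (fun x hx => (tr x hx).1)
      have h5 := abs_sub (ph θ 1 n A B v) (ph θ 1 n A B u)
      linarith

/-- Weighted autocorrelation of the points `Re (θ * Gd 0 (2 * h) (U + c))` at scale `2 ^ (-h)`. -/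
def Rw (θ : ℂ) (h : ℕ) (w : ℕ → ℝ) (U : ℝ) : ℝ :=
  ∑ c ∈ Finset.range (2 ^ (2 * h)), ∑ c' ∈ Finset.range (2 ^ (2 * h)),
    if |(θ * (Gd 0 (2 * h) (U + c) - Gd 0 (2 * h) (U + c'))).re| ≤ 225 * (1 / 2) ^ h
      then w (c / 2 ^ h) * w (c' / 2 ^ h) else 0

lemma Rw_nonneg (θ : ℂ) (h : ℕ) {w : ℕ → ℝ} (hw : ∀ i, 0 ≤ w i) (U : ℝ) : 0 ≤ Rw θ h w U :=
  Finset.sum_nonneg fun _ _ => Finset.sum_nonneg fun _ _ => by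
    split_ifs
    · exact mul_nonneg (hw _) (hw _)
    · exact le_rfl

/-- The quadratic bound with constant `C` for the averaged autocorrelations. -/
def BH (h : ℕ) (C : ℝ) : Prop :=
  ∀ θ : ℂ, ‖θ‖ = 1 → ∀ w : ℕ → ℝ, (∀ i, 0 ≤ w i) →
    ∑ τ ∈ Finset.range (2 ^ h), Rw θ h w (τ / 2 ^ h) ≤
      C * 8 ^ h * ∑ τ ∈ Finset.range (2 ^ h), w τ ^ 2

/-- The weighted total length of the sets `Eset`. -/
def Vs (θ : ℂ) (η : ℝ) (T : Prop) (h e : ℕ) (w : ℕ → ℝ) : ℝ :=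
  ∑ a ∈ Finset.range (2 ^ (e + h)), ∑ b ∈ Finset.range (2 ^ (e + h)),
    w (a / 2 ^ e) * w (b / 2 ^ e) * vl (Eset θ η T (e + h) a b)

lemma sum_near_le_Rw {θ : ℂ} (hθ : ‖θ‖ = 1) (h : ℕ) {w : ℕ → ℝ} (hw : ∀ i, 0 ≤ w i) {U U' : ℝ}
    (hU : |U - U'| ≤ (1 / 2) ^ h) (t : ℝ) :
    ∑ c ∈ Finset.range (2 ^ (2 * h)), ∑ c' ∈ Finset.range (2 ^ (2 * h)),
      (if |((θ * Gd 0 (2 * h) (U + c)).re + t) - ((θ * Gd 0 (2 * h) (U + c')).re + t)| ≤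
          218 * (1 / 2) ^ h
        then w (c / 2 ^ h) * w (c' / 2 ^ h) else 0) ≤ Rw θ h w U' := by
  refine Finset.sum_le_sum fun c _ => Finset.sum_le_sum fun c' _ => ?_
  split_ifs with h1 h2 h2
  · exact le_rfl
  · refine absurd ?_ h2
    have key : ∀ c : ℕ, |(θ * Gd 0 (2 * h) (U + c)).re - (θ * Gd 0 (2 * h) (U' + c)).re| ≤
        3.45 * (1 / 2) ^ h := by
      intro c
      rw [← Complex.sub_re, ← mul_sub]
      refine (Complex.abs_re_le_norm _).trans ?_
      rw [norm_mul, hθ, one_mul]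
      refine (norm_Gd_zero_sub_le _ _ _).trans ?_
      rw [add_sub_add_right_eq_sub]
      gcongr
    have k1 := key c
    have k2 := key c'
    rw [mul_sub, Complex.sub_re]
    have : 0 < (1 / 2 : ℝ) ^ h := by positivity
    rw [abs_le] at *
    constructor <;> linarith
  · exact mul_nonneg (hw _) (hw _)
  · exact le_rfl

lemma ph_zero_split (θ : ℂ) (i s a b c d : ℕ) (u : ℝ) :
    ph θ 0 (i + s) (a + 2 ^ i * c) (b + 2 ^ i * d) u = ph θ 0 i a b u + rt ^ i *
      ((θ * Gd 0 s ((u + b) / 2 ^ i + d)).re - (θ * Gd 0 s ((u + a) / 2 ^ i + c)).re) := by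
  rw [ph, Df_add_split, mul_add, Complex.add_re, ph, mul_left_comm, Complex.re_ofReal_mul, mul_sub,
    Complex.sub_re]
  simp

lemma sum_vl_Eset_le {θ : ℂ} (hθ : ‖θ‖ = 1) {η : ℝ} {T : Prop} {h m a b : ℕ} (hh : 10 ≤ h)
    (hη : η ≤ (1 / 2) ^ h) (hT : T ∨ η = 0) {w : ℕ → ℝ} (hw : ∀ i, 0 ≤ w i) :
    ∑ c ∈ Finset.range (2 ^ (2 * h)), ∑ d ∈ Finset.range (2 ^ (2 * h)),
      w (c / 2 ^ h) * w (d / 2 ^ h) * vl (Eset θ η T (2 * (h + m) + 2 * h)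
        (a + 2 ^ (2 * (h + m)) * c) (b + 2 ^ (2 * (h + m)) * d)) ≤
    1200 * (1 / 2) ^ h * (√(Rw θ h w ((a / 2 ^ (h + 2 * m) : ℕ) / 2 ^ h)) *
      √(Rw θ h w ((b / 2 ^ (h + 2 * m) : ℕ) / 2 ^ h)) * vl (Eset θ η T (2 * (h + m)) a b)) := by
  classical
  set M := h + m with hMdef
  have hM : h ≤ M := by omega
  set N : ℕ := 2 ^ M with hNdef
  have hN : 0 < N := by positivity
  have hNi : (1 : ℝ) / N = (1 / 2) ^ M := by rw [hNdef]; push_cast; rw [one_div_pow]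
  have hp : rt ^ (2 * M) = (1 / 2) ^ M := rt_pow_two_mul M
  set x : ℕ → ℕ → ℝ := fun k c => (θ * Gd 0 (2 * h) (((k : ℝ) / N + a) / 2 ^ (2 * M) + c)).re + 0
    with hx
  set y : ℕ → ℕ → ℝ := fun k d => (θ * Gd 0 (2 * h) (((k : ℝ) / N + b) / 2 ^ (2 * M) + d)).re +
    2 ^ M * ph θ 0 (2 * M) a b (k / N) with hy
  set δ : ℝ := 218 * (1 / 2) ^ h with hδ
  set RA := √(Rw θ h w ((a / 2 ^ (h + 2 * m) : ℕ) / 2 ^ h))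
  set RB := √(Rw θ h w ((b / 2 ^ (h + 2 * m) : ℕ) / 2 ^ h))
  set E := Eset θ η T (2 * M) a b
  set L : ℝ := 400 * ((1 / 2) ^ M * (1 / 2) ^ h) with hL
  have step1 : ∀ c d : ℕ, vl (Eset θ η T (2 * M + 2 * h)
        (a + 2 ^ (2 * M) * c) (b + 2 ^ (2 * M) * d)) ≤
      ∑ k ∈ Finset.range N, if (win N k ⊆ E ∧ |y k d - x k c| ≤ δ) then L else 0 := by
    intro c d
    refine vl_le_sum_win (P := fun k => win N k ⊆ E ∧ |y k d - x k c| ≤ δ) (δ := L) hN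
      (by positivity) fun k hk u hu huk => ⟨⟨fun v hv => ?_, ?_⟩, ?_⟩
    · refine (Eset_window hθ hh hM hη hT hu ?_).1
      rw [← hNi]; exact abs_sub_le_of_mem_win hv huk
    · have h1 := (Eset_window hθ hh hM hη hT hu (v := k / N) (by
        rw [← hNi]; exact abs_sub_le_of_mem_win (left_mem_win hN k) huk)).2.1
      rw [ph_zero_split, hp] at h1
      have h2 : y k d - x k c = 2 ^ M * (ph θ 0 (2 * M) a b (k / N) + (1 / 2) ^ M *
          ((θ * Gd 0 (2 * h) (((k : ℝ) / N + b) / 2 ^ (2 * M) + d)).re -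
            (θ * Gd 0 (2 * h) (((k : ℝ) / N + a) / 2 ^ (2 * M) + c)).re)) := by
        rw [mul_add, ← mul_assoc (2 ^ M), ← mul_pow]
        simp only [hx, hy]
        norm_num
        ring
      rw [h2, abs_mul, abs_of_pos (by positivity)]
      calc _ ≤ 2 ^ M * (218 * ((1 / 2 : ℝ) ^ M * (1 / 2) ^ h)) := by gcongr
        _ = 218 * ((2 * (1 / 2)) ^ M * (1 / 2) ^ h) := by rw [mul_pow]; ring
        _ = δ := by norm_num [hδ]
    · intro v hv hvk
      refine (Eset_window hθ hh hM hη hT hu ?_).2.2 hv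
      rw [← hNi]; exact abs_sub_le_of_mem_win hvk huk
  have near : ∀ k ∈ Finset.range N, ∀ a : ℕ,
      |((k : ℝ) / N + a) / 2 ^ (2 * M) - (a / 2 ^ (h + 2 * m) : ℕ) / 2 ^ h| ≤ (1 / 2) ^ h := by
    intro k hk a
    have hv := win_subset_Ico hk (left_mem_win hN k)
    generalize (k : ℝ) / N = v at hv ⊢
    have e1 : (2 : ℝ) ^ (2 * M) = 2 ^ (h + 2 * m) * 2 ^ h := by
      rw [← pow_add]; congr 1; omega
    have e2 := Nat.div_add_mod a (2 ^ (h + 2 * m))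
    have e3 : a % (2 ^ (h + 2 * m)) + 1 ≤ 2 ^ (h + 2 * m) := Nat.mod_lt a (by positivity)
    generalize a / 2 ^ (h + 2 * m) = q at e2 ⊢
    generalize a % (2 ^ (h + 2 * m)) = r at e2 e3
    have e4 : (a : ℝ) = 2 ^ (h + 2 * m) * q + r := by rw [← e2]; push_cast; ring
    have e5 : (r : ℝ) + 1 ≤ 2 ^ (h + 2 * m) := by exact_mod_cast e3
    have e6 : (v + a) / 2 ^ (2 * M) - q / 2 ^ h = ((v + r) / 2 ^ (h + 2 * m)) * (1 / 2) ^ h := by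
      rw [e1, e4, one_div_pow]; field_simp; ring
    rw [e6, abs_of_nonneg (by have := hv.1; positivity)]
    have : (v + r) / 2 ^ (h + 2 * m) ≤ 1 := by
      rw [div_le_one (by positivity)]; linarith [hv.2]
    calc _ ≤ 1 * (1 / 2 : ℝ) ^ h := by gcongr
      _ = _ := one_mul _
  have step2 : ∀ k ∈ Finset.range N, ∑ c ∈ Finset.range (2 ^ (2 * h)), ∑ d ∈ Finset.range (2 ^ (2 * h)),
      (if |y k d - x k c| ≤ δ then w (c / 2 ^ h) * w (d / 2 ^ h) else 0) ≤ 3 * (RA * RB) := by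
    intro k hk
    refine (sum_sum_near_le _ _ (fun c => w (c / 2 ^ h)) (fun c => w (c / 2 ^ h))
      (fun _ => hw _) (fun _ => hw _) (x k) (y k) (by positivity)).trans ?_
    gcongr
    · exact Real.sqrt_le_sqrt (sum_near_le_Rw hθ h hw (near k hk a) 0)
    · exact Real.sqrt_le_sqrt (sum_near_le_Rw hθ h hw (near k hk b) _)
  calc _ ≤ ∑ c ∈ Finset.range (2 ^ (2 * h)), ∑ d ∈ Finset.range (2 ^ (2 * h)),
      w (c / 2 ^ h) * w (d / 2 ^ h) * ∑ k ∈ Finset.range N,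
        if (win N k ⊆ E ∧ |y k d - x k c| ≤ δ) then L else 0 := by
        refine Finset.sum_le_sum fun c _ => Finset.sum_le_sum fun d _ => ?_
        exact mul_le_mul_of_nonneg_left (step1 c d) (mul_nonneg (hw _) (hw _))
    _ = ∑ k ∈ Finset.range N, (if win N k ⊆ E then 1 else 0) * (L *
        ∑ c ∈ Finset.range (2 ^ (2 * h)), ∑ d ∈ Finset.range (2 ^ (2 * h)),
          (if |y k d - x k c| ≤ δ then w (c / 2 ^ h) * w (d / 2 ^ h) else 0)) := by
        simp_rw [Finset.mul_sum]
        rw [Finset.sum_comm' (t' := Finset.range (2 ^ (2 * h)))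
          (s' := fun _ => Finset.range (2 ^ (2 * h))) (by intros; tauto)]
        rw [Finset.sum_comm]
        conv_lhs => enter [2, c]; rw [Finset.sum_comm]
        rw [Finset.sum_comm]
        refine Finset.sum_congr rfl fun k _ => Finset.sum_congr rfl fun c _ =>
          Finset.sum_congr rfl fun d _ => ?_
        by_cases h1 : win N k ⊆ E <;> by_cases h2 : |y k d - x k c| ≤ δ <;> simp [h1, h2]
        ring
    _ ≤ ∑ k ∈ Finset.range N, (if win N k ⊆ E then 1 else 0) * (L * (3 * (RA * RB))) := by
        refine Finset.sum_le_sum fun k hk => ?_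
        have := step2 k hk
        split_ifs
        · gcongr
        · simp
    _ = (∑ k ∈ Finset.range N, if win N k ⊆ E then (1 : ℝ) else 0) * (L * (3 * (RA * RB))) := by
        rw [Finset.sum_mul]
    _ ≤ (N * vl E) * (L * (3 * (RA * RB))) := by
        gcongr
        exact sum_win_subset_le hN E
    _ = 1200 * (1 / 2) ^ h * (RA * RB * vl E) := by
        have : (N : ℝ) * (1 / 2) ^ M = 1 := by rw [← hNi]; field_simp
        rw [hL]
        linear_combination (1200 * vl E * (1 / 2) ^ h * (RA * RB)) * this

lemma Vs_step {θ : ℂ} (hθ : ‖θ‖ = 1) {η : ℝ} {T : Prop} {h : ℕ} (m : ℕ) (hh : 10 ≤ h)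
    (hη : η ≤ (1 / 2) ^ h) (hT : T ∨ η = 0) {w : ℕ → ℝ} (hw : ∀ i, 0 ≤ w i) :
    Vs θ η T h (h + 2 * m + 2 * h) w ≤ 1200 * (1 / 2) ^ h *
      Vs θ η T h (h + 2 * m) (fun τ => √(Rw θ h w (τ / 2 ^ h))) := by
  have e1 : h + 2 * m + 2 * h + h = 2 * (h + m) + 2 * h := by omega
  have e2 : h + 2 * m + h = 2 * (h + m) := by omega
  rw [Vs, e1, sum_sum_range_two_pow_add, Vs, e2, Finset.mul_sum]
  refine Finset.sum_le_sum fun a ha => ?_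
  rw [Finset.mul_sum]
  refine Finset.sum_le_sum fun b hb => ?_
  have e3 : ∀ a c : ℕ, a ∈ Finset.range (2 ^ (2 * (h + m))) →
      (a + 2 ^ (2 * (h + m)) * c) / 2 ^ (h + 2 * m + 2 * h) = c / 2 ^ h := by
    intro a c ha
    have : (2 : ℕ) ^ (h + 2 * m + 2 * h) = 2 ^ (2 * (h + m)) * 2 ^ h := by
      rw [← pow_add]; congr 1; omega
    rw [this, ← Nat.div_div_eq_div_mul, Nat.add_mul_div_left _ _ (by positivity),
      Nat.div_eq_of_lt (Finset.mem_range.1 ha), zero_add]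
  simp_rw [e3 a _ ha, e3 b _ hb]
  exact sum_vl_Eset_le hθ hh hη hT hw

lemma Vs_zero_le {θ : ℂ} {η : ℝ} {T : Prop} {h : ℕ} {w : ℕ → ℝ} (hw : ∀ i, 0 ≤ w i) :
    Vs θ η T h h w ≤ 8 ^ h * ∑ τ ∈ Finset.range (2 ^ h), w τ ^ 2 := by
  have h1 : ∑ a ∈ Finset.range (2 ^ (h + h)), w (a / 2 ^ h) =
      2 ^ h * ∑ τ ∈ Finset.range (2 ^ h), w τ := by
    rw [sum_range_two_pow_add]
    have : ∀ a ∈ Finset.range (2 ^ h), ∑ c ∈ Finset.range (2 ^ h), w ((a + 2 ^ h * c) / 2 ^ h) =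
        ∑ τ ∈ Finset.range (2 ^ h), w τ := by
      intro a ha
      refine Finset.sum_congr rfl fun c _ => ?_
      rw [Nat.add_mul_div_left _ _ (by positivity), Nat.div_eq_of_lt (Finset.mem_range.1 ha),
        zero_add]
    rw [Finset.sum_congr rfl this]
    simp
  have h2 : (∑ τ ∈ Finset.range (2 ^ h), w τ) ^ 2 ≤ 2 ^ h * ∑ τ ∈ Finset.range (2 ^ h), w τ ^ 2 := by
    have := sq_sum_le_card_mul_sum_sq (s := Finset.range (2 ^ h)) (f := w)
    rw [Finset.card_range] at this
    exact_mod_cast this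
  calc Vs θ η T h h w ≤ ∑ a ∈ Finset.range (2 ^ (h + h)), ∑ b ∈ Finset.range (2 ^ (h + h)),
        w (a / 2 ^ h) * w (b / 2 ^ h) :=
        Finset.sum_le_sum fun a _ => Finset.sum_le_sum fun b _ =>
          mul_le_of_le_one_right (mul_nonneg (hw _) (hw _)) (vl_le_one _)
    _ = (2 ^ h) ^ 2 * (∑ τ ∈ Finset.range (2 ^ h), w τ) ^ 2 := by
        rw [← Finset.sum_mul_sum, h1]; ring
    _ ≤ (2 ^ h) ^ 2 * (2 ^ h * ∑ τ ∈ Finset.range (2 ^ h), w τ ^ 2) := by gcongr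
    _ = _ := by
        have : (8 : ℝ) ^ h = (2 ^ h) ^ 3 := by rw [← pow_mul, mul_comm, pow_mul]; norm_num
        rw [this]; ring

lemma Vs_le {θ : ℂ} (hθ : ‖θ‖ = 1) {η : ℝ} {T : Prop} {h : ℕ} (hh : 10 ≤ h)
    (hη : η ≤ (1 / 2) ^ h) (hT : T ∨ η = 0) {C : ℝ} (hC : 0 ≤ C) (hB : BH h C) (k : ℕ) {w : ℕ → ℝ}
    (hw : ∀ i, 0 ≤ w i) :
    Vs θ η T h (h + 2 * (h * k)) w ≤
      (1200 * C * 4 ^ h) ^ k * 8 ^ h * ∑ τ ∈ Finset.range (2 ^ h), w τ ^ 2 := by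
  induction k generalizing w with
  | zero => simpa using Vs_zero_le hw
  | succ k ih =>
    have e : h + 2 * (h * (k + 1)) = h + 2 * (h * k) + 2 * h := by ring
    rw [e]
    have h1 : ∑ τ ∈ Finset.range (2 ^ h), (√(Rw θ h w (τ / 2 ^ h))) ^ 2 ≤
        C * 8 ^ h * ∑ τ ∈ Finset.range (2 ^ h), w τ ^ 2 := by
      refine le_trans (le_of_eq ?_) (hB θ hθ w hw)
      exact Finset.sum_congr rfl fun τ _ => Real.sq_sqrt (Rw_nonneg θ h hw _)
    calc _ ≤ _ := Vs_step hθ (h * k) hh hη hT hw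
      _ ≤ 1200 * (1 / 2) ^ h * ((1200 * C * 4 ^ h) ^ k * 8 ^ h *
          ∑ τ ∈ Finset.range (2 ^ h), (√(Rw θ h w (τ / 2 ^ h))) ^ 2) := by
        gcongr
        exact ih (w := fun τ => √(Rw θ h w (τ / 2 ^ h))) fun τ => Real.sqrt_nonneg _
      _ ≤ 1200 * (1 / 2) ^ h * ((1200 * C * 4 ^ h) ^ k * 8 ^ h *
          (C * 8 ^ h * ∑ τ ∈ Finset.range (2 ^ h), w τ ^ 2)) := by gcongr
      _ = _ := by
        have : (1 / 2 : ℝ) ^ h * 8 ^ h = 4 ^ h := by rw [← mul_pow]; norm_num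
        rw [pow_succ]
        linear_combination (1200 * C * (1200 * C * 4 ^ h) ^ k * 8 ^ h *
          ∑ τ ∈ Finset.range (2 ^ h), w τ ^ 2) * this

lemma Xs_le_of_BH {θ : ℂ} (hθ : ‖θ‖ = 1) {η : ℝ} {T : Prop} {h : ℕ} (hh : 10 ≤ h)
    (hη : η ≤ (1 / 2) ^ h) (hT : T ∨ η = 0) {C : ℝ} (hC : 1 ≤ C) (hB : BH h C) (i : ℕ) :
    Xs θ η T i ≤ 4 ^ (5 * h) * (1200 * C) ^ (i / (2 * h)) * 2 ^ i := by
  have base : ∀ k : ℕ, Xs θ η T (2 * h * (k + 1)) ≤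
      4 ^ (2 * h) * (1200 * C) ^ k * 4 ^ (h * k) := by
    intro k
    have := Vs_le hθ hh hη hT (by linarith) hB k (w := fun _ => 1) (fun _ => zero_le_one)
    rw [Vs] at this
    have e : h + 2 * (h * k) + h = 2 * h * (k + 1) := by ring
    rw [e] at this
    simp only [one_mul, one_pow, Finset.sum_const, Finset.card_range, nsmul_eq_mul, mul_one] at this
    refine this.trans (le_of_eq ?_)
    push_cast
    rw [mul_pow, ← pow_mul, pow_mul 4 2 h, show (4 : ℝ) ^ 2 = 8 * 2 by norm_num, mul_pow 8]
    ring
  have h1 := Nat.div_add_mod i (2 * h)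
  have h2 : i % (2 * h) < 2 * h := Nat.mod_lt _ (by omega)
  generalize i / (2 * h) = k at *
  generalize i % (2 * h) = r at *
  have h3 : (4 : ℝ) ^ r ≤ 4 ^ (2 * h) := pow_le_pow_right₀ (by norm_num) h2.le
  have h5 : (1 : ℝ) ≤ 4 ^ (5 * h) := one_le_pow₀ (by norm_num)
  have h6 : (1 : ℝ) ≤ 2 ^ r := one_le_pow₀ (by norm_num)
  subst h1
  rw [add_comm] at *
  rcases k with _ | k
  · simp only [mul_zero, add_zero, pow_zero, mul_one]
    calc _ ≤ _ := Xs_le_four_pow θ η T r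
      _ ≤ 4 ^ (2 * h) := h3
      _ ≤ 4 ^ (5 * h) := pow_le_pow_right₀ (by norm_num) (by omega)
      _ ≤ 4 ^ (5 * h) * 2 ^ r := le_mul_of_one_le_right (by positivity) h6
  · rw [add_comm r]
    calc _ ≤ _ := Xs_add_le hθ η T (2 * h * (k + 1)) r
      _ ≤ 4 ^ (2 * h) * (4 ^ (2 * h) * (1200 * C) ^ k * 4 ^ (h * k)) := by
        exact mul_le_mul h3 (base k) (Xs_nonneg _ _ _ _) (by positivity)
      _ = 4 ^ (4 * h) * (1200 * C) ^ k * 4 ^ (h * k) := by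
        rw [show 4 * h = 2 * h + 2 * h by ring, pow_add]; ring
      _ ≤ 4 ^ (5 * h) * (1200 * C) ^ (k + 1) * 4 ^ (h * (k + 1)) * 1 := by
        rw [mul_one]
        gcongr
        · norm_num
        · omega
        · linarith
        · omega
        · norm_num
        · omega
      _ ≤ 4 ^ (5 * h) * (1200 * C) ^ (k + 1) * 4 ^ (h * (k + 1)) * 2 ^ r := by gcongr
      _ = _ := by
        rw [pow_add 2, show 2 * h * (k + 1) = 2 * (h * (k + 1)) by ring, pow_mul 2 2]
        norm_num
        ring

lemma vl_halves_le (S : Set ℝ) :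
    vl {u | (u + (0 : ℕ)) / 2 ∈ S} + vl {u | (u + (1 : ℕ)) / 2 ∈ S} ≤ 2 * vl S := by
  have h0 : lebI {u | (u + (0 : ℕ)) / 2 ∈ S} = 2 * volume (S ∩ Ico 0 (1 / 2)) := by
    have e : {u : ℝ | (u + (0 : ℕ)) / 2 ∈ S} ∩ Ico 0 1 =
        (fun u => u * (1 / 2)) ⁻¹' (S ∩ Ico 0 (1 / 2)) := by
      ext u
      simp only [mem_inter_iff, mem_ofPred_eq, mem_preimage, mem_Ico, Nat.cast_zero, add_zero,
        div_eq_mul_inv, one_mul]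
      constructor <;> rintro ⟨h1, h2, h3⟩ <;> refine ⟨h1, ?_, ?_⟩ <;> linarith
    rw [Measure.restrict_apply' measurableSet_Ico, e, Real.volume_preimage_mul_right (by norm_num)]
    norm_num
  have h1 : lebI {u | (u + (1 : ℕ)) / 2 ∈ S} = 2 * volume (S ∩ Ico (1 / 2) 1) := by
    have e : {u : ℝ | (u + (1 : ℕ)) / 2 ∈ S} ∩ Ico 0 1 =
        (fun u => u + 1) ⁻¹' ((fun u => u * (1 / 2)) ⁻¹' (S ∩ Ico (1 / 2) 1)) := by
      ext u
      simp only [mem_inter_iff, mem_ofPred_eq, mem_preimage, mem_Ico, Nat.cast_one,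
        div_eq_mul_inv, one_mul]
      constructor <;> rintro ⟨h1, h2, h3⟩ <;> refine ⟨h1, ?_, ?_⟩ <;> linarith
    rw [Measure.restrict_apply' measurableSet_Ico, e, measure_preimage_add_right,
      Real.volume_preimage_mul_right (by norm_num)]
    norm_num
  have h2 : lebI S = volume (S ∩ Ico 0 (1 / 2)) + volume (S ∩ Ico (1 / 2) 1) := by
    rw [Measure.restrict_apply' measurableSet_Ico,
      ← measure_inter_add_sdiff (S ∩ Ico 0 1) (measurableSet_Ico (a := (0 : ℝ)) (b := 1 / 2))]
    congr 2 <;> ext u <;> simp only [mem_inter_iff, Set.mem_sdiff, mem_Ico] <;> constructor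
    · tauto
    · rintro ⟨a, b, c⟩
      exact ⟨⟨a, b, by linarith⟩, b, c⟩
    · rintro ⟨⟨a, b, c⟩, d⟩
      exact ⟨a, by by_contra hc; exact d ⟨b, by linarith⟩, c⟩
    · rintro ⟨a, b, c⟩
      exact ⟨⟨a, by linarith, c⟩, fun hc => by linarith [hc.2]⟩
  have f1 : volume (S ∩ Ico (0 : ℝ) (1 / 2)) ≠ ⊤ :=
    measure_ne_top_of_subset inter_subset_right (by simp)
  have f2 : volume (S ∩ Ico (1 / 2 : ℝ) 1) ≠ ⊤ :=
    measure_ne_top_of_subset inter_subset_right (by simp)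
  rw [vl, vl, vl, measureReal_def, measureReal_def, measureReal_def, h0, h1, h2,
    ENNReal.toReal_add f1 f2, ENNReal.toReal_mul, ENNReal.toReal_mul, ENNReal.toReal_ofNat, mul_add]

lemma Df_zero_succ (n p C D : ℕ) (u : ℝ) :
    Df 0 (n + 1) (p + 2 * C) (p + 2 * D) u = rt * Df 0 n C D ((u + p) / 2) := by
  have key : ∀ C : ℕ, Gd 0 (n + 1) (u + (p + 2 * C : ℕ)) =
      rt * ex ((u + p) / 2) + rt * Gd 0 n ((u + p) / 2 + C) := by
    intro C
    have e : (u + (p + 2 * C : ℕ)) / 2 = (u + p) / 2 + C := by push_cast; ring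
    have e2 := ex_add_intCast ((u + p) / 2) C
    rw [Int.cast_natCast] at e2
    rw [Gd_succ, e, e2]
    simp
  rw [Df, key, key, Df]
  ring

/-- The parameters at which two branches of level `n` are close, as measured by `N`. -/
def Yset (N : ℂ → ℝ) (K : ℝ) (n a b : ℕ) : Set ℝ := {u | N (Df 0 n a b u) ≤ K * rt ^ n}

/-- Total length of the coincidence sets over pairs satisfying `P`. -/
def Ysum (P : ℕ → ℕ → Prop) [∀ a b, Decidable (P a b)] (N : ℂ → ℝ) (K : ℝ) (r σ σ' m : ℕ) : ℝ :=
  ∑ a ∈ Finset.range (2 ^ m), ∑ b ∈ Finset.range (2 ^ m),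
    if P a b then vl (Yset N K (m + r) (a + 2 ^ m * σ) (b + 2 ^ m * σ')) else 0

lemma Ysum_succ_le {N : ℂ → ℝ} (hN : ∀ v, N (rt * v) = rt * N v) (K : ℝ) (r σ σ' m : ℕ) :
    Ysum (fun a b => a ≠ b) N K r σ σ' (m + 1) ≤
      2 * Ysum (fun a b => a ≠ b) N K r σ σ' m + Ysum (fun a b => Odd (a + b)) N K r σ σ' (m + 1) := by
  set F : ℕ → ℕ → ℝ := fun a b =>
    vl (Yset N K (m + 1 + r) (a + 2 ^ (m + 1) * σ) (b + 2 ^ (m + 1) * σ')) with hF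
  have hF0 : ∀ a b, 0 ≤ F a b := fun _ _ => vl_nonneg _
  have pre : ∀ p c d : ℕ, F (p + 2 * c) (p + 2 * d) =
      vl {u | (u + p) / 2 ∈ Yset N K (m + r) (c + 2 ^ m * σ) (d + 2 ^ m * σ')} := by
    intro p c d
    simp only [hF]
    congr 1
    ext u
    have e : ∀ c σ : ℕ, p + 2 * c + 2 ^ (m + 1) * σ = p + 2 * (c + 2 ^ m * σ) := by
      intros; ring
    rw [Yset, mem_ofPred_eq, e, e, show m + 1 + r = m + r + 1 by ring, Df_zero_succ, hN, Yset,
      mem_ofPred_eq, mem_ofPred_eq, pow_succ]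
    have hp := rt_pos
    constructor
    · intro h; nlinarith
    · intro h; nlinarith
  have h1 : Ysum (fun a b => a ≠ b) N K r σ σ' (m + 1) ≤
      (∑ a ∈ Finset.range (2 ^ (m + 1)), ∑ b ∈ Finset.range (2 ^ (m + 1)),
        if Even (a + b) ∧ a ≠ b then F a b else 0) +
      Ysum (fun a b => Odd (a + b)) N K r σ σ' (m + 1) := by
    rw [Ysum, Ysum, ← Finset.sum_add_distrib]
    refine Finset.sum_le_sum fun a _ => ?_
    rw [← Finset.sum_add_distrib]
    refine Finset.sum_le_sum fun b _ => ?_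
    change (if a ≠ b then F a b else 0) ≤ _ + (if Odd (a + b) then F a b else 0)
    have := hF0 a b
    rcases Nat.even_or_odd (a + b) with h | h
    · rw [if_neg (Nat.not_odd_iff_even.2 h), add_zero]
      simp [h]
    · rw [if_pos h, if_neg (show ¬(Even (a + b) ∧ a ≠ b) from
        fun h' => Nat.not_even_iff_odd.2 h h'.1), zero_add]
      split_ifs <;> simp [this]
  have h2 : (∑ a ∈ Finset.range (2 ^ (m + 1)), ∑ b ∈ Finset.range (2 ^ (m + 1)),
        if Even (a + b) ∧ a ≠ b then F a b else 0) ≤ 2 * Ysum (fun a b => a ≠ b) N K r σ σ' m := by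
    rw [add_comm m 1, sum_sum_range_two_pow_add, Ysum, Finset.mul_sum]
    simp only [pow_one, Finset.sum_range_succ, Finset.sum_range_zero, zero_add]
    have z1 : ∀ c d : ℕ, ¬ (Even (2 * c + (1 + 2 * d)) ∧ 2 * c ≠ 1 + 2 * d) := by
      rintro c d ⟨h, -⟩; rw [Nat.even_iff] at h; omega
    have z2 : ∀ c d : ℕ, ¬ (Even (1 + 2 * c + 2 * d) ∧ 1 + 2 * c ≠ 2 * d) := by
      rintro c d ⟨h, -⟩; rw [Nat.even_iff] at h; omega
    have z3 : ∀ c d : ℕ, (Even (2 * c + 2 * d) ∧ 2 * c ≠ 2 * d) ↔ c ≠ d := by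
      intro c d
      rw [Nat.even_iff]; omega
    have z4 : ∀ c d : ℕ, (Even (1 + 2 * c + (1 + 2 * d)) ∧ 1 + 2 * c ≠ 1 + 2 * d) ↔ c ≠ d := by
      intro c d
      rw [Nat.even_iff]; omega
    simp only [if_neg (z1 _ _), if_neg (z2 _ _), z3, z4, Finset.sum_const_zero, add_zero, zero_add]
    rw [← Finset.sum_add_distrib]
    refine Finset.sum_le_sum fun c _ => ?_
    rw [Finset.mul_sum, ← Finset.sum_add_distrib]
    refine Finset.sum_le_sum fun d _ => ?_
    by_cases hcd : c = d
    · simp [hcd]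
    · rw [if_pos hcd, if_pos hcd, if_pos hcd]
      have p0 := pre 0 c d
      have p1 := pre 1 c d
      rw [zero_add, zero_add] at p0
      rw [p0, p1]
      exact vl_halves_le _
  linarith

lemma Ysum_ne_le {N : ℂ → ℝ} (hN : ∀ v, N (rt * v) = rt * N v) {K : ℝ} {r σ σ' m : ℕ} {B : ℝ}
    (h : ∀ k ≤ m, Ysum (fun a b => Odd (a + b)) N K r σ σ' k ≤ B * 2 ^ k) :
    Ysum (fun a b => a ≠ b) N K r σ σ' m ≤ m * B * 2 ^ m := by
  induction m with
  | zero => simp [Ysum]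
  | succ m ih =>
    have h1 := Ysum_succ_le hN K r σ σ' m
    have h2 := ih fun k hk => h k (by omega)
    have h3 := h (m + 1) le_rfl
    push_cast
    rw [pow_succ] at *
    linarith

/-- The part of a coincidence set on which the derivative has a prescribed size. -/
lemma vl_bucket_le {θ : ℂ} (hθ : ‖θ‖ = 1) {i t a b C D : ℕ} (ht : 4 ≤ t)
    (hodd : Odd (a + 2 ^ i * C + (b + 2 ^ i * D))) :
    vl {u | |ph θ 0 (i + t) (a + 2 ^ i * C) (b + 2 ^ i * D) u| ≤ 232 * rt ^ (i + t) ∧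
      8 * rt ^ (i + 1) < |ph θ 1 (i + t) (a + 2 ^ i * C) (b + 2 ^ i * D) u| ∧
      |ph θ 1 (i + t) (a + 2 ^ i * C) (b + 2 ^ i * D) u| ≤ 8 * rt ^ i} ≤
    1660 * 2 ^ i * rt ^ (i + t) * vl (Eset θ 0 False i a b) := by
  classical
  have hr := rt_lt
  have hr' := lt_rt
  have hp := rt_pos
  set e := rt ^ i with he
  have he0 : 0 < e := pow_pos hp i
  have he1 : e ≤ 1 := pow_le_one₀ hp.le rt_le_one
  have hesq : e * e = (1 / 2) ^ i := by rw [he, ← pow_add, ← two_mul, rt_pow_two_mul]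
  have hnt : 232 * rt ^ (i + t) ≤ 58 * e := by
    have : rt ^ t ≤ rt ^ 4 := pow_le_pow_of_le_one hp.le rt_le_one ht
    have h4 : rt ^ 4 = 1 / 4 := by
      rw [show 4 = 2 * 2 by rfl, rt_pow_two_mul]; norm_num
    rw [pow_add, ← he]
    rw [h4] at this
    nlinarith
  set n := i + t with hn
  have hq0 : 0 < rt ^ n := pow_pos hp n
  set A := a + 2 ^ i * C with hA
  set B := b + 2 ^ i * D with hB
  rw [pow_succ, ← he]
  have s0 := fun v => (abs_ph_sub_ph_le hθ 0 n i A B a b v).trans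
    (norm_Df_zero_split_le i t a b C D v)
  have s1 := fun v => (abs_ph_sub_ph_le hθ 1 n i A B a b v).trans
    (norm_Df_one_split_le i t a b C D v)
  rw [← he] at s0 s1
  set W : ℕ := ⌈4 / e⌉₊ with hW
  have hW1 : 4 / e ≤ W := Nat.le_ceil _
  have hW2 : (W : ℝ) ≤ 5 / e := by
    have := Nat.ceil_lt_add_one (show 0 ≤ 4 / e by positivity)
    have h1 : 1 ≤ 1 / e := by rw [le_div_iff₀ he0]; linarith
    have h2 : 5 / e = 4 / e + 1 / e := by ring
    linarith
  have hW0 : 0 < W := by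
    have : (0 : ℝ) < W := lt_of_lt_of_le (by positivity) hW1
    exact_mod_cast this
  have hW3 : (1 : ℝ) / W ≤ e / 4 := by
    rw [div_le_iff₀ (by exact_mod_cast hW0)]
    rw [div_le_iff₀ he0] at hW1
    linarith
  have d1 : ∀ u v, |v - u| ≤ e / 4 → |ph θ 1 n A B v - ph θ 1 n A B u| ≤ 17 * (e / 4) := by
    intro u v huv
    exact (abs_sub_le_of_hasDerivAt (hasDerivAt_ph θ 1 n A B)
      (fun y _ => (abs_ph_le hθ _ _ _ _ _).trans (norm_Df_two_le _ _ _ _))).trans (by gcongr)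
  set δ := 332 * rt ^ n / e with hδ
  have key := vl_le_sum_win (N := W) (E := {u | |ph θ 0 n A B u| ≤ 232 * rt ^ n ∧
      8 * (e * rt) < |ph θ 1 n A B u| ∧ |ph θ 1 n A B u| ≤ 8 * e})
      (P := fun k => win W k ⊆ Eset θ 0 False i a b) (δ := δ) hW0 (by positivity) (by
    rintro k hk u ⟨hu1, hu2, hu3⟩ huk
    refine ⟨fun v hv => ?_, ?_⟩
    · have huv := (abs_sub_le_of_mem_win hv huk).trans hW3
      have b0 : |ph θ 0 n A B v - ph θ 0 n A B u| ≤ 13 * e * |v - u| := by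
        refine abs_sub_le_of_hasDerivAt (hasDerivAt_ph θ 0 n A B) fun y hy => ?_
        have := d1 u y (hy.trans huv)
        rw [abs_le] at this hu3 ⊢
        constructor <;> linarith
      have b0' : 13 * e * |v - u| ≤ 13 * e * (1 / 4) := by gcongr; linarith
      have b1 := d1 u v huv
      have c0 := s0 v
      have c1 := s1 v
      refine ⟨?_, ?_, ?_, fun h => h.elim⟩
      · by_cases hi : i = 0
        · exact Or.inl hi
        · exact Or.inr ((odd_add_two_pow_mul hi).1 hodd)
      · rw [← he]
        rw [abs_le] at hu1 b0 c0 ⊢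
        constructor <;> linarith
      · rw [← he]
        rw [abs_le] at hu3 b1 c1 ⊢
        constructor <;> linarith
    · rintro v ⟨hv1, -, -⟩ hvk
      have huv := (abs_sub_le_of_mem_win hvk huk).trans hW3
      have := le_abs_sub_of_hasDerivAt (hasDerivAt_ph θ 0 n A B) (B := 1.4 * e) (u := u) (v := v)
        (fun y hy => by
          have h1 := d1 u y (hy.trans huv)
          have h2 := abs_sub_abs_le_abs_sub (ph θ 1 n A B u) (ph θ 1 n A B y)
          rw [abs_sub_comm] at h2
          nlinarith)
      have h5 := abs_sub (ph θ 0 n A B v) (ph θ 0 n A B u)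
      rw [hδ, le_div_iff₀ he0, abs_sub_comm]
      linarith)
  refine key.trans ?_
  calc _ = (∑ k ∈ Finset.range W, if win W k ⊆ Eset θ 0 False i a b then (1 : ℝ) else 0) * δ := by
        rw [Finset.sum_mul]
        exact Finset.sum_congr rfl fun k _ => by split_ifs <;> simp
    _ ≤ (W * vl (Eset θ 0 False i a b)) * δ := by
        gcongr
        exact sum_win_subset_le hW0 _
    _ ≤ (5 / e * vl (Eset θ 0 False i a b)) * δ := by
        have := vl_nonneg (Eset θ 0 False i a b)
        gcongr
    _ = 1660 * (1 / (e * e)) * rt ^ n * vl (Eset θ 0 False i a b) := by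
        rw [hδ]; field_simp; ring
    _ = _ := by
        rw [hesq, one_div_pow, one_div_one_div]

lemma exists_bucket {x : ℝ} (hx : x ≤ 8) (m : ℕ) :
    x ≤ 8 * rt ^ m ∨ ∃ i ∈ Finset.range m, 8 * rt ^ (i + 1) < x ∧ x ≤ 8 * rt ^ i := by
  induction m with
  | zero => left; simpa using hx
  | succ m ih =>
    rcases ih with h | ⟨i, hi, h⟩
    · by_cases h' : x ≤ 8 * rt ^ (m + 1)
      · exact Or.inl h'
      · exact Or.inr ⟨m, by simp, not_le.1 h', h⟩
    · exact Or.inr ⟨i, Finset.mem_range.2 ((Finset.mem_range.1 hi).trans (by omega)), h⟩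

/-- The seminorm `v ↦ |Re (θ v)|`. -/
def absRe (θ : ℂ) (v : ℂ) : ℝ := |(θ * v).re|

lemma absRe_rt_mul (θ v : ℂ) : absRe θ (rt * v) = rt * absRe θ v := by
  rw [absRe, mul_left_comm, Complex.re_ofReal_mul, abs_mul, abs_of_pos rt_pos, absRe]

lemma Ysum_le_four_pow (P : ℕ → ℕ → Prop) [∀ a b, Decidable (P a b)] (N : ℂ → ℝ) (K : ℝ)
    (r σ σ' m : ℕ) : Ysum P N K r σ σ' m ≤ 4 ^ m := by
  calc _ ≤ ∑ a ∈ Finset.range (2 ^ m), ∑ b ∈ Finset.range (2 ^ m), (1 : ℝ) :=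
        Finset.sum_le_sum fun c _ => Finset.sum_le_sum fun d _ => by
          split_ifs
          · exact vl_le_one _
          · exact zero_le_one
    _ = _ := by
      simp only [Finset.sum_const, Finset.card_range, nsmul_eq_mul, mul_one]
      push_cast
      rw [← mul_pow]; norm_num

lemma Ysum_odd_le {θ : ℂ} (hθ : ‖θ‖ = 1) {h k : ℕ} (hk : k ≤ h) (σ σ' : ℕ) {D : ℝ} (hD : 1 ≤ D)
    (hX : ∀ i ≤ h, Xs θ 0 False i ≤ D * 2 ^ i) :
    Ysum (fun a b => Odd (a + b)) (absRe θ) 232 h σ σ' k ≤ (1660 * (k + 1) * D) * 2 ^ k := by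
  have hp := rt_pos
  rcases lt_or_ge k 4 with hk4 | hk4
  · refine (Ysum_le_four_pow _ _ _ _ _ _ _).trans ?_
    have h1 : (2 : ℝ) ^ k ≤ 2 ^ 3 := pow_le_pow_right₀ (by norm_num) (by omega)
    have h2 : (4 : ℝ) ^ k = 2 ^ k * 2 ^ k := by rw [← mul_pow]; norm_num
    rw [h2]
    gcongr
    have : (1 : ℝ) * 1 ≤ (k + 1) * D := by gcongr; simp
    linarith
  set n := k + h with hn
  have hterm : ∀ a b : ℕ, (if Odd (a + b) then vl (Yset (absRe θ) 232 n (a + 2 ^ k * σ)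
      (b + 2 ^ k * σ')) else 0) ≤ vl (Eset θ 0 False k a b) + ∑ i ∈ Finset.range k,
        1660 * 2 ^ i * rt ^ n * vl (Eset θ 0 False i (a % 2 ^ i) (b % 2 ^ i)) := by
    intro a b
    have hsum : 0 ≤ ∑ i ∈ Finset.range k,
        1660 * 2 ^ i * rt ^ n * vl (Eset θ 0 False i (a % 2 ^ i) (b % 2 ^ i)) :=
      Finset.sum_nonneg fun i _ => mul_nonneg (by positivity) (vl_nonneg _)
    split_ifs with hab
    swap
    · exact add_nonneg (vl_nonneg _) hsum
    have hodd : Odd (a + 2 ^ k * σ + (b + 2 ^ k * σ')) :=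
      (odd_add_two_pow_mul (by omega)).2 hab
    set S : ℕ → Set ℝ := fun i => {u | |ph θ 0 n (a + 2 ^ k * σ) (b + 2 ^ k * σ') u| ≤
      232 * rt ^ n ∧ 8 * rt ^ (i + 1) < |ph θ 1 n (a + 2 ^ k * σ) (b + 2 ^ k * σ') u| ∧
      |ph θ 1 n (a + 2 ^ k * σ) (b + 2 ^ k * σ') u| ≤ 8 * rt ^ i} with hS
    have cover : Yset (absRe θ) 232 n (a + 2 ^ k * σ) (b + 2 ^ k * σ') ⊆
        Eset θ 0 False k a b ∪ ⋃ i ∈ Finset.range k, S i := by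
      intro u hu
      have hu' : |ph θ 0 n (a + 2 ^ k * σ) (b + 2 ^ k * σ') u| ≤ 232 * rt ^ n := hu
      have hx := (abs_ph_le hθ 1 n (a + 2 ^ k * σ) (b + 2 ^ k * σ') u).trans
        (norm_Df_one_le n (a + 2 ^ k * σ) (b + 2 ^ k * σ') u)
      rcases exists_bucket (hx.trans (by norm_num)) k with h1 | ⟨i, hi, h1⟩
      · left
        have s0 := (abs_ph_sub_ph_le hθ 0 n k _ _ a b u).trans
          (norm_Df_zero_split_le k h a b σ σ' u)
        have s1 := (abs_ph_sub_ph_le hθ 1 n k _ _ a b u).trans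
          (norm_Df_one_split_le k h a b σ σ' u)
        have he0 : 0 < rt ^ k := pow_pos hp k
        have hnt : rt ^ n ≤ rt ^ k * (1 / 4) := by
          have : rt ^ h ≤ rt ^ 4 := pow_le_pow_of_le_one hp.le rt_le_one (by omega)
          have h4 : rt ^ 4 = 1 / 4 := by
            rw [show 4 = 2 * 2 by rfl, rt_pow_two_mul]; norm_num
          rw [h4] at this
          rw [hn, pow_add]
          gcongr
        refine ⟨Or.inr hab, ?_, ?_, fun h => h.elim⟩
        · rw [abs_le] at s0 hu' ⊢
          constructor <;> linarith
        · rw [abs_le] at s1 h1 ⊢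
          constructor <;> linarith
      · right
        exact mem_biUnion hi ⟨hu', h1⟩
    refine (vl_mono cover).trans ((vl_union_le _ _).trans ?_)
    gcongr
    refine (vl_biUnion_le _ _).trans (Finset.sum_le_sum fun i hi => ?_)
    rw [Finset.mem_range] at hi
    have split : ∀ a σ : ℕ, a + 2 ^ k * σ = a % 2 ^ i + 2 ^ i * (a / 2 ^ i + 2 ^ (k - i) * σ) := by
      intro a σ
      have e1 : 2 ^ k = 2 ^ i * 2 ^ (k - i) := by rw [← pow_add]; congr 1; omega
      have e2 := Nat.mod_add_div a (2 ^ i)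
      rw [mul_add, ← mul_assoc, ← e1, ← add_assoc, e2]
    have e3 : n = i + (n - i) := by omega
    simp only [hS]
    rw [split a, split b] at hodd ⊢
    have := vl_bucket_le hθ (show 4 ≤ n - i by omega) hodd
    rw [← e3] at this
    exact this
  have hsum_mod : ∀ i ∈ Finset.range k, ∑ a ∈ Finset.range (2 ^ k), ∑ b ∈ Finset.range (2 ^ k),
      1660 * 2 ^ i * rt ^ n * vl (Eset θ 0 False i (a % 2 ^ i) (b % 2 ^ i)) ≤ 1660 * D * 2 ^ k := by
    intro i hi
    rw [Finset.mem_range] at hi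
    obtain ⟨s, rfl⟩ : ∃ s, k = i + s := ⟨k - i, by omega⟩
    have e : ∑ a ∈ Finset.range (2 ^ (i + s)), ∑ b ∈ Finset.range (2 ^ (i + s)),
        vl (Eset θ 0 False i (a % 2 ^ i) (b % 2 ^ i)) = 4 ^ s * Xs θ 0 False i := by
      rw [sum_sum_range_two_pow_add, Xs, Finset.mul_sum]
      refine Finset.sum_congr rfl fun a ha => ?_
      rw [Finset.mul_sum]
      refine Finset.sum_congr rfl fun b hb => ?_
      simp only [Nat.add_mul_mod_self_left, Nat.mod_eq_of_lt (Finset.mem_range.1 ha),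
        Nat.mod_eq_of_lt (Finset.mem_range.1 hb), Finset.sum_const, Finset.card_range, nsmul_eq_mul]
      push_cast
      rw [← mul_assoc, ← mul_pow]; norm_num
    simp_rw [← Finset.mul_sum]
    rw [e]
    have h1 : rt ^ n ≤ (1 / 2) ^ (i + s) := by
      rw [← rt_pow_two_mul]
      exact pow_le_pow_of_le_one hp.le rt_le_one (by omega)
    calc _ ≤ 1660 * 2 ^ i * (1 / 2) ^ (i + s) * (4 ^ s * (D * 2 ^ i)) := by
          have hx0 := Xs_nonneg θ 0 False i
          exact mul_le_mul (by gcongr) (by gcongr; exact hX i (by omega))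
            (by positivity) (by positivity)
      _ = 1660 * D * ((2 * 2 * (1 / 2)) ^ i * ((1 / 2) * 4) ^ s) := by
          rw [mul_pow, mul_pow, mul_pow, pow_add]; ring
      _ = _ := by norm_num [pow_add]
  calc _ ≤ ∑ a ∈ Finset.range (2 ^ k), ∑ b ∈ Finset.range (2 ^ k),
      (vl (Eset θ 0 False k a b) + ∑ i ∈ Finset.range k,
        1660 * 2 ^ i * rt ^ n * vl (Eset θ 0 False i (a % 2 ^ i) (b % 2 ^ i))) :=
        Finset.sum_le_sum fun a _ => Finset.sum_le_sum fun b _ => hterm a b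
    _ = Xs θ 0 False k + ∑ i ∈ Finset.range k, ∑ a ∈ Finset.range (2 ^ k),
        ∑ b ∈ Finset.range (2 ^ k),
        1660 * 2 ^ i * rt ^ n * vl (Eset θ 0 False i (a % 2 ^ i) (b % 2 ^ i)) := by
        simp_rw [Finset.sum_add_distrib]
        rw [Xs]
        congr 1
        conv_lhs => enter [2, a]; rw [Finset.sum_comm]
        rw [Finset.sum_comm]
    _ ≤ D * 2 ^ k + ∑ i ∈ Finset.range k, 1660 * D * 2 ^ k :=
        add_le_add (hX k hk) (Finset.sum_le_sum hsum_mod)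
    _ ≤ _ := by
        rw [Finset.sum_const, Finset.card_range, nsmul_eq_mul]
        have : 0 < D * 2 ^ k := by positivity
        nlinarith

lemma sum_near_le_vl {θ : ℂ} (hθ : ‖θ‖ = 1) (h c c' : ℕ) :
    ∑ τ ∈ Finset.range (2 ^ h), (if |ph θ 0 (2 * h) c' c (τ / 2 ^ h)| ≤ 225 * (1 / 2) ^ h
      then (1 : ℝ) else 0) ≤ 2 ^ h * vl (Yset (absRe θ) 232 (2 * h) c' c) := by
  classical
  have h1 := sum_win_subset_le (N := 2 ^ h) (by positivity) (Yset (absRe θ) 232 (2 * h) c' c)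
  push_cast at h1
  refine le_trans (Finset.sum_le_sum fun τ _ => ?_) h1
  by_cases hτ : |ph θ 0 (2 * h) c' c (τ / 2 ^ h)| ≤ 225 * (1 / 2) ^ h
  · rw [if_pos hτ, if_pos]
    intro v hv
    have h2 := abs_sub_le_of_mem_win hv (left_mem_win (N := 2 ^ h) (by positivity) τ)
    push_cast at h2
    rw [← one_div_pow] at h2
    have h3 := abs_sub_le_of_hasDerivAt (hasDerivAt_ph θ 0 (2 * h) c' c) (B := 6.9) (v := v)
      (u := τ / 2 ^ h) (fun y _ => (abs_ph_le hθ _ _ _ _ _).trans (norm_Df_one_le _ _ _ _))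
    change |ph θ 0 (2 * h) c' c v| ≤ _
    rw [rt_pow_two_mul]
    have h4 : 6.9 * |v - τ / 2 ^ h| ≤ 6.9 * (1 / 2) ^ h := by gcongr
    have h5 : 0 < (1 / 2 : ℝ) ^ h := by positivity
    rw [abs_le] at hτ h3 ⊢
    constructor <;> linarith
  · rw [if_neg hτ]
    split_ifs <;> simp

lemma BH_of_Xs {h : ℕ} {D : ℝ} (hD : 1 ≤ D)
    (hX : ∀ θ : ℂ, ‖θ‖ = 1 → ∀ i ≤ h, Xs θ 0 False i ≤ D * 2 ^ i) :
    BH h (1660 * (h + 1) ^ 2 * D) := by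
  intro θ hθ w hw
  set Q : ℝ := 1660 * (h + 1) ^ 2 * D with hQ
  have hY : ∀ σ σ' : ℕ, ∑ a ∈ Finset.range (2 ^ h), ∑ a' ∈ Finset.range (2 ^ h),
      vl (Yset (absRe θ) 232 (2 * h) (a + 2 ^ h * σ) (a' + 2 ^ h * σ')) ≤ Q * 2 ^ h := by
    intro σ σ'
    have h1 : Ysum (fun a b => a ≠ b) (absRe θ) 232 h σ σ' h ≤ h * (1660 * (h + 1) * D) * 2 ^ h := by
      refine Ysum_ne_le (absRe_rt_mul θ) fun k hk => ?_
      refine (Ysum_odd_le hθ hk σ σ' hD (hX θ hθ)).trans ?_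
      gcongr
    have h2 : ∑ a ∈ Finset.range (2 ^ h), ∑ a' ∈ Finset.range (2 ^ h),
        vl (Yset (absRe θ) 232 (2 * h) (a + 2 ^ h * σ) (a' + 2 ^ h * σ')) ≤
        2 ^ h + Ysum (fun a b => a ≠ b) (absRe θ) 232 h σ σ' h := by
      have e : (2 : ℝ) ^ h = ∑ a ∈ Finset.range (2 ^ h), ∑ a' ∈ Finset.range (2 ^ h),
          if a = a' then (1 : ℝ) else 0 := by
        have : ∀ a ∈ Finset.range (2 ^ h), (∑ a' ∈ Finset.range (2 ^ h),
          if a = a' then (1 : ℝ) else 0) = 1 := by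
          intro a ha
          rw [Finset.sum_ite_eq, if_pos ha]
        rw [Finset.sum_congr rfl this]; simp
      rw [e, Ysum, ← two_mul, ← Finset.sum_add_distrib]
      refine Finset.sum_le_sum fun a _ => ?_
      rw [← Finset.sum_add_distrib]
      refine Finset.sum_le_sum fun a' _ => ?_
      by_cases haa : a = a'
      · simp [haa, vl_le_one]
      · simp [haa]
    refine h2.trans ((add_le_add le_rfl h1).trans ?_)
    rw [hQ]
    have : (1 : ℝ) ≤ 1660 * (h + 1) * D := by
      have : (1 : ℝ) * 1 ≤ (h + 1) * D := by gcongr; simp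
      linarith
    have h5 : (0 : ℝ) < 2 ^ h := by positivity
    nlinarith
  have h2 : (∑ τ ∈ Finset.range (2 ^ h), w τ) ^ 2 ≤ 2 ^ h * ∑ τ ∈ Finset.range (2 ^ h), w τ ^ 2 := by
    have := sq_sum_le_card_mul_sum_sq (s := Finset.range (2 ^ h)) (f := w)
    rw [Finset.card_range] at this
    exact_mod_cast this
  calc ∑ τ ∈ Finset.range (2 ^ h), Rw θ h w (τ / 2 ^ h)
      = ∑ c ∈ Finset.range (2 ^ (2 * h)), ∑ c' ∈ Finset.range (2 ^ (2 * h)),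
        w (c / 2 ^ h) * w (c' / 2 ^ h) * ∑ τ ∈ Finset.range (2 ^ h),
        (if |ph θ 0 (2 * h) c' c (τ / 2 ^ h)| ≤ 225 * (1 / 2) ^ h then (1 : ℝ) else 0) := by
        simp_rw [Rw]
        rw [Finset.sum_comm]
        refine Finset.sum_congr rfl fun c _ => ?_
        rw [Finset.sum_comm]
        refine Finset.sum_congr rfl fun c' _ => ?_
        rw [Finset.mul_sum]
        refine Finset.sum_congr rfl fun τ _ => ?_
        rw [mul_ite, mul_one, mul_zero]
        rfl
    _ ≤ ∑ c ∈ Finset.range (2 ^ (2 * h)), ∑ c' ∈ Finset.range (2 ^ (2 * h)),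
        w (c / 2 ^ h) * w (c' / 2 ^ h) * (2 ^ h * vl (Yset (absRe θ) 232 (2 * h) c' c)) :=
        Finset.sum_le_sum fun c _ => Finset.sum_le_sum fun c' _ =>
          mul_le_mul_of_nonneg_left (sum_near_le_vl hθ h c c') (mul_nonneg (hw _) (hw _))
    _ = ∑ σ ∈ Finset.range (2 ^ h), ∑ σ' ∈ Finset.range (2 ^ h), w σ * w σ' * (2 ^ h *
        ∑ a' ∈ Finset.range (2 ^ h), ∑ a ∈ Finset.range (2 ^ h),
          vl (Yset (absRe θ) 232 (2 * h) (a' + 2 ^ h * σ') (a + 2 ^ h * σ))) := by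
        have e : ∀ a σ : ℕ, a ∈ Finset.range (2 ^ h) → (a + 2 ^ h * σ) / 2 ^ h = σ := by
          intro a σ ha
          rw [Nat.add_mul_div_left _ _ (by positivity), Nat.div_eq_of_lt (Finset.mem_range.1 ha),
            zero_add]
        conv_lhs => rw [two_mul h, sum_sum_range_two_pow_add, ← two_mul h]
        simp_rw [Finset.mul_sum]
        conv_lhs => enter [2, a]; rw [Finset.sum_comm]
        rw [Finset.sum_comm]
        refine Finset.sum_congr rfl fun σ _ => ?_
        conv_rhs => enter [2, σ']; rw [Finset.sum_comm]
        conv_rhs => rw [Finset.sum_comm]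
        refine Finset.sum_congr rfl fun a ha => ?_
        conv_rhs => rw [Finset.sum_comm]
        refine Finset.sum_congr rfl fun a' ha' => ?_
        refine Finset.sum_congr rfl fun σ' _ => ?_
        rw [e a σ ha, e a' σ' ha']
    _ ≤ ∑ σ ∈ Finset.range (2 ^ h), ∑ σ' ∈ Finset.range (2 ^ h), w σ * w σ' * (2 ^ h *
        (Q * 2 ^ h)) :=
        Finset.sum_le_sum fun σ _ => Finset.sum_le_sum fun σ' _ =>
          mul_le_mul_of_nonneg_left (by gcongr; exact hY σ' σ) (mul_nonneg (hw _) (hw _))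
    _ = (∑ τ ∈ Finset.range (2 ^ h), w τ) ^ 2 * (2 ^ h * (Q * 2 ^ h)) := by
        rw [sq, Finset.sum_mul_sum, Finset.sum_mul]
        simp_rw [Finset.sum_mul]
    _ ≤ (2 ^ h * ∑ τ ∈ Finset.range (2 ^ h), w τ ^ 2) * (2 ^ h * (Q * 2 ^ h)) := by
        have : 0 ≤ Q := by positivity
        gcongr
    _ = _ := by
        have : (8 : ℝ) ^ h = (2 ^ h) ^ 3 := by rw [← pow_mul, mul_comm, pow_mul]; norm_num
        rw [this]; ring

lemma exists_sq_mul_pow_le {r s : ℝ} (hr : 0 < r) (hrs : r < s) :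
    ∃ A : ℝ, 1 ≤ A ∧ ∀ n : ℕ, ((n : ℝ) + 1) ^ 2 * r ^ n ≤ A * s ^ n := by
  have hs := hr.trans hrs
  have h0 : 0 < r / s := by positivity
  have ht := tendsto_pow_const_mul_const_pow_of_abs_lt_one 2
    (r := r / s) (by rw [abs_of_pos h0, div_lt_one hs]; exact hrs)
  have ht' := ht.comp (tendsto_add_atTop_nat 1)
  obtain ⟨A, hA⟩ := ht'.bddAbove_range
  refine ⟨max 1 (A / (r / s)), le_max_left _ _, fun n => ?_⟩
  have h1 : ((n : ℝ) + 1) ^ 2 * (r / s) ^ (n + 1) ≤ A := by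
    have := hA ⟨n, rfl⟩
    simpa using this
  have h2 : ((n : ℝ) + 1) ^ 2 * (r / s) ^ n ≤ A / (r / s) := by
    rw [le_div_iff₀ h0]
    calc _ = _ := by rw [pow_succ]; ring
      _ ≤ _ := h1
  have h3 := h2.trans (le_max_right 1 _)
  rw [div_pow, ← mul_div_assoc, div_le_iff₀ (by positivity)] at h3
  exact h3

/-- The quadratic bound holds at every scale with constants growing at rate `ρ`. -/
def HB (ρ : ℝ) : Prop := ∃ A : ℝ, 1 ≤ A ∧ ∀ h : ℕ, BH h (A * ρ ^ h)

lemma BH.mono {h : ℕ} {C C' : ℝ} (hB : BH h C) (hC : C ≤ C') : BH h C' := by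
  intro θ hθ w hw
  refine (hB θ hθ w hw).trans ?_
  have : 0 ≤ ∑ τ ∈ Finset.range (2 ^ h), w τ ^ 2 := Finset.sum_nonneg fun _ _ => sq_nonneg _
  gcongr

lemma HB.mono {ρ ρ' : ℝ} (hρ : 0 ≤ ρ) (h : HB ρ) (hle : ρ ≤ ρ') : HB ρ' := by
  obtain ⟨A, hA, hB⟩ := h
  exact ⟨A, hA, fun h => (hB h).mono (by gcongr)⟩

lemma HB_two : HB 2 := by
  refine ⟨1, le_rfl, fun h θ _ w hw => ?_⟩
  have hS : ∑ c ∈ Finset.range (2 ^ (2 * h)), w (c / 2 ^ h) =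
      2 ^ h * ∑ τ ∈ Finset.range (2 ^ h), w τ := by
    rw [two_mul, sum_range_two_pow_add, Finset.mul_sum]
    rw [Finset.sum_comm]
    refine Finset.sum_congr rfl fun τ _ => ?_
    calc _ = ∑ a ∈ Finset.range (2 ^ h), w τ := by
          refine Finset.sum_congr rfl fun a ha => ?_
          rw [Nat.add_mul_div_left _ _ (by positivity), Nat.div_eq_of_lt (Finset.mem_range.1 ha),
            zero_add]
      _ = _ := by simp
  have h1 : ∀ U, Rw θ h w U ≤ (2 ^ h * ∑ τ ∈ Finset.range (2 ^ h), w τ) ^ 2 := by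
    intro U
    rw [← hS, sq, Finset.sum_mul_sum]
    refine Finset.sum_le_sum fun c _ => Finset.sum_le_sum fun c' _ => ?_
    split_ifs
    · exact le_rfl
    · exact mul_nonneg (hw _) (hw _)
  have h2 : (∑ τ ∈ Finset.range (2 ^ h), w τ) ^ 2 ≤
      2 ^ h * ∑ τ ∈ Finset.range (2 ^ h), w τ ^ 2 := by
    have := sq_sum_le_card_mul_sum_sq (s := Finset.range (2 ^ h)) (f := w)
    simpa using this
  calc _ ≤ ∑ τ ∈ Finset.range (2 ^ h), (2 ^ h * ∑ τ ∈ Finset.range (2 ^ h), w τ) ^ 2 :=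
        Finset.sum_le_sum fun τ _ => h1 _
    _ = 2 ^ h * (2 ^ h) ^ 2 * (∑ τ ∈ Finset.range (2 ^ h), w τ) ^ 2 := by
        rw [Finset.sum_const, Finset.card_range, nsmul_eq_mul]; push_cast; ring
    _ ≤ 2 ^ h * (2 ^ h) ^ 2 * (2 ^ h * ∑ τ ∈ Finset.range (2 ^ h), w τ ^ 2) := by gcongr
    _ = _ := by
        have : (8 : ℝ) ^ h = (2 ^ h) ^ 3 := by rw [← pow_mul, mul_comm, pow_mul]; norm_num
        rw [this]; ring

lemma HB.exists_Xs_le {ρ ρ₁ : ℝ} (hρ : 1 ≤ ρ) (hρ₁ : 1 ≤ ρ₁) (hlt : ρ < ρ₁ ^ 2) (H : HB ρ) :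
    ∃ h : ℕ, ∃ A : ℝ, 1 ≤ A ∧ ∀ (θ : ℂ) (η : ℝ) (T : Prop), ‖θ‖ = 1 → η ≤ (1 / 2) ^ h →
      (T ∨ η = 0) → ∀ i, Xs θ η T i ≤ A * ρ₁ ^ i * 2 ^ i := by
  obtain ⟨A, hA, hB⟩ := H
  have hρ0 : 0 < ρ := by linarith
  have h1 : 1 < ρ₁ ^ 2 / ρ := by rwa [one_lt_div hρ0]
  obtain ⟨h, hh, hlarge⟩ := ((tendsto_pow_atTop_atTop_of_one_lt h1).eventually_ge_atTop
    (1200 * A)).and (eventually_ge_atTop 10) |>.exists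
  have h2 : 1200 * (A * ρ ^ h) ≤ ρ₁ ^ (2 * h) := by
    rw [div_pow, le_div_iff₀ (by positivity), ← pow_mul] at hh
    linarith
  have hC : 1 ≤ A * ρ ^ h := one_le_mul_of_one_le_of_one_le hA (one_le_pow₀ hρ)
  refine ⟨h, 4 ^ (5 * h), one_le_pow₀ (by norm_num), fun θ η T hθ hη hT i => ?_⟩
  refine (Xs_le_of_BH hθ hlarge hη hT hC (hB h) i).trans ?_
  gcongr
  calc _ ≤ (ρ₁ ^ (2 * h)) ^ (i / (2 * h)) := by gcongr
    _ = ρ₁ ^ (2 * h * (i / (2 * h))) := by rw [← pow_mul]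
    _ ≤ _ := pow_le_pow_right₀ hρ₁ (Nat.mul_div_le _ _)

lemma HB.step {ρ ρ' : ℝ} (hρ : 1 ≤ ρ) (hρ' : 1 < ρ') (hlt : ρ < ρ' ^ 2) (H : HB ρ) : HB ρ' := by
  obtain ⟨ρ₁, h1, h2⟩ : ∃ ρ₁, max 1 (√ρ) < ρ₁ ∧ ρ₁ < ρ' :=
    exists_between (max_lt hρ' (by rw [Real.sqrt_lt' (by linarith)]; exact hlt))
  have h1' : 1 < ρ₁ := (le_max_left _ _).trans_lt h1
  have h3 : ρ < ρ₁ ^ 2 := by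
    rw [← Real.sqrt_lt' (by linarith)]; exact (le_max_right _ _).trans_lt h1
  obtain ⟨_, A, hA, hX⟩ := H.exists_Xs_le hρ h1'.le h3
  obtain ⟨B, hB, hpoly⟩ := exists_sq_mul_pow_le (by linarith : 0 < ρ₁) h2
  refine ⟨1660 * A * B, ?_, fun h => ?_⟩
  · nlinarith [one_le_mul_of_one_le_of_one_le hA hB]
  have hD : 1 ≤ A * ρ₁ ^ h := one_le_mul_of_one_le_of_one_le hA (one_le_pow₀ h1'.le)
  refine (BH_of_Xs hD fun θ hθ i hi => ?_).mono ?_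
  · refine (hX θ 0 False hθ (by positivity) (Or.inr rfl) i).trans ?_
    gcongr
    exact h1'.le
  · have := hpoly h
    calc _ = 1660 * A * ((h + 1) ^ 2 * ρ₁ ^ h) := by ring
      _ ≤ 1660 * A * (B * ρ' ^ h) := by gcongr
      _ = _ := by ring

lemma HB_of_one_lt {ρ : ℝ} (hρ : 1 < ρ) : HB ρ := by
  set σ := √ρ with hσ
  have hσ1 : 1 < σ := by rw [hσ, Real.lt_sqrt (by norm_num)]; linarith
  have hσ2 : σ ^ 2 = ρ := Real.sq_sqrt (by linarith)
  have key : ∀ k : ℕ, HB (σ ^ (k + 2)) → HB (σ ^ 2) := by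
    intro k
    induction k with
    | zero => exact id
    | succ k ih =>
      intro h
      refine ih (h.step (one_le_pow₀ hσ1.le) (one_lt_pow₀ hσ1 (by omega)) ?_)
      rw [← pow_mul]
      exact pow_lt_pow_right₀ hσ1 (by omega)
  obtain ⟨k, hk⟩ := ((tendsto_pow_atTop_atTop_of_one_lt hσ1).comp
    (tendsto_add_atTop_nat 2)).eventually_ge_atTop 2 |>.exists
  rw [← hσ2]
  exact key k (HB_two.mono (by norm_num) hk)

lemma exists_Xs_le {ρ : ℝ} (hρ : 1 < ρ) :
    ∃ h : ℕ, ∃ A : ℝ, 1 ≤ A ∧ ∀ (θ : ℂ) (η : ℝ) (T : Prop), ‖θ‖ = 1 → η ≤ (1 / 2) ^ h →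
      (T ∨ η = 0) → ∀ i, Xs θ η T i ≤ A * ρ ^ i * 2 ^ i :=
  (HB_of_one_lt hρ).exists_Xs_le hρ.le hρ.le (by nlinarith)

/-- A finite net of directions such that each vector is nearly orthogonal to one of them. -/
lemma exists_finite_directions {ε : ℝ} (hε : 0 < ε) :
    ∃ S : Finset ℂ, (∀ θ ∈ S, ‖θ‖ = 1) ∧
      ∀ v : ℂ, ∃ θ ∈ S, |(θ * v).re| ≤ ε * ‖v‖ := by
  obtain ⟨t, hts, htf, hcov⟩ := (isCompact_sphere (0 : ℂ) 1).finite_cover_balls hε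
  refine ⟨htf.toFinset, fun θ hθ => by simpa using hts (htf.mem_toFinset.1 hθ), fun v => ?_⟩
  obtain ⟨θ₀, h1, h2⟩ : ∃ θ₀ : ℂ, ‖θ₀‖ = 1 ∧ (θ₀ * v).re = 0 := by
    by_cases hv : v = 0
    · exact ⟨1, by simp, by simp [hv]⟩
    · have hv' : (‖v‖ : ℂ) ≠ 0 := by simpa using hv
      refine ⟨Complex.I * (starRingEnd ℂ v / ‖v‖), by simp [hv], ?_⟩
      rw [mul_assoc, div_mul_eq_mul_div, mul_comm _ v, Complex.mul_conj, Complex.normSq_eq_norm_sq]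
      push_cast
      rw [sq, mul_div_cancel_right₀ _ hv']
      simp
  obtain ⟨θ, hθt, hθ⟩ := mem_iUnion₂.1 (hcov (by simpa using h1 : θ₀ ∈ Metric.sphere (0 : ℂ) 1))
  refine ⟨θ, htf.mem_toFinset.2 hθt, ?_⟩
  rw [Metric.mem_ball, dist_eq_norm] at hθ
  calc _ = |((θ₀ - θ) * v).re| := by rw [sub_mul, Complex.sub_re, h2, zero_sub, abs_neg]
    _ ≤ ‖(θ₀ - θ) * v‖ := Complex.abs_re_le_norm _
    _ ≤ _ := by rw [norm_mul]; gcongr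

/-- Total length of the coincidence sets of the planar points `Gd 0 n (u + a)`. -/
def Gam (n : ℕ) : ℝ :=
  ∑ a ∈ Finset.range (2 ^ n), ∑ b ∈ Finset.range (2 ^ n), vl (Yset norm 100 n a b)

lemma Gam_le {ρ : ℝ} (hρ : 1 < ρ) : ∃ A : ℝ, 1 ≤ A ∧ ∀ n, Gam n ≤ A * ρ ^ n * 2 ^ n := by
  obtain ⟨ρ₁, h1, h2⟩ := exists_between hρ
  obtain ⟨h, A, hA, hX⟩ := exists_Xs_le h1
  obtain ⟨S, hS1, hS⟩ := exists_finite_directions (ε := (1 / 2) ^ h / 7) (by positivity)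
  obtain ⟨B, hB, hpoly⟩ := exists_sq_mul_pow_le (by linarith : 0 < ρ₁) h2
  have hodd : ∀ k, Ysum (fun a b => Odd (a + b)) norm 100 0 0 0 k ≤
      (S.card * A) * ρ₁ ^ k * 2 ^ k := by
    intro k
    calc _ ≤ ∑ a ∈ Finset.range (2 ^ k), ∑ b ∈ Finset.range (2 ^ k),
          ∑ θ ∈ S, vl (Eset θ ((1 / 2) ^ h) True k a b) := by
          refine Finset.sum_le_sum fun a _ => Finset.sum_le_sum fun b _ => ?_
          split_ifs with hab
          · rw [mul_zero, add_zero, add_zero, add_zero]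
            refine (vl_mono fun u hu => ?_).trans (vl_biUnion_le S _)
            obtain ⟨θ, hθS, hθ⟩ := hS (Df 1 k a b u)
            have hθ1 := hS1 θ hθS
            have hp := rt_pos
            rw [Yset, mem_ofPred_eq] at hu
            refine mem_biUnion hθS ⟨Or.inr hab, ?_, ?_, fun _ => ?_⟩
            · refine (Complex.abs_re_le_norm _).trans ?_
              rwa [norm_mul, hθ1, one_mul]
            · have h3 := norm_Df_one_le k a b u
              have h4 : (1 / 2 : ℝ) ^ h / 7 * ‖Df 1 k a b u‖ ≤ (1 / 2) ^ h / 7 * 6.9 := by gcongr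
              have h5 : (0 : ℝ) < (1 / 2) ^ h := by positivity
              have h6 : 0 < 100 * rt ^ k := by positivity
              rw [ph]
              linarith
            · refine (Complex.abs_re_le_norm _).trans ?_
              rwa [norm_mul, norm_mul, hθ1, norm_neg, Complex.norm_I, one_mul, one_mul]
          · exact Finset.sum_nonneg fun _ _ => vl_nonneg _
      _ = ∑ θ ∈ S, Xs θ ((1 / 2) ^ h) True k := by
          conv_lhs => enter [2, a]; rw [Finset.sum_comm]
          rw [Finset.sum_comm]; rfl
      _ ≤ ∑ θ ∈ S, A * ρ₁ ^ k * 2 ^ k :=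
          Finset.sum_le_sum fun θ hθ => hX θ _ True (hS1 θ hθ) le_rfl (Or.inl trivial) k
      _ = _ := by rw [Finset.sum_const, nsmul_eq_mul]; ring
  refine ⟨1 + S.card * A * B, by have : 0 ≤ S.card * A * B := by positivity
                                 linarith, fun n => ?_⟩
  have hne := Ysum_ne_le (N := norm) (fun v => by
    rw [norm_mul, Complex.norm_real, Real.norm_of_nonneg rt_pos.le]) (K := 100) (r := 0) (σ := 0)
    (σ' := 0) (m := n) (B := S.card * A * ρ₁ ^ n) (fun k hk => (hodd k).trans (by
      gcongr
      exact h1.le))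
  have hsplit : Gam n ≤ 2 ^ n + Ysum (fun a b => a ≠ b) norm 100 0 0 0 n := by
    have e : (2 : ℝ) ^ n = ∑ a ∈ Finset.range (2 ^ n), ∑ b ∈ Finset.range (2 ^ n),
        if a = b then 1 else 0 := by
      rw [Finset.sum_congr rfl fun a ha => (Finset.sum_ite_eq _ a _).trans (if_pos ha)]
      simp
    rw [e, Ysum, Gam, ← Finset.sum_add_distrib]
    refine Finset.sum_le_sum fun a _ => ?_
    rw [← Finset.sum_add_distrib]
    refine Finset.sum_le_sum fun b _ => ?_
    by_cases hab : a = b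
    · simp [hab, vl_le_one]
    · simp [hab]
  refine hsplit.trans ?_
  have h7 : (n : ℝ) * ρ₁ ^ n ≤ B * ρ ^ n := by
    refine le_trans ?_ (hpoly n)
    have : (n : ℝ) ≤ (n + 1) ^ 2 := by nlinarith [(n.cast_nonneg : (0 : ℝ) ≤ n)]
    gcongr
  have h8 : (1 : ℝ) ≤ ρ ^ n := one_le_pow₀ hρ.le
  calc _ ≤ 2 ^ n + n * (S.card * A * ρ₁ ^ n) * 2 ^ n := by linarith
    _ = (1 + S.card * A * (n * ρ₁ ^ n)) * 2 ^ n := by ring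
    _ ≤ (1 * ρ ^ n + S.card * A * (B * ρ ^ n)) * 2 ^ n := by
        gcongr
        linarith
    _ = _ := by ring

/-- The Weierstrass function as a complex valued function. -/
def Wc (x : ℝ) : ℂ := ∑' n : ℕ, (rt : ℂ) ^ n * ex (2 ^ n * x)

lemma norm_Wc_term (n : ℕ) (x : ℝ) : ‖(rt : ℂ) ^ n * ex (2 ^ n * x)‖ = rt ^ n := by
  rw [norm_mul, norm_pow, norm_ex, Complex.norm_real, Real.norm_of_nonneg rt_pos.le, mul_one]

lemma summable_rt_pow : Summable fun n : ℕ => rt ^ n :=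
  summable_geometric_of_lt_one rt_pos.le (by linarith [rt_lt])

lemma summable_Wc (x : ℝ) : Summable fun n : ℕ => (rt : ℂ) ^ n * ex (2 ^ n * x) :=
  Summable.of_norm (by simpa only [norm_Wc_term] using summable_rt_pow)

lemma continuous_ex : Continuous ex := by unfold ex; fun_prop

lemma continuous_Wc : Continuous Wc :=
  continuous_tsum (fun n => continuous_const.mul (continuous_ex.comp (by fun_prop)))
    summable_rt_pow fun n x => (norm_Wc_term n x).le

lemma Wc_eq (x : ℝ) : Wc x = ex x + rt * Wc (2 * x) := by
  rw [Wc, (summable_Wc x).tsum_eq_zero_add, Wc, ← tsum_mul_left]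
  simp only [pow_zero, one_mul]
  congr 1
  refine tsum_congr fun n => ?_
  rw [pow_succ', mul_assoc, show (2 : ℝ) ^ (n + 1) * x = 2 ^ n * (2 * x) by ring]

lemma Wc_add_intCast (x : ℝ) (k : ℤ) : Wc (x + k) = Wc x := by
  unfold Wc
  refine tsum_congr fun n => ?_
  have : (2 : ℝ) ^ n * (x + k) = 2 ^ n * x + ((2 ^ n * k : ℤ) : ℝ) := by push_cast; ring
  rw [this, ex_add_intCast]

/-- The smooth part of the Weierstrass function seen at scale `2 ^ (-N)`. -/
def Hf : ℕ → ℝ → ℂ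
  | 0, _ => 0
  | N + 1, z => (rt : ℂ)⁻¹ * (ex (z / 2) + Hf N (z / 2))

lemma Wc_div_two_pow (N : ℕ) (z : ℝ) : Wc (z / 2 ^ N) = rt ^ N * (Wc z + Hf N z) := by
  induction N generalizing z with
  | zero => simp [Hf]
  | succ N ih =>
    have h0 : (rt : ℂ) ≠ 0 := by exact_mod_cast rt_pos.ne'
    have h1 : z / 2 ^ (N + 1) = z / 2 / 2 ^ N := by rw [pow_succ']; field_simp
    rw [h1, ih, Hf, Wc_eq (z / 2), show 2 * (z / 2) = z by ring]
    field_simp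
    ring

lemma hasDerivAt_Hf (N : ℕ) (z : ℝ) :
    HasDerivAt (Hf N) (2 * π * Complex.I * Gd 0 N z) z := by
  induction N generalizing z with
  | zero =>
    have : HasDerivAt (Hf 0) 0 z := hasDerivAt_const z (0 : ℂ)
    simpa [Gd] using this
  | succ N ih =>
    have h2 : HasDerivAt (fun z : ℝ => Hf N (z / 2))
        ((1 / 2 : ℝ) • (2 * π * Complex.I * Gd 0 N (z / 2))) z :=
      (ih (z / 2)).scomp z ((hasDerivAt_id z).div_const 2)
    have h3 := ((hasDerivAt_ex_half z).add h2).const_mul (rt : ℂ)⁻¹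
    refine h3.congr_deriv ?_
    have h0 : (rt : ℂ) ≠ 0 := by exact_mod_cast rt_pos.ne'
    have hs : (rt : ℂ) ^ 2 = 1 / 2 := by
      rw [← Complex.ofReal_pow, rt_sq]; norm_num
    rw [Gd_succ, Complex.real_smul]
    push_cast
    rw [inv_mul_eq_iff_eq_mul₀ h0]
    linear_combination (-2 * π * Complex.I * (ex (z / 2) + Gd 0 N (z / 2))) * hs

lemma norm_Hf_sub_le (N : ℕ) (z h : ℝ) : ‖Hf N (z + h) - Hf N z‖ ≤ 16 * |h| := by
  have := Convex.norm_image_sub_le_of_norm_hasDerivWithin_le (s := univ) (f := Hf N) (C := 16)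
    (fun x _ => (hasDerivAt_Hf N x).hasDerivWithinAt) (fun x _ => ?_) convex_univ
    (mem_univ z) (mem_univ (z + h))
  · simpa using this
  · have h1 := norm_Gd_zero_le N x
    have h2 := pi_lt_d2
    have h3 := pi_pos
    rw [norm_mul, norm_mul, norm_mul, Complex.norm_I, Complex.norm_real, Real.norm_of_nonneg h3.le]
    norm_num
    nlinarith [norm_nonneg (Gd 0 N x)]

lemma norm_Hf_sub_sub_le (N : ℕ) (z h : ℝ) :
    ‖Hf N (z + h) - Hf N z - h * (2 * π * Complex.I * Gd 0 N z)‖ ≤ 22 * h ^ 2 := by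
  have hd : ∀ x, HasDerivAt (fun x : ℝ => Hf N x - x * (2 * π * Complex.I * Gd 0 N z))
      (2 * π * Complex.I * (Gd 0 N x - Gd 0 N z)) x := by
    intro x
    have := (hasDerivAt_Hf N x).sub
      ((HasDerivAt.ofReal_comp (hasDerivAt_id x)).mul_const (2 * π * Complex.I * Gd 0 N z))
    refine this.congr_deriv ?_
    push_cast; ring
  have hb : ∀ x ∈ uIcc z (z + h), ‖2 * π * Complex.I * (Gd 0 N x - Gd 0 N z)‖ ≤ 22 * |h| := by
    intro x hx
    have h1 := norm_Gd_zero_sub_le N x z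
    have h2 := pi_lt_d2
    have h3 := pi_pos
    have h4 : |x - z| ≤ |h| := by simpa using abs_sub_left_of_mem_uIcc hx
    rw [norm_mul, norm_mul, norm_mul, Complex.norm_I, Complex.norm_real, Real.norm_of_nonneg h3.le]
    norm_num
    nlinarith [norm_nonneg (Gd 0 N x - Gd 0 N z), abs_nonneg h]
  have := Convex.norm_image_sub_le_of_norm_hasDerivWithin_le (s := uIcc z (z + h))
    (fun x _ => (hd x).hasDerivWithinAt) hb (convex_uIcc _ _) left_mem_uIcc right_mem_uIcc
  have e : ‖Hf N (z + h) - Hf N z - h * (2 * π * Complex.I * Gd 0 N z)‖ =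
      ‖Hf N (z + h) - ↑(z + h) * (2 * π * Complex.I * Gd 0 N z) -
        (Hf N z - z * (2 * π * Complex.I * Gd 0 N z))‖ := by
    congr 1; push_cast; ring
  rw [e]
  refine this.trans (le_of_eq ?_)
  rw [add_sub_cancel_left, Real.norm_eq_abs, mul_assoc, ← sq, sq_abs]

lemma Wc_increment (N ξ : ℕ) (X h : ℝ) :
    Wc ((ξ + X) / 2 ^ N + h) - Wc ((ξ + X) / 2 ^ N) = rt ^ N *
      (Wc (X + 2 ^ N * h) - Wc X + (Hf N (X + ξ + 2 ^ N * h) - Hf N (X + ξ))) := by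
  have e1 : (ξ + X) / 2 ^ N + h = (X + ξ + 2 ^ N * h) / 2 ^ N := by field_simp; ring
  have e2 : Wc (X + ξ + 2 ^ N * h) = Wc (X + 2 ^ N * h) := by
    rw [← Wc_add_intCast (X + 2 ^ N * h) ξ]; congr 1; push_cast; ring
  have e3 : Wc (X + ξ) = Wc X := by
    rw [← Wc_add_intCast X ξ]; congr 1
  rw [e1, Wc_div_two_pow, add_comm (ξ : ℝ) X, Wc_div_two_pow, e2, e3]
  ring

/-- An increment bound for `Wc` passes to the next scales. -/
lemma norm_Wc_sub_le_of_increment {N ξ : ℕ} {X h B : ℝ}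
    (hB : ‖Wc ((ξ + X) / 2 ^ N + h) - Wc ((ξ + X) / 2 ^ N)‖ ≤ rt ^ N * B) :
    ‖Wc (X + 2 ^ N * h) - Wc X + (Hf N (X + ξ + 2 ^ N * h) - Hf N (X + ξ))‖ ≤ B ∧
    ‖Wc (X + 2 ^ N * h) - Wc X‖ ≤ B + 16 * |2 ^ N * h| := by
  have hp : 0 < rt ^ N := pow_pos rt_pos N
  rw [Wc_increment, norm_mul, norm_pow, Complex.norm_real, Real.norm_of_nonneg rt_pos.le,
    mul_le_mul_iff_right₀ hp] at hB
  refine ⟨hB, ?_⟩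
  have h1 := norm_Hf_sub_le N (X + ξ) (2 ^ N * h)
  have h2 := norm_sub_le (Wc (X + 2 ^ N * h) - Wc X + (Hf N (X + ξ + 2 ^ N * h) - Hf N (X + ξ)))
    (Hf N (X + ξ + 2 ^ N * h) - Hf N (X + ξ))
  rw [add_sub_cancel_right] at h2
  linarith

lemma vl_le_sum_fiber (N : ℕ) (E : Set ℝ) :
    vl E ≤ (1 / 2) ^ N * ∑ ξ ∈ Finset.range (2 ^ N), vl {X | (ξ + X) / 2 ^ N ∈ E} := by
  have hN : 0 < 2 ^ N := by positivity
  have h1 : vl E ≤ vl (⋃ k ∈ Finset.range (2 ^ N), E ∩ win (2 ^ N) k) := by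
    refine vl_mono' fun u hu huE => ?_
    obtain ⟨k, hk, hku⟩ := exists_mem_win hN hu
    exact mem_biUnion hk ⟨huE, hku⟩
  refine h1.trans ((vl_biUnion_le _ _).trans ?_)
  rw [Finset.mul_sum]
  refine Finset.sum_le_sum fun k hk => le_of_eq ?_
  have e : {X : ℝ | (k + X) / 2 ^ N ∈ E} ∩ Ico 0 1 =
      (fun X => (k : ℝ) + X) ⁻¹' ((fun y => ((2 : ℝ) ^ N)⁻¹ * y) ⁻¹' (E ∩ win (2 ^ N) k)) := by
    ext X
    simp only [mem_inter_iff, mem_ofPred_eq, mem_preimage, win, mem_Ico]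
    rw [inv_mul_eq_div]
    push_cast
    have hp : (0 : ℝ) < 2 ^ N := by positivity
    rw [div_le_div_iff_of_pos_right hp, div_lt_div_iff_of_pos_right hp]
    constructor
    · rintro ⟨a, b, c⟩; exact ⟨a, by linarith, by linarith⟩
    · rintro ⟨a, b, c⟩; exact ⟨a, by linarith, by linarith⟩
  have hs : vl (E ∩ win (2 ^ N) k) = volume.real (E ∩ win (2 ^ N) k) := by
    rw [vl, measureReal_def, measureReal_def, lebI, Measure.restrict_apply' measurableSet_Ico,
      inter_assoc, inter_eq_left.2 (win_subset_Ico hk)]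
  have hs' : vl {X : ℝ | (k + X) / 2 ^ N ∈ E} =
      volume.real ({X : ℝ | (k + X) / 2 ^ N ∈ E} ∩ Ico 0 1) := by
    rw [vl, measureReal_def, measureReal_def, lebI, Measure.restrict_apply' measurableSet_Ico]
  rw [hs, hs', e, measureReal_def, measureReal_def, measure_preimage_add,
    Real.volume_preimage_mul_left (by positivity), ENNReal.toReal_mul,
    ENNReal.toReal_ofReal (abs_nonneg _), inv_inv, abs_of_pos (by positivity), ← mul_assoc,
    ← mul_pow]
  norm_num

lemma fract_fiber {X : ℝ} (hX : X ∈ Ico (0 : ℝ) 1) (N ξ : ℕ) :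
    Int.fract (2 ^ N * ((ξ + X) / 2 ^ N)) = X ∧ ⌊2 ^ N * ((ξ + X) / 2 ^ N)⌋₊ = ξ := by
  have e : (2 : ℝ) ^ N * ((ξ + X) / 2 ^ N) = ξ + X := by field_simp
  rw [e]
  refine ⟨?_, ?_⟩
  · rw [Int.fract_natCast_add]; exact Int.fract_eq_self.2 hX
  · rw [Nat.floor_eq_iff (by linarith [hX.1, (ξ.cast_nonneg : (0 : ℝ) ≤ ξ)])]
    exact ⟨by linarith [hX.1], by linarith [hX.2]⟩

lemma vl_fract_le (N : ℕ) (F : Set ℝ) : vl {x | Int.fract (2 ^ N * x) ∈ F} ≤ vl F := by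
  calc _ ≤ (1 / 2) ^ N * ∑ ξ ∈ Finset.range (2 ^ N), vl F := by
        refine (vl_le_sum_fiber N _).trans ?_
        gcongr with ξ hξ
        refine vl_mono' fun X hX h => ?_
        rw [mem_ofPred_eq, mem_ofPred_eq, (fract_fiber hX N ξ).1] at h
        exact h
    _ = _ := by
        rw [Finset.sum_const, Finset.card_range, nsmul_eq_mul, ← mul_assoc]
        push_cast
        rw [← mul_pow]; norm_num

lemma integral_indicator_vl {E : Set ℝ} (hE : MeasurableSet E) :
    ∫ x, E.indicator 1 x ∂lebI = vl E := integral_indicator_one hE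

lemma integrable_indicator_lebI {E : Set ℝ} (hE : MeasurableSet E) :
    Integrable (E.indicator (1 : ℝ → ℝ)) lebI :=
  (integrable_const (1 : ℝ)).indicator hE

lemma sum_vl_le {ι : Type*} (s : Finset ι) {E : ι → Set ℝ} (hE : ∀ i, MeasurableSet (E i))
    {F : Set ℝ} (hF : MeasurableSet F) {K : ℝ}
    (h : ∀ x, ∑ i ∈ s, (E i).indicator (1 : ℝ → ℝ) x ≤ K * F.indicator 1 x) :
    ∑ i ∈ s, vl (E i) ≤ K * vl F := by
  simp_rw [← integral_indicator_vl (hE _)]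
  rw [← integral_indicator_vl hF, ← integral_finsetSum _ fun i _ => integrable_indicator_lebI (hE i),
    ← integral_const_mul]
  exact integral_mono (integrable_finsetSum _ fun i _ => integrable_indicator_lebI (hE i))
    ((integrable_indicator_lebI hF).const_mul K) h

lemma vl_le_sum_div {ι : Type*} (s : Finset ι) {E : ι → Set ℝ} (hE : ∀ i, MeasurableSet (E i))
    {K : ℝ} (hK : 0 < K) :
    vl {x | K ≤ ∑ i ∈ s, (E i).indicator (1 : ℝ → ℝ) x} ≤ (∑ i ∈ s, vl (E i)) / K := by
  rw [le_div_iff₀ hK, mul_comm]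
  refine (mul_meas_ge_le_integral_of_nonneg (ae_of_all _ fun x => ?_)
    (integrable_finsetSum _ fun i _ => integrable_indicator_lebI (hE i)) K).trans (le_of_eq ?_)
  · exact Finset.sum_nonneg fun i _ => indicator_nonneg (fun _ _ => zero_le_one) x
  · rw [integral_finsetSum _ fun i _ => integrable_indicator_lebI (hE i)]
    exact Finset.sum_congr rfl fun i _ => integral_indicator_vl (hE i)

lemma continuous_Df (j l a b : ℕ) : Continuous (Df j l a b) :=
  continuous_iff_continuousAt.2 fun u => (hasDerivAt_Df j l a b u).continuousAt

lemma continuous_Gd (j l : ℕ) : Continuous (Gd j l) :=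
  continuous_iff_continuousAt.2 fun u => (hasDerivAt_Gd j l u).continuousAt

lemma measurableSet_Yset (K : ℝ) (n a b : ℕ) : MeasurableSet (Yset norm K n a b) :=
  (isClosed_le (continuous_Df 0 n a b).norm continuous_const).measurableSet

/-- The number of points `Gd 0 N (X + η)` that are close to `Gd 0 N (X + ξ)`. -/
def cnt (N ξ : ℕ) (X : ℝ) : ℝ :=
  ∑ η ∈ Finset.range (2 ^ N), (Yset norm 100 N ξ η).indicator 1 X

lemma measurable_cnt (N ξ : ℕ) : Measurable (cnt N ξ) :=
  Finset.measurable_sum _ fun η _ => measurable_one.indicator (measurableSet_Yset 100 N ξ η)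

/-- The points with many near-coincidences at level `N`. -/
def crowded (N : ℕ) (K : ℝ) : Set ℝ := {x | K ≤ cnt N ⌊2 ^ N * x⌋₊ (Int.fract (2 ^ N * x))}

lemma vl_crowded_le (N : ℕ) {K : ℝ} (hK : 0 < K) : vl (crowded N K) ≤ (1 / 2) ^ N * (Gam N / K) := by
  refine (vl_le_sum_fiber N _).trans ?_
  gcongr
  rw [Gam, Finset.sum_div]
  refine Finset.sum_le_sum fun ξ _ => ?_
  refine le_trans (vl_mono' fun X hX h => ?_)
    (vl_le_sum_div _ (fun η => measurableSet_Yset 100 N ξ η) hK)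
  obtain ⟨e1, e2⟩ := fract_fiber hX N ξ
  rw [mem_ofPred_eq, crowded, mem_ofPred_eq, e1, e2] at h
  exact h

/-- The set of points at which the increment of `Wc` is small. -/
def flat (n : ℕ) (h : ℝ) : Set ℝ := {x | ‖Wc (x + h) - Wc x‖ ≤ 40 * (1 / 2) ^ n}

lemma measurableSet_flat (n : ℕ) (h : ℝ) : MeasurableSet (flat n h) :=
  (isClosed_le ((continuous_Wc.comp (by fun_prop)).sub continuous_Wc).norm
    continuous_const).measurableSet

lemma vl_flat_sdiff_le {q r : ℕ} (hq : 1 ≤ q) {h K : ℝ} (hK : 0 ≤ K)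
    (hl : (1 / 2) ^ (3 * q + r + 1) ≤ |h|) (hu : |h| ≤ (1 / 2) ^ (3 * q + r))
    {Bd : Set ℝ} (hBd : MeasurableSet Bd) :
    vl (flat (3 * q + r) h \ (crowded (2 * q) K ∪ {x | Int.fract (2 ^ (2 * q) * x) ∈ Bd})) ≤
      (1 / 2) ^ (2 * q) * (K * vl (flat (q + r) (2 ^ (2 * q) * h) \ Bd)) := by
  set N := 2 * q with hN
  set t := 2 ^ N * h with ht
  have hpq : (0 : ℝ) < (1 / 2) ^ q := by positivity
  have hpr : (0 : ℝ) < (1 / 2) ^ r := by positivity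
  have hq2 : (1 / 2 : ℝ) ^ q ≤ 1 / 2 := by
    simpa using pow_le_pow_of_le_one (by norm_num : (0 : ℝ) ≤ 1 / 2) (by norm_num) hq
  have hr1 : (1 / 2 : ℝ) ^ r ≤ 1 := pow_le_one₀ (by norm_num) (by norm_num)
  have hrt : rt ^ N = (1 / 2) ^ q := rt_pow_two_mul q
  have habs : |t| = 2 ^ N * |h| := by rw [ht, abs_mul, abs_of_pos (by positivity)]
  have e2 : (2 : ℝ) ^ N * ((1 / 2) ^ q * (1 / 2) ^ q) = 1 := by
    rw [hN, ← pow_add, ← two_mul, ← mul_pow]; norm_num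
  have e3 : (1 / 2 : ℝ) ^ (3 * q + r) = ((1 / 2) ^ q * (1 / 2) ^ q) * ((1 / 2) ^ q * (1 / 2) ^ r) := by
    rw [← pow_add, ← pow_add, ← pow_add]; congr 1; ring
  have hp2 : (0 : ℝ) < 2 ^ N := by positivity
  have htu : |t| ≤ (1 / 2) ^ q * (1 / 2) ^ r := by
    rw [habs]
    calc _ ≤ (2 : ℝ) ^ N * (1 / 2) ^ (3 * q + r) := by gcongr
      _ = _ := by rw [e3, ← mul_assoc, e2, one_mul]
  have htl : (1 / 2) ^ q * (1 / 2) ^ r / 2 ≤ |t| := by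
    rw [habs]
    calc _ = (2 : ℝ) ^ N * (1 / 2) ^ (3 * q + r + 1) := by
          rw [pow_succ, e3, ← mul_assoc, ← mul_assoc, e2]; ring
      _ ≤ _ := by gcongr
  set Fξ : ℕ → Set ℝ := fun ξ => {X | cnt N ξ X < K} ∩ (flat (q + r) t \ Bd) ∩
    {X | ‖Wc (X + t) - Wc X + t * (2 * π * Complex.I * Gd 0 N (X + ξ))‖ ≤
      62 * ((1 / 2) ^ q * ((1 / 2) ^ q * (1 / 2) ^ r))} with hFξ
  have hFm : ∀ ξ, MeasurableSet (Fξ ξ) := by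
    intro ξ
    refine ((measurableSet_lt (measurable_cnt N ξ) measurable_const).inter
      ((measurableSet_flat _ _).diff hBd)).inter (IsClosed.measurableSet (isClosed_le ?_ continuous_const))
    have h1 := continuous_Wc
    have h2 := continuous_Gd 0 N
    fun_prop
  refine (vl_le_sum_fiber N _).trans ?_
  gcongr
  refine le_trans (Finset.sum_le_sum fun ξ _ => vl_mono' (T := Fξ ξ) fun X hX hmem => ?_)
    (sum_vl_le _ hFm ((measurableSet_flat _ _).diff hBd) fun X => ?_)
  · obtain ⟨e4, e5⟩ := fract_fiber hX N ξ
    rw [mem_ofPred_eq, Set.mem_sdiff, mem_union, not_or, crowded, mem_ofPred_eq, mem_ofPred_eq, e4, e5,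
      not_le, flat, mem_ofPred_eq] at hmem
    obtain ⟨hflat, hcnt, hnB⟩ := hmem
    rw [e3] at hflat
    obtain ⟨h1, h2⟩ := norm_Wc_sub_le_of_increment (N := N) (ξ := ξ) (X := X) (h := h)
      (B := 40 * ((1 / 2) ^ q * ((1 / 2) ^ q * (1 / 2) ^ r)))
      (hflat.trans (le_of_eq (by rw [hrt]; ring)))
    rw [← ht] at h1 h2
    have hxy : (1 / 2 : ℝ) ^ q * ((1 / 2) ^ q * (1 / 2) ^ r) ≤ 1 / 2 * ((1 / 2) ^ q * (1 / 2) ^ r) := by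
      gcongr
    refine ⟨⟨hcnt, ?_, hnB⟩, ?_⟩
    · rw [flat, mem_ofPred_eq, pow_add]
      linarith
    · rw [mem_ofPred_eq]
      have h3 := norm_Hf_sub_sub_le N (X + ξ) t
      have h4 : t ^ 2 ≤ (1 / 2) ^ q * ((1 / 2) ^ q * (1 / 2) ^ r) := by
        rw [← sq_abs]
        calc |t| ^ 2 ≤ ((1 / 2) ^ q * (1 / 2) ^ r) ^ 2 := by gcongr
          _ = (1 / 2) ^ q * ((1 / 2) ^ q * (1 / 2) ^ r) * (1 / 2) ^ r := by ring
          _ ≤ _ := mul_le_of_le_one_right (by positivity) hr1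
      have h5 := norm_sub_le (Wc (X + t) - Wc X + (Hf N (X + ξ + t) - Hf N (X + ξ)))
        (Hf N (X + ξ + t) - Hf N (X + ξ) - t * (2 * π * Complex.I * Gd 0 N (X + ξ)))
      rw [add_sub_assoc, sub_sub_cancel] at h5
      linarith
  · by_cases hX : X ∈ flat (q + r) t \ Bd
    · rw [indicator_of_mem hX, Pi.one_apply, mul_one]
      by_cases hex : ∃ ξ, X ∈ Fξ ξ
      · obtain ⟨ξ₀, h0⟩ := hex
        refine le_trans (Finset.sum_le_sum fun ξ _ => ?_) h0.1.1.le
        by_cases hξ : X ∈ Fξ ξ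
        · rw [indicator_of_mem hξ, indicator_of_mem]
          have h1 := h0.2
          have h2 := hξ.2
          rw [mem_ofPred_eq] at h1 h2
          rw [Yset, mem_ofPred_eq, Df, hrt]
          have h3 := norm_sub_le_of_le h2 h1
          rw [add_sub_add_left_eq_sub, ← mul_sub, ← mul_sub, norm_mul, norm_mul, norm_mul, norm_mul,
            Complex.norm_I, Complex.norm_real, Complex.norm_real, Real.norm_of_nonneg pi_pos.le,
            Real.norm_eq_abs, Complex.norm_ofNat] at h3
          set D := ‖Gd 0 N (X + ξ) - Gd 0 N (X + ξ₀)‖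
          have hD : 0 ≤ D := norm_nonneg _
          have h4 : (1 / 2) ^ q * (1 / 2) ^ r / 2 * (2 * 3 * 1 * D) ≤ |t| * (2 * π * 1 * D) := by
            gcongr
            exact pi_gt_three.le
          have h5 : 0 < (1 / 2 : ℝ) ^ q * (1 / 2) ^ r := by positivity
          have h6 : ((1 / 2) ^ q * (1 / 2) ^ r) * (3 * D) ≤
              ((1 / 2) ^ q * (1 / 2) ^ r) * (124 * (1 / 2) ^ q) := by linarith
          have h7 := le_of_mul_le_mul_left h6 h5
          linarith
        · rw [indicator_of_notMem hξ]
          exact indicator_nonneg (fun _ _ => zero_le_one) X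
      · push Not at hex
        rw [Finset.sum_eq_zero fun ξ _ => indicator_of_notMem (hex ξ) _]
        exact hK
    · rw [indicator_of_notMem hX, mul_zero]
      exact (Finset.sum_eq_zero fun ξ _ => indicator_of_notMem (fun h => hX h.1.2) _).le

/-- Outside exceptional sets of exponentially small length, the sets where an increment of `Wc` of
step about `2 ^ (-n)` is at most of order `2 ^ (-n)` have length of order at most `lam ^ n`. -/
def FlatBound (lam : ℝ) : Prop :=
  ∃ A c : ℝ, 0 ≤ A ∧ 0 < c ∧ c < 1 ∧ ∃ Bd : ℕ → Set ℝ, (∀ n, MeasurableSet (Bd n)) ∧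
    (∀ n, vl (Bd n) ≤ A * c ^ n) ∧
    ∀ (n : ℕ) (h : ℝ), (1 / 2) ^ (n + 1) ≤ |h| → |h| ≤ (1 / 2) ^ n →
      vl (flat n h \ Bd n) ≤ A * lam ^ n

lemma FlatBound.of_one_le {lam : ℝ} (hl : 1 ≤ lam) : FlatBound lam := by
  refine ⟨1, 1 / 2, zero_le_one, by norm_num, by norm_num, fun _ => ∅, fun _ => MeasurableSet.empty,
    fun n => ?_, fun n h _ _ => ?_⟩
  · simp [vl]
  · rw [one_mul]
    exact (vl_le_one _).trans (one_le_pow₀ hl)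

lemma pow_div_three_le {x y : ℝ} (hy : 0 < y) (hy1 : y ≤ 1) (hxy : x ≤ y ^ 3) (hx : 0 ≤ x) (n : ℕ) :
    x ^ (n / 3) ≤ y ^ n / y ^ 2 := by
  rw [le_div_iff₀ (by positivity)]
  calc x ^ (n / 3) * y ^ 2 ≤ (y ^ 3) ^ (n / 3) * y ^ (n % 3) :=
        mul_le_mul (by gcongr) (pow_le_pow_of_le_one hy.le hy1 (by omega)) (by positivity)
          (by positivity)
    _ = y ^ n := by rw [← pow_mul, ← pow_add, Nat.div_add_mod]

lemma FlatBound.step {lam lam' s : ℝ} (hs : 1 < s) (hl : 0 < lam') (hll : lam' ≤ lam)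
    (h3 : (s / 2) ^ 2 * lam ≤ lam' ^ 3) (H : FlatBound lam) : FlatBound lam' := by
  obtain ⟨A, c, hA, hc, hc1, Bd, hBm, hBv, hflat⟩ := H
  obtain ⟨ρ, hρ1, hρs⟩ := exists_between hs
  obtain ⟨A₁, hA₁, hGam⟩ := Gam_le hρ1
  have hs0 : 0 < s := by linarith
  have hρ0 : 0 < ρ := by linarith
  have hratio : ρ / s < 1 := by rwa [div_lt_one hs0]
  set m := max c ((ρ / s) ^ 2) with hm
  have hm0 : 0 < m := lt_of_lt_of_le hc (le_max_left _ _)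
  have hm1 : m < 1 := max_lt hc1 (pow_lt_one₀ (by positivity) hratio (by norm_num))
  set c' := m ^ (((3 : ℕ) : ℝ)⁻¹) with hc'
  have hc'3 : c' ^ 3 = m := Real.rpow_inv_natCast_pow hm0.le (by norm_num)
  have hc'0 : 0 < c' := Real.rpow_pos_of_pos hm0 _
  have hc'1 : c' < 1 := Real.rpow_lt_one hm0.le hm1 (by norm_num)
  have hcrowd : ∀ q : ℕ, vl (crowded (2 * q) (s ^ (2 * q))) ≤ A₁ * ((ρ / s) ^ 2) ^ q := by
    intro q
    refine (vl_crowded_le _ (by positivity)).trans ?_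
    calc _ ≤ (1 / 2 : ℝ) ^ (2 * q) * (A₁ * ρ ^ (2 * q) * 2 ^ (2 * q) / s ^ (2 * q)) := by
          gcongr; exact hGam _
      _ = A₁ * ((ρ / s) ^ (2 * q)) * ((1 / 2 : ℝ) * 2) ^ (2 * q) := by
          rw [div_pow ρ, mul_pow]; ring
      _ = _ := by norm_num [pow_mul]
  set E : ℕ → Set ℝ := fun n => crowded (2 * (n / 3)) (s ^ (2 * (n / 3))) ∪
    {x | Int.fract (2 ^ (2 * (n / 3)) * x) ∈ Bd (n / 3 + n % 3)} with hE
  have hBd : ∀ n, flat n = flat (3 * (n / 3) + n % 3) := fun n => by rw [Nat.div_add_mod]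
  set A' := max ((A₁ + A) / c' ^ 2) (A * (lam / lam' + 1) ^ 2 + (1 + lam'⁻¹ ^ 1 + lam'⁻¹ ^ 2)) with hA'
  have hlam0 : 0 < lam := by linarith
  refine ⟨A', c', le_max_of_le_left (by positivity), hc'0, hc'1, fun n => toMeasurable lebI (E n),
    fun n => measurableSet_toMeasurable _ _, fun n => ?_, fun n h h1 h2 => ?_⟩
  · have e1 : vl (toMeasurable lebI (E n)) = vl (E n) := by
      rw [vl, measureReal_def, measure_toMeasurable]; rfl
    rw [e1]
    refine (vl_union_le _ _).trans ?_
    have hx := pow_div_three_le hc'0 hc'1.le hc'3.ge hm0.le n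
    calc _ ≤ A₁ * ((ρ / s) ^ 2) ^ (n / 3) + A * c ^ (n / 3) := by
          refine add_le_add (hcrowd _) ((vl_fract_le _ _).trans ((hBv _).trans ?_))
          exact mul_le_mul_of_nonneg_left
            (pow_le_pow_of_le_one hc.le hc1.le (by omega)) hA
      _ ≤ A₁ * m ^ (n / 3) + A * m ^ (n / 3) := by
          gcongr
          · exact le_max_right _ _
          · exact le_max_left _ _
      _ = (A₁ + A) * m ^ (n / 3) := by ring
      _ ≤ (A₁ + A) * (c' ^ n / c' ^ 2) := by gcongr
      _ = (A₁ + A) / c' ^ 2 * c' ^ n := by ring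
      _ ≤ _ := by gcongr; exact le_max_left _ _
  · refine le_trans ?_ (mul_le_mul_of_nonneg_right (le_max_right _ _) (by positivity))
    have hnn : 0 ≤ A * (lam / lam' + 1) ^ 2 := by positivity
    rw [add_mul]
    rcases Nat.eq_zero_or_pos (n / 3) with hq | hq
    · refine (vl_le_one _).trans ?_
      have hn : n < 3 := by omega
      have h4 : 1 ≤ (1 + lam'⁻¹ ^ 1 + lam'⁻¹ ^ 2) * lam' ^ n := by
        have e : ∀ k, lam'⁻¹ ^ k * lam' ^ k = 1 := fun k => by
          rw [← mul_pow, inv_mul_cancel₀ hl.ne', one_pow]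
        have hk : ∀ k, 0 ≤ lam'⁻¹ ^ k * lam' ^ n := fun k => by positivity
        rw [add_mul, add_mul, one_mul]
        have a1 := hk 1
        have a2 := hk 2
        have a0 : 0 ≤ lam' ^ n := by positivity
        interval_cases n
        · linarith
        · linarith [e 1]
        · linarith [e 2]
      have : 0 ≤ A * (lam / lam' + 1) ^ 2 * lam' ^ n := by positivity
      linarith
    · have hn := Nat.div_add_mod n 3
      have hr : n % 3 ≤ 2 := by omega
      set q := n / 3
      set r := n % 3
      have h5 : vl (flat n h \ toMeasurable lebI (E n)) ≤ vl (flat n h \ E n) :=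
        vl_mono (sdiff_subset_sdiff_right (subset_toMeasurable _ _))
      have h6 := vl_flat_sdiff_le hq (r := r) (K := s ^ (2 * q)) (by positivity)
        (by rw [hn]; exact h1) (by rw [hn]; exact h2) (hBm (q + r))
      have e0 : (2 : ℝ) ^ (2 * q) * (1 / 2) ^ (2 * q) = 1 := by rw [← mul_pow]; norm_num
      have habs : |2 ^ (2 * q) * h| = 2 ^ (2 * q) * |h| := by
        rw [abs_mul, abs_of_pos (by positivity)]
      have h7 := hflat (q + r) (2 ^ (2 * q) * h)
        (by
          rw [habs]
          calc _ = (2 : ℝ) ^ (2 * q) * (1 / 2) ^ (2 * q) * (1 / 2) ^ (q + r + 1) := by rw [e0, one_mul]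
            _ = (2 : ℝ) ^ (2 * q) * (1 / 2) ^ (n + 1) := by
              rw [mul_assoc, ← pow_add]; congr 2; omega
            _ ≤ _ := by gcongr)
        (by
          rw [habs]
          calc _ ≤ (2 : ℝ) ^ (2 * q) * (1 / 2) ^ n := by gcongr
            _ = (2 : ℝ) ^ (2 * q) * (1 / 2) ^ (2 * q) * (1 / 2) ^ (q + r) := by
              rw [mul_assoc, ← pow_add]; congr 2; omega
            _ = _ := by rw [e0, one_mul])
      rw [hn] at h6
      have h8 : (1 / 2 : ℝ) ^ (2 * q) * s ^ (2 * q) * lam ^ q ≤ lam' ^ (3 * q) := by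
        calc _ = ((s / 2) ^ 2 * lam) ^ q := by
              rw [← mul_pow, pow_mul, ← mul_pow]; ring
          _ ≤ (lam' ^ 3) ^ q := by gcongr
          _ = _ := by rw [← pow_mul]
      have h9 : lam ^ r ≤ (lam / lam' + 1) ^ 2 * lam' ^ r := by
        have h10 : 1 ≤ lam / lam' + 1 := by
          have : 0 < lam / lam' := by positivity
          linarith
        calc lam ^ r = (lam / lam') ^ r * lam' ^ r := by
              rw [← mul_pow, div_mul_cancel₀ _ hl.ne']
          _ ≤ (lam / lam' + 1) ^ r * lam' ^ r := by gcongr; linarith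
          _ ≤ _ := by gcongr
      calc _ ≤ (1 / 2 : ℝ) ^ (2 * q) * (s ^ (2 * q) * (A * lam ^ (q + r))) := by
            refine h5.trans (h6.trans ?_)
            gcongr
        _ = A * (((1 / 2 : ℝ) ^ (2 * q) * s ^ (2 * q) * lam ^ q) * lam ^ r) := by
            rw [pow_add]; ring
        _ ≤ A * (lam' ^ (3 * q) * ((lam / lam' + 1) ^ 2 * lam' ^ r)) := by gcongr
        _ = A * (lam / lam' + 1) ^ 2 * lam' ^ n := by
            rw [← hn, pow_add]; ring
        _ ≤ _ := le_add_of_nonneg_right (by positivity)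

lemma flatBound_of_one_lt {s : ℝ} (hs : 1 < s) : FlatBound (s ^ 2 / 2) := by
  have hs0 : 0 < s := by linarith
  have key : ∀ k : ℕ, FlatBound (s ^ (k + 2) / 2) → FlatBound (s ^ 2 / 2) := by
    intro k
    induction k with
    | zero => exact id
    | succ k ih =>
      intro h
      refine ih (h.step hs (by positivity) ?_ ?_)
      · gcongr
        · exact hs.le
        · omega
      · calc (s / 2) ^ 2 * (s ^ (k + 1 + 2) / 2) = s ^ (k + 5) / 8 := by ring
          _ ≤ s ^ (3 * k + 6) / 8 :=
            div_le_div_of_nonneg_right (pow_le_pow_right₀ hs.le (by omega)) (by norm_num)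
          _ = _ := by ring
  obtain ⟨k, hk⟩ := ((tendsto_pow_atTop_atTop_of_one_lt hs).comp
    (tendsto_add_atTop_nat 2)).eventually_ge_atTop 2 |>.exists
  exact key k (FlatBound.of_one_le (by rw [le_div_iff₀ (by norm_num)]; simpa using hk))

lemma vl_section_le {S : Set (ℝ × ℝ)} (hS : MeasurableSet S) {J : Set ℝ} (hJ : MeasurableSet J)
    {j B t : ℝ} (hj0 : 0 ≤ j) (hj : volume J ≤ ENNReal.ofReal j) (hSJ : ∀ p ∈ S, p.2 ∈ J)
    (hB0 : 0 ≤ B) (hB : ∀ h ∈ J, vl {x | (x, h) ∈ S} ≤ B) (ht : 0 < t) :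
    vl {x | ENNReal.ofReal t ≤ volume {h | (x, h) ∈ S}} ≤ j * B / t := by
  have h1 : ENNReal.ofReal t * lebI {x | ENNReal.ofReal t ≤ volume {h | (x, h) ∈ S}} ≤
      ENNReal.ofReal (j * B) := by
    calc _ ≤ ∫⁻ x, volume (Prod.mk x ⁻¹' S) ∂lebI :=
          mul_meas_ge_le_lintegral (measurable_measure_prodMk_left hS) _
      _ = (lebI.prod volume) S := (Measure.prod_apply hS).symm
      _ = ∫⁻ h, lebI ((fun x => (x, h)) ⁻¹' S) := Measure.prod_apply_symm hS
      _ ≤ ∫⁻ h, J.indicator (fun _ => ENNReal.ofReal B) h := by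
          refine lintegral_mono fun h => ?_
          by_cases hh : h ∈ J
          · rw [indicator_of_mem hh]
            exact (ENNReal.le_ofReal_iff_toReal_le (measure_ne_top _ _) hB0).2 (hB h hh)
          · have : (fun x => (x, h)) ⁻¹' S = ∅ := by
              ext x; simpa using fun hx => hh (hSJ _ hx)
            rw [this]; simp
      _ = ENNReal.ofReal B * volume J := lintegral_indicator_const hJ _
      _ ≤ ENNReal.ofReal B * ENNReal.ofReal j := by gcongr
      _ = _ := by rw [← ENNReal.ofReal_mul hB0, mul_comm]
  rw [le_div_iff₀ ht, mul_comm]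
  have h2 := ENNReal.toReal_mono ENNReal.ofReal_ne_top h1
  rwa [ENNReal.toReal_mul, ENNReal.toReal_ofReal ht.le, ENNReal.toReal_ofReal (by positivity)] at h2

/-- The steps of size about `2 ^ (-a)`. -/
def annulus (a : ℕ) : Set ℝ := {h | (1 / 2) ^ (a + 1) ≤ |h| ∧ |h| ≤ (1 / 2) ^ a}

lemma measurableSet_annulus (a : ℕ) : MeasurableSet (annulus a) := by
  have h : Continuous fun h : ℝ => |h| := continuous_abs
  exact ((isClosed_le continuous_const h).inter (isClosed_le h continuous_const)).measurableSet

lemma volume_abs_le (r : ℝ) : volume {h : ℝ | |h| ≤ r} = ENNReal.ofReal (2 * r) := by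
  have : {h : ℝ | |h| ≤ r} = Icc (-r) r := by ext h; rw [mem_ofPred_eq, mem_Icc, abs_le]
  rw [this, Real.volume_Icc]; congr 1; ring

lemma volume_annulus_le (a : ℕ) : volume (annulus a) ≤ ENNReal.ofReal (2 * (1 / 2) ^ a) :=
  (measure_mono fun _ h => h.2).trans (volume_abs_le _).le

/-- The pairs `(x, h)` with `h` of size `2 ^ (-(2 * b - m))`, such that the increment of `Wc` at `x`
with step `h` is at most `2 ^ (-b)`, and with `x` not exceptional. -/
def flatPairs (Bd : ℕ → Set ℝ) (b m : ℕ) : Set (ℝ × ℝ) :=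
  {p | p.2 ∈ annulus (2 * b - m) ∧ ‖Wc (p.1 + p.2) - Wc p.1‖ ≤ (1 / 2) ^ b ∧
    Int.fract (2 ^ (2 * (b - m)) * p.1) ∉ Bd m}

lemma measurableSet_flatPairs {Bd : ℕ → Set ℝ} (hBd : ∀ n, MeasurableSet (Bd n)) (b m : ℕ) :
    MeasurableSet (flatPairs Bd b m) := by
  refine (measurable_snd (measurableSet_annulus _)).inter (MeasurableSet.inter ?_ ?_)
  · have hc : Continuous fun p : ℝ × ℝ => ‖Wc (p.1 + p.2) - Wc p.1‖ :=
      ((continuous_Wc.comp (continuous_fst.add continuous_snd)).sub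
        (continuous_Wc.comp continuous_fst)).norm
    exact (isClosed_le hc continuous_const).measurableSet
  · have : Measurable fun p : ℝ × ℝ => Int.fract (2 ^ (2 * (b - m)) * p.1) := by fun_prop
    exact (this (hBd m)).compl

lemma vl_flatPairs_section_le {Bd : ℕ → Set ℝ} {b m : ℕ} (hm : m ≤ b) {h B : ℝ}
    (hh : h ∈ annulus (2 * b - m))
    (hB : ∀ t : ℝ, (1 / 2) ^ (m + 1) ≤ |t| → |t| ≤ (1 / 2) ^ m → vl (flat m t \ Bd m) ≤ B) :
    vl {x | (x, h) ∈ flatPairs Bd b m} ≤ B := by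
  obtain ⟨k, rfl⟩ : ∃ k, b = m + k := ⟨b - m, by omega⟩
  have e0 : (2 : ℝ) ^ (2 * k) * (1 / 2) ^ (2 * k) = 1 := by rw [← mul_pow]; norm_num
  have habs : |2 ^ (2 * k) * h| = 2 ^ (2 * k) * |h| := by
    rw [abs_mul, abs_of_pos (by positivity)]
  have hu : |2 ^ (2 * k) * h| ≤ (1 / 2) ^ m := by
    rw [habs]
    calc _ ≤ (2 : ℝ) ^ (2 * k) * (1 / 2) ^ (2 * (m + k) - m) := by gcongr; exact hh.2
      _ = (2 : ℝ) ^ (2 * k) * (1 / 2) ^ (2 * k) * (1 / 2) ^ m := by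
        rw [mul_assoc, ← pow_add]; congr 2; omega
      _ = _ := by rw [e0, one_mul]
  have hl : (1 / 2) ^ (m + 1) ≤ |2 ^ (2 * k) * h| := by
    rw [habs]
    calc _ = (2 : ℝ) ^ (2 * k) * (1 / 2) ^ (2 * k) * (1 / 2) ^ (m + 1) := by rw [e0, one_mul]
      _ = (2 : ℝ) ^ (2 * k) * (1 / 2) ^ (2 * (m + k) - m + 1) := by
        rw [mul_assoc, ← pow_add]; congr 2; omega
      _ ≤ _ := by gcongr; exact hh.1
  refine le_trans (vl_mono' fun x hx hmem => ?_)
    ((vl_fract_le (2 * k) (flat m (2 ^ (2 * k) * h) \ Bd m)).trans (hB _ hl hu))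
  obtain ⟨-, h1, h2⟩ := hmem
  rw [add_tsub_cancel_left] at h2
  refine ⟨?_, h2⟩
  have hx2 : ((⌊2 ^ (2 * k) * x⌋₊ : ℝ) + Int.fract (2 ^ (2 * k) * x)) / 2 ^ (2 * k) = x := by
    rw [natCast_floor_eq_intCast_floor (mul_nonneg (by positivity) hx.1), Int.floor_add_fract]
    field_simp
  have h3 := (norm_Wc_sub_le_of_increment (N := 2 * k) (ξ := ⌊2 ^ (2 * k) * x⌋₊)
    (X := Int.fract (2 ^ (2 * k) * x)) (h := h) (B := (1 / 2) ^ m) (by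
      rw [hx2, rt_pow_two_mul, ← pow_add, add_comm k m]; exact h1)).2
  rw [flat, mem_ofPred_eq]
  have : (0 : ℝ) < (1 / 2) ^ m := by positivity
  linarith

lemma volume_flat_steps_le {Bd : ℕ → Set ℝ} {b q : ℕ} (hq : q ≤ b) {x t : ℝ} (ht : 0 ≤ t)
    (hx : ∀ m ∈ Finset.Icc q b, Int.fract (2 ^ (2 * (b - m)) * x) ∉ Bd m ∧
      volume {h | (x, h) ∈ flatPairs Bd b m} ≤ ENNReal.ofReal t) :
    volume {h | |h| ≤ (1 / 2) ^ b ∧ ‖Wc (x + h) - Wc x‖ ≤ (1 / 2) ^ b} ≤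
      ENNReal.ofReal (2 * (1 / 2) ^ (2 * b - q) + (b + 1) * t) := by
  have hsub : {h | |h| ≤ (1 / 2) ^ b ∧ ‖Wc (x + h) - Wc x‖ ≤ (1 / 2) ^ b} ⊆
      {h | |h| ≤ (1 / 2) ^ (2 * b - q)} ∪ ⋃ m ∈ Finset.Icc q b, {h | (x, h) ∈ flatPairs Bd b m} := by
    rintro h ⟨h1, h2⟩
    by_cases h3 : |h| ≤ (1 / 2) ^ (2 * b - q)
    · exact Or.inl h3
    · right
      rw [not_le] at h3
      have h0 : 0 < |h| := lt_trans (by positivity) h3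
      obtain ⟨a, ha1, ha2⟩ := exists_nat_pow_near_of_lt_one h0
        (h1.trans (pow_le_one₀ (by norm_num) (by norm_num))) (by norm_num : (0 : ℝ) < 1 / 2) (by norm_num)
      have hab : b ≤ a := by
        by_contra hlt
        exact absurd (ha1.trans_le h1) (not_lt.2
          (pow_le_pow_of_le_one (by norm_num) (by norm_num) (by omega)))
      have hab2 : a ≤ 2 * b - q := by
        by_contra hlt
        exact absurd (h3.trans_le ha2) (not_lt.2
          (pow_le_pow_of_le_one (by norm_num) (by norm_num) (by omega)))
      have hmem : 2 * b - a ∈ Finset.Icc q b := by rw [Finset.mem_Icc]; omega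
      refine mem_biUnion hmem ⟨?_, h2, (hx _ hmem).1⟩
      rw [show 2 * b - (2 * b - a) = a by omega]
      exact ⟨ha1.le, ha2⟩
  calc _ ≤ volume {h : ℝ | |h| ≤ (1 / 2) ^ (2 * b - q)} +
        ∑ m ∈ Finset.Icc q b, volume {h | (x, h) ∈ flatPairs Bd b m} :=
        (measure_mono hsub).trans ((measure_union_le _ _).trans
          (add_le_add le_rfl (measure_biUnion_finset_le _ _)))
    _ ≤ ENNReal.ofReal (2 * (1 / 2) ^ (2 * b - q)) + ∑ m ∈ Finset.Icc q b, ENNReal.ofReal t :=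
        add_le_add (volume_abs_le _).le (Finset.sum_le_sum fun m hm => (hx m hm).2)
    _ = ENNReal.ofReal (2 * (1 / 2) ^ (2 * b - q) + ∑ m ∈ Finset.Icc q b, t) := by
        rw [ENNReal.ofReal_add (by positivity) (Finset.sum_nonneg fun _ _ => ht),
          ENNReal.ofReal_sum_of_nonneg fun _ _ => ht]
    _ ≤ _ := by
        refine ENNReal.ofReal_le_ofReal ?_
        rw [Finset.sum_const, nsmul_eq_mul, Nat.card_Icc]
        have : ((b + 1 - q : ℕ) : ℝ) ≤ b + 1 := by exact_mod_cast Nat.sub_le _ _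
        gcongr

/-- A set of positive length on which the local increments of `Wc` spread out. -/
lemma exists_spread_set {β : ℝ} (hβ : 1 < β) : ∃ (M q₀ : ℕ) (K : Set ℝ), 1 ≤ M ∧ lebI K ≠ 0 ∧
    ∀ x ∈ K, ∀ q, q₀ ≤ q → volume {h | |h| ≤ (1 / 2) ^ (M * q) ∧
      ‖Wc (x + h) - Wc x‖ ≤ (1 / 2) ^ (M * q)} ≤ ENNReal.ofReal ((β / 4) ^ (M * q)) := by
  obtain ⟨s, hs1, hs2⟩ : ∃ s, 1 < s ∧ s < √β :=
    exists_between (by rw [Real.lt_sqrt (by norm_num)]; linarith)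
  have hβ0 : 0 < β := by linarith
  have hs0 : 0 < s := by linarith
  have hsβ : s ^ 2 < β := (Real.lt_sqrt hs0.le).1 hs2
  obtain ⟨A, c, hA, hc, hc1, Bd, hBm, hBv, hflat⟩ := flatBound_of_one_lt hs1
  obtain ⟨M, hM4, hM1⟩ := ((tendsto_pow_atTop_atTop_of_one_lt hβ).eventually_ge_atTop
    4).and (eventually_ge_atTop 1) |>.exists
  have hM0 : (1 : ℝ) ≤ M := by exact_mod_cast hM1
  set t : ℕ → ℝ := fun b => (β / 4) ^ b / (2 * (b + 1)) with ht
  have ht0 : ∀ b, 0 < t b := fun b => by positivity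
  set fail : ℕ → Set ℝ := fun q => ⋃ m ∈ Finset.Icc q (M * q),
    ({x | Int.fract (2 ^ (2 * (M * q - m)) * x) ∈ Bd m} ∪
      {x | ENNReal.ofReal (t (M * q)) ≤ volume {h | (x, h) ∈ flatPairs Bd (M * q) m}}) with hfail
  set d := max c (s ^ 2 / β) with hd
  have hsb1 : s ^ 2 / β < 1 := by rwa [div_lt_one hβ0]
  have hd0 : 0 < d := hc.trans_le (le_max_left _ _)
  have hd1 : d < 1 := max_lt hc1 hsb1
  obtain ⟨r, hdr, hr1⟩ := exists_between hd1
  obtain ⟨C, hC, hpoly⟩ := exists_sq_mul_pow_le hd0 hdr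
  have hqM : ∀ q, q ≤ M * q := fun q => Nat.le_mul_of_pos_left q (by omega)
  have hT : ∀ q m, m ≤ M * q → vl {x | ENNReal.ofReal (t (M * q)) ≤
      volume {h | (x, h) ∈ flatPairs Bd (M * q) m}} ≤ 4 * A * ((M * q : ℕ) + 1) * d ^ q := by
    intro q m hm
    set b := M * q
    have h1 := vl_section_le (measurableSet_flatPairs hBm b m) (measurableSet_annulus (2 * b - m))
      (by positivity) (volume_annulus_le (2 * b - m)) (fun p hp => hp.1)
      (B := A * (s ^ 2 / 2) ^ m) (by positivity)
      (fun h hh => vl_flatPairs_section_le hm hh (hflat m)) (ht0 b)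
    refine h1.trans ?_
    have e1 : (1 / 2 : ℝ) ^ (2 * b - m) * (1 / 2) ^ m = (1 / 4) ^ b := by
      rw [← pow_add, show 2 * b - m + m = 2 * b by omega, pow_mul]; norm_num
    calc _ = 4 * A * (b + 1) * ((1 / 2 : ℝ) ^ (2 * b - m) * (1 / 2) ^ m) * (s ^ 2) ^ m /
          (β / 4) ^ b := by
          rw [ht, div_pow (s ^ 2), one_div_pow 2 m]
          field_simp
          ring
      _ ≤ 4 * A * (b + 1) * ((1 / 2 : ℝ) ^ (2 * b - m) * (1 / 2) ^ m) * (s ^ 2) ^ b /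
          (β / 4) ^ b := by
          gcongr
          exact one_le_pow₀ hs1.le
      _ = 4 * A * (b + 1) * (s ^ 2 / β) ^ b := by
          rw [e1, div_pow, div_pow, div_pow, one_pow]
          field_simp
      _ ≤ 4 * A * (b + 1) * (s ^ 2 / β) ^ q := by
          gcongr 4 * A * (b + 1) * ?_
          exact pow_le_pow_of_le_one (by positivity) hsb1.le (hqM q)
      _ ≤ _ := by gcongr; exact le_max_right _ _
  have hfv : ∀ q, vl (fail q) ≤ 5 * A * M ^ 2 * C * r ^ q := by
    intro q
    have hcast : (((M * q : ℕ) : ℝ) + 1) ≤ M * (q + 1) := by push_cast; linarith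
    have hb0 : (1 : ℝ) ≤ ((M * q : ℕ) : ℝ) + 1 := le_add_of_nonneg_left (Nat.cast_nonneg _)
    calc vl (fail q) ≤ ∑ m ∈ Finset.Icc q (M * q), (A * d ^ q + 4 * A * ((M * q : ℕ) + 1) * d ^ q) := by
          refine (vl_biUnion_le _ _).trans (Finset.sum_le_sum fun m hm => ?_)
          rw [Finset.mem_Icc] at hm
          refine (vl_union_le _ _).trans (add_le_add ((vl_fract_le _ _).trans ((hBv m).trans ?_))
            (hT q m hm.2))
          gcongr A * ?_
          calc c ^ m ≤ c ^ q := pow_le_pow_of_le_one hc.le hc1.le hm.1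
            _ ≤ _ := by gcongr; exact le_max_left _ _
      _ = ((M * q + 1 - q : ℕ) : ℝ) * (A * d ^ q + 4 * A * ((M * q : ℕ) + 1) * d ^ q) := by
          rw [Finset.sum_const, nsmul_eq_mul, Nat.card_Icc]
      _ ≤ ((M * q : ℕ) + 1) * (A * d ^ q * ((M * q : ℕ) + 1) + 4 * A * ((M * q : ℕ) + 1) * d ^ q) := by
          have h1 : ((M * q + 1 - q : ℕ) : ℝ) ≤ (M * q : ℕ) + 1 := by exact_mod_cast Nat.sub_le _ _
          have h2 : A * d ^ q ≤ A * d ^ q * ((M * q : ℕ) + 1) := le_mul_of_one_le_right (by positivity) hb0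
          gcongr
      _ = 5 * A * ((M * q : ℕ) + 1) ^ 2 * d ^ q := by ring
      _ ≤ 5 * A * (M * (q + 1)) ^ 2 * d ^ q := by gcongr
      _ = 5 * A * M ^ 2 * ((q + 1) ^ 2 * d ^ q) := by ring
      _ ≤ 5 * A * M ^ 2 * (C * r ^ q) := mul_le_mul_of_nonneg_left (hpoly q) (by positivity)
      _ = _ := by ring
  have hr0 : 0 < r := hd0.trans hdr
  obtain ⟨q₀, hq₀, hq2⟩ : ∃ q₀ : ℕ, 5 * A * M ^ 2 * C * (1 - r)⁻¹ * r ^ q₀ < 1 ∧ 2 ≤ q₀ := by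
    have := (tendsto_pow_atTop_nhds_zero_of_lt_one hr0.le hr1).const_mul (5 * A * M ^ 2 * C * (1 - r)⁻¹)
    rw [mul_zero] at this
    exact ((this.eventually (gt_mem_nhds zero_lt_one)).and (eventually_ge_atTop 2)).exists
  refine ⟨M, q₀, {x | ∀ q, q₀ ≤ q → x ∉ fail q}, hM1, fun h0 => ?_, fun x hx q hq => ?_⟩
  · have hcov : univ ⊆ {x | ∀ q, q₀ ≤ q → x ∉ fail q} ∪ ⋃ n : ℕ, fail (q₀ + n) := by
      intro x _
      by_cases hx : ∀ q, q₀ ≤ q → x ∉ fail q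
      · exact Or.inl hx
      · right
        push Not at hx
        obtain ⟨q, hq, hxq⟩ := hx
        exact mem_iUnion.2 ⟨q - q₀, by rwa [Nat.add_sub_cancel' hq]⟩
    have hsum : HasSum (fun n : ℕ => 5 * A * M ^ 2 * C * r ^ (q₀ + n))
        (5 * A * M ^ 2 * C * (1 - r)⁻¹ * r ^ q₀) := by
      have := (hasSum_geometric_of_lt_one hr0.le hr1).mul_left (5 * A * M ^ 2 * C * r ^ q₀)
      have e : (fun n : ℕ => 5 * A * M ^ 2 * C * r ^ (q₀ + n)) =
          fun n => 5 * A * M ^ 2 * C * r ^ q₀ * r ^ n := by funext n; rw [pow_add]; ring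
      rw [e, mul_right_comm _ (1 - r)⁻¹]
      exact this
    have h1 : (1 : ENNReal) ≤ ENNReal.ofReal (5 * A * M ^ 2 * C * (1 - r)⁻¹ * r ^ q₀) := by
      calc (1 : ENNReal) = lebI univ := measure_univ.symm
        _ ≤ lebI {x | ∀ q, q₀ ≤ q → x ∉ fail q} + lebI (⋃ n : ℕ, fail (q₀ + n)) :=
            (measure_mono hcov).trans (measure_union_le _ _)
        _ ≤ 0 + ∑' n : ℕ, lebI (fail (q₀ + n)) := add_le_add h0.le (measure_iUnion_le _)
        _ ≤ ∑' n : ℕ, ENNReal.ofReal (5 * A * M ^ 2 * C * r ^ (q₀ + n)) := by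
            rw [zero_add]
            refine ENNReal.tsum_le_tsum fun n => ?_
            exact (ENNReal.le_ofReal_iff_toReal_le (measure_ne_top _ _) (by positivity)).2 (hfv _)
        _ = _ := by
            rw [← hsum.tsum_eq, ENNReal.ofReal_tsum_of_nonneg (fun n => by positivity) hsum.summable]
    rw [ENNReal.one_le_ofReal] at h1
    linarith
  · have hxq := hx q hq
    simp only [hfail, mem_iUnion, not_exists, mem_union, not_or, mem_ofPred_eq, not_le] at hxq
    refine (volume_flat_steps_le (hqM q) (ht0 (M * q)).le
      fun m hm => ⟨(hxq m hm).1, (hxq m hm).2.le⟩).trans (ENNReal.ofReal_le_ofReal ?_)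
    set b := M * q with hb
    have hb0 : (0 : ℝ) < (b : ℝ) + 1 := by positivity
    have e1 : ((b : ℝ) + 1) * t b = (β / 4) ^ b / 2 := by
      rw [ht]; field_simp
    have e2 : (1 / 2 : ℝ) ^ (2 * b - q) = 2 ^ q * (1 / 4) ^ b := by
      have h1 : (1 / 2 : ℝ) ^ (2 * b - q) * (1 / 2) ^ q = (1 / 4) ^ b := by
        rw [← pow_add, show 2 * b - q + q = 2 * b by have := hqM q; omega, pow_mul]; norm_num
      have h2 : (2 : ℝ) ^ q * (1 / 2) ^ q = 1 := by rw [← mul_pow]; norm_num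
      calc (1 / 2 : ℝ) ^ (2 * b - q) = (1 / 2) ^ (2 * b - q) * (2 ^ q * (1 / 2) ^ q) := by
            rw [h2, mul_one]
        _ = 2 ^ q * ((1 / 2) ^ (2 * b - q) * (1 / 2) ^ q) := mul_left_comm _ _ _
        _ = _ := by rw [h1]
    have h4 : (4 : ℝ) * 2 ^ q ≤ β ^ b := by
      calc (4 : ℝ) * 2 ^ q = 2 ^ 2 * 2 ^ q := by norm_num
        _ ≤ 2 ^ q * 2 ^ q := by gcongr <;> norm_num; omega
        _ = 4 ^ q := by rw [← mul_pow]; norm_num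
        _ ≤ (β ^ M) ^ q := by gcongr
        _ = _ := by rw [← pow_mul]
    have e3 : (β / 4) ^ b = β ^ b * (1 / 4) ^ b := by rw [← mul_pow]; congr 1; ring
    have h5 : (0 : ℝ) < (1 / 4) ^ b := by positivity
    rw [e1, e2, e3]
    nlinarith

lemma cs_eq_repr_ex (t : ℝ) : cs (2 * π * t) = Complex.orthonormalBasisOneI.repr (ex t) := by
  have h : ex t = Complex.exp ((2 * π * t : ℝ) * Complex.I) := by unfold ex; push_cast; rfl
  ext i
  rw [Complex.orthonormalBasisOneI_repr_apply, h, Complex.exp_ofReal_mul_I_re,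
    Complex.exp_ofReal_mul_I_im]
  rfl

lemma two_rpow_neg_half (n : ℕ) : (2 : ℝ) ^ (-(n : ℝ) / 2) = rt ^ n := by
  rw [rt, Real.sqrt_eq_rpow, ← Real.rpow_neg (by norm_num), ← Real.rpow_natCast,
    ← Real.rpow_mul (by norm_num)]
  congr 1; ring

lemma Wfn_eq_repr_Wc (x : ℝ) : Wfn x = Complex.orthonormalBasisOneI.repr (Wc x) := by
  have := (Complex.orthonormalBasisOneI.repr.toContinuousLinearEquiv :
    ℂ ≃L[ℝ] E2).map_tsum (L := SummationFilter.unconditional ℕ)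
    (f := fun n : ℕ => (rt : ℂ) ^ n * ex (2 ^ n * x))
  rw [Wfn, Wc]
  refine Eq.trans (tsum_congr fun n => ?_) this.symm
  rw [two_rpow_neg_half, mul_assoc, cs_eq_repr_ex]
  have h : (rt : ℂ) ^ n * ex (2 ^ n * x) = (rt ^ n : ℝ) • ex (2 ^ n * x) := by
    rw [Complex.real_smul]; push_cast; rfl
  rw [h]
  exact (map_smul Complex.orthonormalBasisOneI.repr _ _).symm

lemma continuous_Wfn : Continuous Wfn := by
  have : Wfn = fun x => Complex.orthonormalBasisOneI.repr (Wc x) := funext Wfn_eq_repr_Wc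
  rw [this]
  exact Complex.orthonormalBasisOneI.repr.continuous.comp continuous_Wc

lemma dist_Wfn (x y : ℝ) : dist (Wfn x) (Wfn y) = ‖Wc x - Wc y‖ := by
  rw [Wfn_eq_repr_Wc, Wfn_eq_repr_Wc, LinearIsometryEquiv.dist_map, dist_eq_norm]

lemma norm_Wc_le (x : ℝ) : ‖Wc x‖ ≤ 4 := by
  have h := rt_lt
  have h1 : ‖Wc x‖ ≤ (1 - rt)⁻¹ :=
    tsum_of_norm_bounded (hasSum_geometric_of_lt_one rt_pos.le (by linarith))
      fun n => (norm_Wc_term n x).le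
  refine h1.trans ?_
  rw [inv_le_comm₀ (by linarith) (by norm_num)]
  linarith

lemma norm_Wc_sub_le (x : ℝ) {h : ℝ} (hh : |h| ≤ 1) : ‖Wc (x + h) - Wc x‖ ≤ 48 * √|h| := by
  rcases eq_or_ne h 0 with rfl | h0
  · simp
  obtain ⟨N, hN1, hN2⟩ := exists_nat_pow_near_of_lt_one (abs_pos.2 h0) hh
    (by norm_num : (0 : ℝ) < 1 / 2) (by norm_num)
  set z := 2 ^ N * x
  set k := 2 ^ N * h
  have hk : |k| ≤ 1 := by
    have : (2 : ℝ) ^ N * (1 / 2) ^ N = 1 := by rw [← mul_pow]; norm_num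
    rw [abs_mul, abs_of_pos (by positivity), ← this]
    gcongr
  have hz : Wc x = rt ^ N * (Wc z + Hf N z) := by rw [← Wc_div_two_pow]; congr 1; simp only [z]; field_simp
  have hzk : Wc (x + h) = rt ^ N * (Wc (z + k) + Hf N (z + k)) := by
    rw [← Wc_div_two_pow]; congr 1; simp only [z, k]; field_simp
  have h1 : ‖Wc (z + k) - Wc z + (Hf N (z + k) - Hf N z)‖ ≤ 24 := by
    have := norm_Hf_sub_le N z k
    have h2 := norm_add_le (Wc (z + k) - Wc z) (Hf N (z + k) - Hf N z)
    have h3 := norm_sub_le (Wc (z + k)) (Wc z)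
    linarith [norm_Wc_le z, norm_Wc_le (z + k)]
  have h4 : rt ^ N ≤ 2 * √|h| := by
    refine le_of_sq_le_sq ?_ (by positivity)
    rw [mul_pow, Real.sq_sqrt (abs_nonneg h), ← pow_mul, mul_comm N, rt_pow_two_mul]
    rw [pow_succ] at hN1
    linarith [abs_nonneg h]
  have e : Wc (x + h) - Wc x = (rt : ℂ) ^ N * (Wc (z + k) - Wc z + (Hf N (z + k) - Hf N z)) := by
    rw [hz, hzk]; ring
  rw [e, norm_mul, norm_pow, Complex.norm_real, Real.norm_of_nonneg rt_pos.le]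
  calc _ ≤ 2 * √|h| * 24 := by gcongr
    _ = _ := by ring

/-- The graph map of the Weierstrass function. -/
def graphMap (x : ℝ) : ℝ × E2 := (x, Wfn x)

lemma continuous_graphMap : Continuous graphMap := continuous_id.prodMk continuous_Wfn

lemma holderOnWith_graphMap : HolderOnWith 48 (1 / 2) graphMap (Icc 0 1) := by
  intro x hx y hy
  have hxy : |y - x| ≤ 1 := by rw [abs_le]; constructor <;> linarith [hx.1, hx.2, hy.1, hy.2]
  have h1 : dist (graphMap x) (graphMap y) ≤ 48 * √|y - x| := by
    rw [dist_comm, Prod.dist_eq, max_le_iff]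
    constructor
    · have h2 : |y - x| ≤ √|y - x| := by
        refine Real.le_sqrt_of_sq_le ?_
        nlinarith [abs_nonneg (y - x)]
      change |y - x| ≤ _
      linarith [Real.sqrt_nonneg |y - x|]
    · change dist (Wfn y) (Wfn x) ≤ _
      rw [dist_Wfn]
      simpa using norm_Wc_sub_le x hxy
  rw [edist_dist, edist_dist, dist_comm x y, Real.dist_eq]
  refine (ENNReal.ofReal_le_ofReal h1).trans (le_of_eq ?_)
  rw [ENNReal.ofReal_mul (by norm_num), Real.sqrt_eq_rpow,
    ← ENNReal.ofReal_rpow_of_nonneg (abs_nonneg _) (by norm_num)]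
  norm_num

lemma graph_eq_image : {p : ℝ × E2 | ∃ x ∈ Icc (0 : ℝ) 1, p = (x, Wfn x)} =
    graphMap '' Icc 0 1 := by
  ext p; simp only [mem_ofPred_eq, mem_image, graphMap, eq_comm]

lemma dimH_graph_le : dimH (graphMap '' Icc 0 1) ≤ 2 := by
  refine (holderOnWith_graphMap.dimH_image_le (by norm_num)).trans ?_
  calc dimH (Icc (0 : ℝ) 1) / ((1 / 2 : NNReal) : ENNReal) ≤ 1 / ((1 / 2 : NNReal) : ENNReal) := by
        gcongr
        exact (dimH_mono (subset_univ _)).trans_eq Real.dimH_univ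
    _ = 2 := by
        rw [ENNReal.coe_div (by norm_num)]; simp

lemma volume_graphMap_preimage_le {t : Set (ℝ × E2)} (ht : Metric.ediam t ≠ ⊤) {x : ℝ}
    (hx : graphMap x ∈ t) {R : ℝ} (hR : Metric.diam t ≤ R) :
    volume (graphMap ⁻¹' t) ≤ volume {h | |h| ≤ R ∧ ‖Wc (x + h) - Wc x‖ ≤ R} := by
  have hsub : graphMap ⁻¹' t ⊆
      (fun y => y - x) ⁻¹' {h | |h| ≤ R ∧ ‖Wc (x + h) - Wc x‖ ≤ R} := by
    intro y hy
    have h1 := (Metric.dist_le_diam_of_mem' ht hy hx).trans hR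
    rw [Prod.dist_eq, max_le_iff] at h1
    refine ⟨h1.1, ?_⟩
    rw [← dist_Wfn, add_sub_cancel]
    exact h1.2
  refine (measure_mono hsub).trans_eq ?_
  simp only [sub_eq_add_neg]
  exact measure_preimage_add_right volume (-x) _

lemma volume_graphMap_inter_le {M q₀ : ℕ} (hM : 1 ≤ M) {K : Set ℝ} {s β : ℝ} (hs : 0 < s)
    (hβ : β / 4 = (1 / 2) ^ s)
    (hK : ∀ x ∈ K, ∀ q, q₀ ≤ q → volume {h | |h| ≤ (1 / 2) ^ (M * q) ∧
      ‖Wc (x + h) - Wc x‖ ≤ (1 / 2) ^ (M * q)} ≤ ENNReal.ofReal ((β / 4) ^ (M * q)))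
    {t : Set (ℝ × E2)} (ht : Metric.ediam t ≤ ENNReal.ofReal ((1 / 2) ^ (M * q₀))) :
    volume (graphMap ⁻¹' t ∩ K) ≤ ENNReal.ofReal ((2 ^ M) ^ s) * Metric.ediam t ^ s := by
  rcases (graphMap ⁻¹' t ∩ K).eq_empty_or_nonempty with he | ⟨x, hxt, hxK⟩
  · simp [he]
  have htop : Metric.ediam t ≠ ⊤ := ne_top_of_le_ne_top ENNReal.ofReal_ne_top ht
  have hd : Metric.ediam t = ENNReal.ofReal (Metric.diam t) := (ENNReal.ofReal_toReal htop).symm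
  rcases (Metric.diam_nonneg (s := t)).eq_or_lt with h0 | h0
  · have : graphMap ⁻¹' t ⊆ {x} := by
      intro y hy
      have h1 := Metric.dist_le_diam_of_mem' htop hy hxt
      rw [← h0] at h1
      exact congrArg Prod.fst (dist_le_zero.1 h1)
    rw [measure_mono_null (inter_subset_left.trans this) Real.volume_singleton]
    exact zero_le
  have hpM : (0 : ℝ) < (1 / 2) ^ M := by positivity
  have hr : Metric.diam t ≤ (1 / 2) ^ (M * q₀) := by
    rwa [hd, ENNReal.ofReal_le_ofReal_iff (by positivity)] at ht
  have hpM1 : (1 / 2 : ℝ) ^ M < 1 := pow_lt_one₀ (by norm_num) (by norm_num) (by omega)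
  obtain ⟨q, hq1, hq2⟩ := exists_nat_pow_near_of_lt_one h0
    (hr.trans (pow_le_one₀ (by norm_num) (by norm_num))) hpM hpM1
  have hq : q₀ ≤ q := by
    by_contra hlt
    rw [pow_mul] at hr
    exact absurd (hq1.trans_le hr) (not_lt.2 (pow_le_pow_of_le_one hpM.le hpM1.le (by omega)))
  rw [← pow_mul] at hq2
  refine (measure_mono inter_subset_left).trans
    (((volume_graphMap_preimage_le htop hxt hq2).trans (hK x hxK q hq)).trans ?_)
  rw [hd, ENNReal.ofReal_rpow_of_pos h0, ← ENNReal.ofReal_mul (by positivity)]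
  refine ENNReal.ofReal_le_ofReal ?_
  rw [← Real.mul_rpow (by positivity) h0.le, hβ, ← Real.rpow_natCast, ← Real.rpow_mul (by norm_num),
    mul_comm s, Real.rpow_mul (by norm_num), Real.rpow_natCast]
  refine Real.rpow_le_rpow (by positivity) ?_ hs.le
  calc (1 / 2 : ℝ) ^ (M * q) = 2 ^ M * ((1 / 2) ^ M) ^ (q + 1) := by
        have : (2 : ℝ) ^ M * (1 / 2) ^ M = 1 := by rw [← mul_pow]; norm_num
        rw [pow_succ', ← mul_assoc, this, one_mul, pow_mul]
    _ ≤ _ := by gcongr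

lemma hausdorffMeasure_graph_ne_zero {s : ℝ} (hs : 0 < s) (hs2 : s < 2) :
    Measure.hausdorffMeasure s (graphMap '' Icc 0 1) ≠ 0 := by
  obtain ⟨M, q₀, K, hM, hK0, hK⟩ := exists_spread_set
    (Real.one_lt_rpow (by norm_num : (1 : ℝ) < 2) (sub_pos.2 hs2))
  have hβ : (2 : ℝ) ^ (2 - s) / 4 = (1 / 2) ^ s := by
    rw [Real.rpow_sub (by norm_num), Real.div_rpow (by norm_num) (by norm_num), Real.one_rpow]
    norm_num
    ring
  set c := ENNReal.ofReal ((2 ^ M) ^ s)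
  have hc0 : c ≠ 0 := by simp only [c, ne_eq, ENNReal.ofReal_eq_zero, not_le]; positivity
  have hct : c ≠ ⊤ := ENNReal.ofReal_ne_top
  have hg : Measurable graphMap := continuous_graphMap.measurable
  set ν := Measure.map graphMap (lebI.restrict K)
  have hν : c⁻¹ • ν ≤ Measure.hausdorffMeasure s := by
    refine Measure.le_hausdorffMeasure s _ (ENNReal.ofReal ((1 / 2) ^ (M * q₀)))
      (ENNReal.ofReal_pos.2 (by positivity)) fun t ht => ?_
    rw [← Metric.ediam_closure t] at ht ⊢
    refine (measure_mono subset_closure).trans ?_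
    have hm : MeasurableSet (closure t) := isClosed_closure.measurableSet
    rw [Measure.smul_apply, smul_eq_mul, ENNReal.inv_mul_le_iff hc0 hct,
      Measure.map_apply hg hm, Measure.restrict_apply (hg hm)]
    exact (Measure.restrict_apply_le _ _).trans (volume_graphMap_inter_le hM hs hβ hK ht)
  have hΓ : MeasurableSet (graphMap '' Icc 0 1) :=
    (isCompact_Icc.image continuous_graphMap).isClosed.measurableSet
  have hpos : lebI K ≤ ν (graphMap '' Icc 0 1) := by
    rw [Measure.map_apply hg hΓ, Measure.restrict_apply (hg hΓ), lebI,
      Measure.restrict_apply' measurableSet_Ico, Measure.restrict_apply' measurableSet_Ico]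
    exact measure_mono fun x hx =>
      ⟨⟨mem_image_of_mem _ (Ico_subset_Icc_self hx.2), hx.1⟩, hx.2⟩
  intro h0
  have h1 := hν (graphMap '' Icc 0 1)
  rw [h0, Measure.smul_apply, smul_eq_mul, nonpos_iff_eq_zero, mul_eq_zero] at h1
  rcases h1 with h1 | h1
  · exact hct (ENNReal.inv_eq_zero.1 h1)
  · exact hK0 (nonpos_iff_eq_zero.1 (hpos.trans h1.le))

lemma two_le_dimH_graph : 2 ≤ dimH (graphMap '' Icc 0 1) := by
  refine le_of_forall_lt_imp_le_of_dense fun d hd => ?_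
  lift d to NNReal using ne_top_of_lt hd
  have hd2 : d < 2 := by exact_mod_cast hd
  have hle : ((max d 1 : NNReal) : ENNReal) ≤ dimH (graphMap '' Icc 0 1) :=
    le_dimH_of_hausdorffMeasure_ne_zero (hausdorffMeasure_graph_ne_zero
      (by exact_mod_cast lt_max_of_lt_right one_pos) (by exact_mod_cast max_lt hd2 one_lt_two))
  exact le_trans (by exact_mod_cast le_max_left d 1) hle

/-- The Hausdorff dimension of the graph `{(x, W(x)) : x ∈ [0,1]} ⊆ ℝ × ℝ²`
of the two-dimensional Weierstrass function `W` equals `2`. -/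
theorem hausdorff_dim_graph_weierstrass_eq_two :
    dimH {p : ℝ × E2 | ∃ x ∈ Icc (0:ℝ) 1, p = (x, Wfn x)} = 2 := by
  rw [graph_eq_image]
  exact le_antisymm dimH_graph_le two_le_dimH_graph

end
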